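/- Let d ≥ 2, λ ∈ ℂ, let X ⊆ ℝ^d be an open set homeomorphic to ℝ^d, and let w : X → ℂ and ψ : X → X be smooth functions such that the weighted composition operator C_{w,ψ} : f ↦ w·(f∘ψ) is well-defined on E_λ(X) = {f : X → ℂ smooth : Δf = λf on X}, i.e. maps E_λ(X) into itself. Equip E_λ(X) with the compact-open topology. Then the following are equivalent: (i) C_{w,ψ} is topologically mixing on E_λ(X); (ii) w has no zeros, ψ is injective, ψ is strong run-away, and the derivative of ψ at every point x ∈ X is an invertible linear map (det Jψ(x) ≠ 0). -/

import Mathlib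

/-- Topological mixing. -/
def TopMixing {E : Type*} [TopologicalSpace E] (T : E → E) : Prop :=
  ∀ U V : Set E, IsOpen U → IsOpen V → U.Nonempty → V.Nonempty →
    ∃ M : ℕ, ∀ m : ℕ, M ≤ m → ((T^[m] '' U) ∩ V).Nonempty

/-- The strong run-away property. -/
def StrongRunAway {X : Type*} [TopologicalSpace X] (ψ : X → X) : Prop :=
  ∀ K : Set X, IsCompact K → ∃ M : ℕ, ∀ m : ℕ, M ≤ m → (ψ^[m] '' K) ∩ K = ∅

/-- The `j`-th partial derivative of a function on `ℝ^d`. -/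
noncomputable def pd {d : ℕ} {F : Type*} [NormedAddCommGroup F] [NormedSpace ℝ F]
    (j : Fin d) (f : EuclideanSpace ℝ (Fin d) → F) : EuclideanSpace ℝ (Fin d) → F :=
  fun x => fderiv ℝ f x (EuclideanSpace.single j 1)

/-- The Laplacian `Δf = ∑ⱼ ∂ⱼ²f` of a function on `ℝ^d`. -/
noncomputable def lap {d : ℕ} {F : Type*} [NormedAddCommGroup F] [NormedSpace ℝ F]
    (f : EuclideanSpace ℝ (Fin d) → F) : EuclideanSpace ℝ (Fin d) → F :=
  fun x => ∑ j, pd j (pd j f) x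

/-- The eigenspace `E_λ(X) = {f : X → ℂ smooth, Δf = λf}`, realized as the set of those
continuous functions on `X` (an open subset of `ℝ^d`) which agree on `X` with a function that
is smooth on `X` and satisfies `Δg = λg` there. -/
def Eig (d : ℕ) (lam : ℂ) (X : Set (EuclideanSpace ℝ (Fin d))) : Set C(↥X, ℂ) :=
  {f | ∃ g : EuclideanSpace ℝ (Fin d) → ℂ, ContDiffOn ℝ (⊤ : ℕ∞) g X ∧
    (∀ x ∈ X, lap g x = lam * g x) ∧ ∀ z : ↥X, f z = g ↑z}

/-- The weighted composition operator `C_{w,ψ} f = w·(f∘ψ)` on `C(X, ℂ)`. -/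
noncomputable def wcomp {d : ℕ} (X : Set (EuclideanSpace ℝ (Fin d)))
    (w : EuclideanSpace ℝ (Fin d) → ℂ)
    (ψ : EuclideanSpace ℝ (Fin d) → EuclideanSpace ℝ (Fin d))
    (hw : ContinuousOn w X) (hψ : ContinuousOn ψ X) (hm : Set.MapsTo ψ X X) :
    C(↥X, ℂ) → C(↥X, ℂ) :=
  fun f => ⟨fun x => w ↑x * f ⟨ψ ↑x, hm x.2⟩, by
    exact (hw.restrict).mul (f.continuous.comp ((hψ.restrict).subtype_mk fun x => hm x.2))⟩

section Calculus

variable {d : ℕ} {F : Type*} [NormedAddCommGroup F] [NormedSpace ℝ F]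

theorem pd_congr {f g : EuclideanSpace ℝ (Fin d) → F} {x : EuclideanSpace ℝ (Fin d)}
    (h : f =ᶠ[nhds x] g) (j : Fin d) : pd j f =ᶠ[nhds x] pd j g :=
  (Filter.EventuallyEq.fderiv (𝕜 := ℝ) h).mono fun y hy => by simp only [pd, hy]

theorem lap_congr {f g : EuclideanSpace ℝ (Fin d) → F} {x : EuclideanSpace ℝ (Fin d)}
    (h : f =ᶠ[nhds x] g) : lap f =ᶠ[nhds x] lap g := by
  have : ∀ᶠ y in nhds x, ∀ j, pd j (pd j f) y = pd j (pd j g) y :=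
    Filter.eventually_all.2 fun j => pd_congr (pd_congr h j) j
  exact this.mono fun y hy => Finset.sum_congr rfl fun j _ => hy j

theorem ContDiffAt.pd {f : EuclideanSpace ℝ (Fin d) → F} {x : EuclideanSpace ℝ (Fin d)}
    (h : ContDiffAt ℝ (⊤ : ℕ∞) f x) (j : Fin d) : ContDiffAt ℝ (⊤ : ℕ∞) (pd j f) x :=
  (h.fderiv_right (m := ((⊤ : ℕ∞) : WithTop ℕ∞)) le_rfl).clm_apply contDiffAt_const

theorem ContDiff.pd {f : EuclideanSpace ℝ (Fin d) → F}
    (h : ContDiff ℝ (⊤ : ℕ∞) f) (j : Fin d) : ContDiff ℝ (⊤ : ℕ∞) (pd j f) :=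
  contDiff_iff_contDiffAt.2 fun _ => h.contDiffAt.pd j

theorem ContDiffAt.lap {f : EuclideanSpace ℝ (Fin d) → F} {x : EuclideanSpace ℝ (Fin d)}
    (h : ContDiffAt ℝ (⊤ : ℕ∞) f x) : ContDiffAt ℝ (⊤ : ℕ∞) (lap f) x :=
  ContDiffAt.sum fun j _ => (h.pd j).pd j

theorem ContDiff.lap {f : EuclideanSpace ℝ (Fin d) → F}
    (h : ContDiff ℝ (⊤ : ℕ∞) f) : ContDiff ℝ (⊤ : ℕ∞) (lap f) :=
  contDiff_iff_contDiffAt.2 fun _ => h.contDiffAt.lap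

theorem differentiableAt_of_smooth {f : EuclideanSpace ℝ (Fin d) → F}
    {x : EuclideanSpace ℝ (Fin d)} (h : ContDiffAt ℝ (⊤ : ℕ∞) f x) : DifferentiableAt ℝ f x :=
  h.differentiableAt (by simp)

theorem eventually_differentiableAt {f : EuclideanSpace ℝ (Fin d) → F}
    {x : EuclideanSpace ℝ (Fin d)} (h : ContDiffAt ℝ (⊤ : ℕ∞) f x) :
    ∀ᶠ y in nhds x, DifferentiableAt ℝ f y :=
  ((h.of_le (m := 1) (by exact_mod_cast le_top)).eventually (by simp)).mono
    fun _ hy => hy.differentiableAt (by simp)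

theorem fderiv_eq_sum_pd (f : EuclideanSpace ℝ (Fin d) → F) (x v : EuclideanSpace ℝ (Fin d)) :
    fderiv ℝ f x v = ∑ k, v k • pd k f x := by
  have hv : v = ∑ k, v k • EuclideanSpace.single k (1 : ℝ) := by
    ext i
    simp [Finset.sum_apply, Pi.single_apply]
  conv_lhs => rw [hv]
  simp [pd]

theorem pd_add {f g : EuclideanSpace ℝ (Fin d) → F} {x : EuclideanSpace ℝ (Fin d)}
    (hf : DifferentiableAt ℝ f x) (hg : DifferentiableAt ℝ g x) (j : Fin d) :
    pd j (fun y => f y + g y) x = pd j f x + pd j g x := by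
  simp only [pd]
  rw [fderiv_fun_add hf hg]; rfl

theorem pd_sub {f g : EuclideanSpace ℝ (Fin d) → F} {x : EuclideanSpace ℝ (Fin d)}
    (hf : DifferentiableAt ℝ f x) (hg : DifferentiableAt ℝ g x) (j : Fin d) :
    pd j (fun y => f y - g y) x = pd j f x - pd j g x := by
  simp only [pd]
  rw [fderiv_fun_sub hf hg]; rfl

theorem pd_sum {ι : Type*} (s : Finset ι) {f : ι → EuclideanSpace ℝ (Fin d) → F}
    {x : EuclideanSpace ℝ (Fin d)}
    (hf : ∀ i ∈ s, DifferentiableAt ℝ (f i) x) (j : Fin d) :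
    pd j (fun y => ∑ i ∈ s, f i y) x = ∑ i ∈ s, pd j (f i) x := by
  simp only [pd]
  rw [fderiv_fun_sum hf, _root_.sum_apply]

theorem lap_sub {f g : EuclideanSpace ℝ (Fin d) → F} {x : EuclideanSpace ℝ (Fin d)}
    (hf : ContDiffAt ℝ (⊤ : ℕ∞) f x) (hg : ContDiffAt ℝ (⊤ : ℕ∞) g x) :
    lap (fun y => f y - g y) x = lap f x - lap g x := by
  simp only [lap, ← Finset.sum_sub_distrib]
  refine Finset.sum_congr rfl fun j _ => ?_
  have h : pd j (fun y => f y - g y) =ᶠ[nhds x] fun y => pd j f y - pd j g y := by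
    filter_upwards [eventually_differentiableAt hf, eventually_differentiableAt hg] with y h1 h2
    exact pd_sub h1 h2 j
  rw [(pd_congr h j).eq_of_nhds,
    pd_sub (differentiableAt_of_smooth (hf.pd j)) (differentiableAt_of_smooth (hg.pd j))]

theorem lap_add {f g : EuclideanSpace ℝ (Fin d) → F} {x : EuclideanSpace ℝ (Fin d)}
    (hf : ContDiffAt ℝ (⊤ : ℕ∞) f x) (hg : ContDiffAt ℝ (⊤ : ℕ∞) g x) :
    lap (fun y => f y + g y) x = lap f x + lap g x := by
  simp only [lap, ← Finset.sum_add_distrib]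
  refine Finset.sum_congr rfl fun j _ => ?_
  have h : pd j (fun y => f y + g y) =ᶠ[nhds x] fun y => pd j f y + pd j g y := by
    filter_upwards [eventually_differentiableAt hf, eventually_differentiableAt hg] with y h1 h2
    exact pd_add h1 h2 j
  rw [(pd_congr h j).eq_of_nhds,
    pd_add (differentiableAt_of_smooth (hf.pd j)) (differentiableAt_of_smooth (hg.pd j))]

theorem pd_mul {f g : EuclideanSpace ℝ (Fin d) → ℂ} {x : EuclideanSpace ℝ (Fin d)}
    (hf : DifferentiableAt ℝ f x) (hg : DifferentiableAt ℝ g x) (j : Fin d) :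
    pd j (fun y => f y * g y) x = f x * pd j g x + pd j f x * g x := by
  simp only [pd]
  rw [fderiv_fun_mul hf hg]
  simp [mul_comm]

theorem pd_pd_mul {f g : EuclideanSpace ℝ (Fin d) → ℂ} {x : EuclideanSpace ℝ (Fin d)}
    (hf : ContDiffAt ℝ (⊤ : ℕ∞) f x) (hg : ContDiffAt ℝ (⊤ : ℕ∞) g x) (j : Fin d) :
    pd j (pd j (fun y => f y * g y)) x =
      f x * pd j (pd j g) x + 2 * (pd j f x * pd j g x) + pd j (pd j f) x * g x := by
  have h : pd j (fun y => f y * g y) =ᶠ[nhds x] fun y => f y * pd j g y + pd j f y * g y := by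
    filter_upwards [eventually_differentiableAt hf, eventually_differentiableAt hg] with y h1 h2
    exact pd_mul h1 h2 j
  have hf' := differentiableAt_of_smooth hf
  have hg' := differentiableAt_of_smooth hg
  have hfj := differentiableAt_of_smooth (hf.pd j)
  have hgj := differentiableAt_of_smooth (hg.pd j)
  rw [(pd_congr h j).eq_of_nhds, pd_add (hf'.fun_mul hgj) (hfj.fun_mul hg'), pd_mul hf' hgj,
    pd_mul hfj hg']
  ring

theorem lap_mul {f g : EuclideanSpace ℝ (Fin d) → ℂ} {x : EuclideanSpace ℝ (Fin d)}
    (hf : ContDiffAt ℝ (⊤ : ℕ∞) f x) (hg : ContDiffAt ℝ (⊤ : ℕ∞) g x) :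
    lap (fun y => f y * g y) x =
      f x * lap g x + 2 * ∑ j, pd j f x * pd j g x + lap f x * g x := by
  simp only [lap, pd_pd_mul hf hg, Finset.sum_add_distrib, Finset.mul_sum, Finset.sum_mul]

/-- The complexified coordinate functions of a map into `ℝ^d`. -/
def ccoord (ψ : EuclideanSpace ℝ (Fin d) → EuclideanSpace ℝ (Fin d)) (k : Fin d) :
    EuclideanSpace ℝ (Fin d) → ℂ := fun x => ((ψ x k : ℝ) : ℂ)

theorem smooth_ccoord {ψ : EuclideanSpace ℝ (Fin d) → EuclideanSpace ℝ (Fin d)}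
    {x : EuclideanSpace ℝ (Fin d)} (h : ContDiffAt ℝ (⊤ : ℕ∞) ψ x) (k : Fin d) :
    ContDiffAt ℝ (⊤ : ℕ∞) (ccoord ψ k) x :=
  Complex.ofRealCLM.contDiff.contDiffAt.comp x
    ((EuclideanSpace.proj (𝕜 := ℝ) k).contDiff.contDiffAt.comp x h)

theorem pd_ccoord {ψ : EuclideanSpace ℝ (Fin d) → EuclideanSpace ℝ (Fin d)}
    {x : EuclideanSpace ℝ (Fin d)} (h : DifferentiableAt ℝ ψ x) (j k : Fin d) :
    pd j (ccoord ψ k) x = ((fderiv ℝ ψ x (EuclideanSpace.single j 1) k : ℝ) : ℂ) := by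
  have h2 : HasFDerivAt (ccoord ψ k)
      (Complex.ofRealCLM.comp ((EuclideanSpace.proj (𝕜 := ℝ) k).comp (fderiv ℝ ψ x))) x :=
    Complex.ofRealCLM.hasFDerivAt.comp x
      ((EuclideanSpace.proj (𝕜 := ℝ) k).hasFDerivAt.comp x h.hasFDerivAt)
  simp [pd, h2.fderiv]

theorem pd_comp {ψ : EuclideanSpace ℝ (Fin d) → EuclideanSpace ℝ (Fin d)}
    {f : EuclideanSpace ℝ (Fin d) → ℂ} {x : EuclideanSpace ℝ (Fin d)}
    (h : DifferentiableAt ℝ ψ x) (hf : DifferentiableAt ℝ f (ψ x)) (j : Fin d) :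
    pd j (fun y => f (ψ y)) x = ∑ k, pd j (ccoord ψ k) x * pd k f (ψ x) := by
  have : fderiv ℝ (fun y => f (ψ y)) x = (fderiv ℝ f (ψ x)).comp (fderiv ℝ ψ x) :=
    fderiv_comp x hf h
  simp only [pd_ccoord h]
  rw [pd, this, ContinuousLinearMap.comp_apply, fderiv_eq_sum_pd]
  simp

theorem lap_comp {ψ : EuclideanSpace ℝ (Fin d) → EuclideanSpace ℝ (Fin d)}
    {f : EuclideanSpace ℝ (Fin d) → ℂ} {x : EuclideanSpace ℝ (Fin d)}
    (h : ContDiffAt ℝ (⊤ : ℕ∞) ψ x) (hf : ContDiffAt ℝ (⊤ : ℕ∞) f (ψ x)) :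
    lap (fun y => f (ψ y)) x = ∑ k, lap (ccoord ψ k) x * pd k f (ψ x) +
      ∑ k, ∑ l, (∑ j, pd j (ccoord ψ k) x * pd j (ccoord ψ l) x) * pd l (pd k f) (ψ x) := by
  have key : ∀ j, pd j (pd j (fun y => f (ψ y))) x =
      ∑ k, (pd j (pd j (ccoord ψ k)) x * pd k f (ψ x) +
      ∑ l, pd j (ccoord ψ k) x * pd j (ccoord ψ l) x * pd l (pd k f) (ψ x)) := by
    intro j
    have h1 : pd j (fun y => f (ψ y)) =ᶠ[nhds x]
        fun y => ∑ k, pd j (ccoord ψ k) y * pd k f (ψ y) := by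
      filter_upwards [eventually_differentiableAt h, h.continuousAt.eventually (eventually_differentiableAt hf)]
        with y h1 h2
      exact pd_comp h1 h2 j
    have hc : ∀ k, DifferentiableAt ℝ (fun y => pd k f (ψ y)) x := fun k =>
      differentiableAt_of_smooth ((hf.pd k).comp x h)
    have hp : ∀ k, DifferentiableAt ℝ (pd j (ccoord ψ k)) x := fun k =>
      differentiableAt_of_smooth ((smooth_ccoord h k).pd j)
    rw [(pd_congr h1 j).eq_of_nhds, pd_sum _ (fun k _ => (hp k).fun_mul (hc k))]
    refine Finset.sum_congr rfl fun k _ => ?_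
    rw [pd_mul (hp k) (hc k), pd_comp (differentiableAt_of_smooth h)
      (differentiableAt_of_smooth (hf.pd k)), Finset.mul_sum, add_comm]
    simp only [mul_assoc]
  simp only [lap, key, Finset.sum_add_distrib, Finset.sum_mul]
  congr 1
  · exact Finset.sum_comm
  · rw [Finset.sum_comm]
    exact Finset.sum_congr rfl fun k _ => Finset.sum_comm

theorem lap_mul_comp {ψ : EuclideanSpace ℝ (Fin d) → EuclideanSpace ℝ (Fin d)}
    {f w : EuclideanSpace ℝ (Fin d) → ℂ} {x : EuclideanSpace ℝ (Fin d)}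
    (hw : ContDiffAt ℝ (⊤ : ℕ∞) w x) (h : ContDiffAt ℝ (⊤ : ℕ∞) ψ x)
    (hf : ContDiffAt ℝ (⊤ : ℕ∞) f (ψ x)) :
    lap (fun y => w y * f (ψ y)) x = lap w x * f (ψ x) +
      ∑ k, (w x * lap (ccoord ψ k) x + 2 * ∑ j, pd j w x * pd j (ccoord ψ k) x) *
        pd k f (ψ x) +
      ∑ k, ∑ l, (w x * ∑ j, pd j (ccoord ψ k) x * pd j (ccoord ψ l) x) *
        pd l (pd k f) (ψ x) := by
  rw [lap_mul hw (g := fun y => f (ψ y)) (hf.comp x h), lap_comp h hf]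
  simp only [pd_comp (differentiableAt_of_smooth h) (differentiableAt_of_smooth hf)]
  have e1 : ∑ j, pd j w x * ∑ k, pd j (ccoord ψ k) x * pd k f (ψ x) =
      ∑ k, (∑ j, pd j w x * pd j (ccoord ψ k) x) * pd k f (ψ x) := by
    simp only [Finset.mul_sum, Finset.sum_mul, mul_assoc]
    exact Finset.sum_comm
  rw [e1]
  simp only [add_mul, Finset.sum_add_distrib, mul_add, Finset.mul_sum, mul_assoc]
  ring_nf
  simp only [Finset.sum_mul, Finset.mul_sum]
  ring_nf

/-- The exponential `x ↦ exp (∑ ζᵢ xᵢ)`. -/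
noncomputable def expo (ζ : Fin d → ℂ) : EuclideanSpace ℝ (Fin d) → ℂ :=
  fun x => Complex.exp (∑ i, ζ i * (x i : ℂ))

theorem hasFDerivAt_expo (ζ : Fin d → ℂ) (x : EuclideanSpace ℝ (Fin d)) :
    HasFDerivAt (expo ζ) (expo ζ x • ∑ i, ζ i •
      (Complex.ofRealCLM.comp (EuclideanSpace.proj (𝕜 := ℝ) i))) x := by
  have h : HasFDerivAt (fun x : EuclideanSpace ℝ (Fin d) => ∑ i, ζ i * (x i : ℂ))
      (∑ i, ζ i • (Complex.ofRealCLM.comp (EuclideanSpace.proj (𝕜 := ℝ) i))) x := by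
    refine HasFDerivAt.fun_sum fun i _ => ?_
    exact ((Complex.ofRealCLM.comp
      (EuclideanSpace.proj (𝕜 := ℝ) i)).hasFDerivAt (x := x)).const_mul (ζ i)
  exact h.cexp

theorem pd_expo (ζ : Fin d → ℂ) (j : Fin d) : pd j (expo ζ) = fun x => ζ j * expo ζ x := by
  funext x
  rw [pd, (hasFDerivAt_expo ζ x).fderiv]
  simp [apply_ite, mul_comm]

theorem contDiff_expo (ζ : Fin d → ℂ) : ContDiff ℝ (⊤ : ℕ∞) (expo ζ) := by
  refine ContDiff.cexp (ContDiff.sum fun i _ => contDiff_const.mul ?_)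
  exact (Complex.ofRealCLM.comp (EuclideanSpace.proj (𝕜 := ℝ) i)).contDiff

theorem pd_const_mul (c : ℂ) {f : EuclideanSpace ℝ (Fin d) → ℂ} {x : EuclideanSpace ℝ (Fin d)}
    (hf : DifferentiableAt ℝ f x) (j : Fin d) :
    pd j (fun y => c * f y) x = c * pd j f x := by
  rw [pd, fderiv_const_mul hf]; rfl

theorem pd_pd_expo (ζ : Fin d → ℂ) (j k : Fin d) :
    pd k (pd j (expo ζ)) = fun x => ζ j * ζ k * expo ζ x := by
  funext x
  rw [pd_expo, pd_const_mul _ (differentiableAt_of_smooth (contDiff_expo ζ).contDiffAt), pd_expo]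
  ring

theorem lap_expo (ζ : Fin d → ℂ) : lap (expo ζ) = fun x => (∑ i, ζ i ^ 2) * expo ζ x := by
  funext x
  simp only [lap, pd_pd_expo, Finset.sum_mul, sq]

end Calculus

section Jet

variable {d : ℕ}

theorem sum_mul_single_add_single (B : Fin d → ℂ) (j k : Fin d) (α β : ℂ) :
    ∑ i, B i * (Pi.single j α + Pi.single k β : Fin d → ℂ) i = B j * α + B k * β := by
  simp [mul_add, Finset.sum_add_distrib, Pi.single_apply]

theorem sum_sq_single_add_single {j k : Fin d} (hjk : j ≠ k) (α β : ℂ) :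
    ∑ i, (Pi.single j α + Pi.single k β : Fin d → ℂ) i ^ 2 = α ^ 2 + β ^ 2 := by
  simp only [sq]
  rw [sum_mul_single_add_single]
  simp [hjk, hjk.symm]

theorem exists_sq_add_sq (lam α : ℂ) : ∃ β : ℂ, α ^ 2 + β ^ 2 = lam := by
  obtain ⟨β, hβ⟩ := IsAlgClosed.exists_pow_nat_eq (lam - α ^ 2) (n := 2) (by norm_num)
  exact ⟨β, by rw [hβ]; ring⟩

theorem quadratic_vanishing_on_quadric (hd : 2 ≤ d) {lam A : ℂ} {B : Fin d → ℂ}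
    {C : Fin d → Fin d → ℂ} (hC : ∀ k l, C k l = C l k)
    (h : ∀ ζ : Fin d → ℂ, ∑ i, ζ i ^ 2 = lam →
      A + ∑ k, B k * ζ k + ∑ k, ∑ l, C k l * (ζ k * ζ l) = 0) (i : Fin d) :
    (∀ k, B k = 0) ∧ (∀ k l, k ≠ l → C k l = 0) ∧ (∀ k, C k k = C i i) ∧ A = -C i i * lam := by
  have : Nontrivial (Fin d) := Fin.nontrivial_iff_two_le.2 hd
  have key : ∀ j k, j ≠ k → ∀ α β : ℂ, α ^ 2 + β ^ 2 = lam →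
      A + (B j * α + B k * β) +
        (C j j * α ^ 2 + 2 * C j k * (α * β) + C k k * β ^ 2) = 0 := by
    intro j k hjk α β hab
    have := h (Pi.single j α + Pi.single k β) (by rw [sum_sq_single_add_single hjk, hab])
    rw [sum_mul_single_add_single] at this
    have e : ∀ a, ∑ l, C a l * ((Pi.single j α + Pi.single k β : Fin d → ℂ) a *
        (Pi.single j α + Pi.single k β : Fin d → ℂ) l) =
        (C a j * α + C a k * β) * (Pi.single j α + Pi.single k β : Fin d → ℂ) a := by
      intro a
      rw [← sum_mul_single_add_single, Finset.sum_mul]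
      exact Finset.sum_congr rfl fun _ _ => by ring
    simp only [e] at this
    rw [sum_mul_single_add_single (fun a => C a j * α + C a k * β)] at this
    rw [hC k j] at this
    linear_combination this
  have hA : ∀ j k, j ≠ k → A = -C k k * lam := by
    intro j k hjk
    obtain ⟨β, hβ⟩ := exists_sq_add_sq lam 0
    have h1 := key j k hjk 0 β hβ
    have h2 := key j k hjk 0 (-β) (by linear_combination hβ)
    linear_combination (h1 + h2) / 2 - C k k * hβ
  have hA' : ∀ k, A = -C k k * lam := fun k => by
    obtain ⟨j, hj⟩ := exists_ne k
    exact hA j k hj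
  have hdiag : ∀ j k, C j j = C k k := by
    intro j k
    by_cases hjk : j = k
    · rw [hjk]
    obtain ⟨β, hβ⟩ := exists_sq_add_sq lam 1
    have h1 := key j k hjk 1 β hβ
    have h2 := key j k hjk (-1) (-β) (by linear_combination hβ)
    have h3 := key j k hjk 1 (-β) (by linear_combination hβ)
    have h4 := key j k hjk (-1) (β) (by linear_combination hβ)
    linear_combination (h1 + h2 + h3 + h4) / 4 - C k k * hβ - hA' k
  refine ⟨fun j => ?_, fun j k hjk => ?_, fun k => hdiag k i, hA' i⟩
  · obtain ⟨k, hk⟩ := exists_ne j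
    obtain ⟨β, hβ⟩ := exists_sq_add_sq lam 1
    have h1 := key j k hk.symm 1 β hβ
    have h2 := key j k hk.symm (-1) (-β) (by linear_combination hβ)
    have h3 := key j k hk.symm 1 (-β) (by linear_combination hβ)
    have h4 := key j k hk.symm (-1) (β) (by linear_combination hβ)
    linear_combination (h1 - h2 + h3 - h4) / 4
  · obtain ⟨α, β, hα, hβ, hab⟩ : ∃ α β : ℂ, α ≠ 0 ∧ β ≠ 0 ∧ α ^ 2 + β ^ 2 = lam := by
      by_cases hl : lam = 1
      · obtain ⟨β, hβ⟩ := exists_sq_add_sq lam 2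
        refine ⟨2, β, by norm_num, ?_, hβ⟩
        rintro rfl
        rw [hl] at hβ
        norm_num at hβ
      · obtain ⟨β, hβ⟩ := exists_sq_add_sq lam 1
        refine ⟨1, β, by norm_num, ?_, hβ⟩
        rintro rfl
        exact hl (by rw [← hβ]; ring)
    have h1 := key j k hjk α β hab
    have h2 := key j k hjk (-α) (-β) (by linear_combination hab)
    have h3 := key j k hjk α (-β) (by linear_combination hab)
    have h4 := key j k hjk (-α) (β) (by linear_combination hab)
    have : C j k * (α * β) = 0 := by linear_combination (h1 + h2 - h3 - h4) / 8
    simpa [hα, hβ] using this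

/-- The weighted conformal factor of a smooth map. -/
noncomputable def confFactor (w : EuclideanSpace ℝ (Fin d) → ℂ)
    (ψ : EuclideanSpace ℝ (Fin d) → EuclideanSpace ℝ (Fin d)) (i : Fin d)
    (x : EuclideanSpace ℝ (Fin d)) : ℂ :=
  w x * ∑ j, pd j (ccoord ψ i) x * pd j (ccoord ψ i) x

theorem lap_mul_comp_sub (hd : 2 ≤ d) {lam : ℂ}
    {ψ : EuclideanSpace ℝ (Fin d) → EuclideanSpace ℝ (Fin d)}
    {w : EuclideanSpace ℝ (Fin d) → ℂ} {x : EuclideanSpace ℝ (Fin d)}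
    (hw : ContDiffAt ℝ (⊤ : ℕ∞) w x) (hψ : ContDiffAt ℝ (⊤ : ℕ∞) ψ x)
    (hE : ∀ ζ : Fin d → ℂ, ∑ i, ζ i ^ 2 = lam →
      lap (fun y => w y * expo ζ (ψ y)) x = lam * (w x * expo ζ (ψ x)))
    {f : EuclideanSpace ℝ (Fin d) → ℂ} (hf : ContDiffAt ℝ (⊤ : ℕ∞) f (ψ x)) (i : Fin d) :
    lap (fun y => w y * f (ψ y)) x - lam * (w x * f (ψ x)) =
      confFactor w ψ i x * (lap f (ψ x) - lam * f (ψ x)) := by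
  obtain ⟨hB, hoff, hdiag, hA⟩ := quadratic_vanishing_on_quadric hd (lam := lam)
    (A := lap w x - lam * w x)
    (B := fun k => w x * lap (ccoord ψ k) x + 2 * ∑ j, pd j w x * pd j (ccoord ψ k) x)
    (C := fun k l => w x * ∑ j, pd j (ccoord ψ k) x * pd j (ccoord ψ l) x)
    (fun k l => by simp only [mul_comm]) (fun ζ hζ => by
      have h := hE ζ hζ
      rw [lap_mul_comp hw hψ (contDiff_expo ζ).contDiffAt] at h
      simp only [pd_pd_expo] at h
      simp only [pd_expo] at h
      have hne : expo ζ (ψ x) ≠ 0 := Complex.exp_ne_zero _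
      refine mul_right_cancel₀ hne ?_
      rw [zero_mul, add_mul, add_mul, Finset.sum_mul, Finset.sum_mul]
      simp only [Finset.sum_mul _ _ (expo ζ (ψ x)), mul_assoc _ _ (expo ζ (ψ x))] at h ⊢
      linear_combination h) i
  rw [lap_mul_comp hw hψ hf]
  simp only [hB, zero_mul, Finset.sum_const_zero]
  have : ∀ k, ∑ l, (w x * ∑ j, pd j (ccoord ψ k) x * pd j (ccoord ψ l) x) *
        pd l (pd k f) (ψ x) = confFactor w ψ i x * pd k (pd k f) (ψ x) := by
    intro k
    rw [Finset.sum_eq_single k]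
    · rw [hdiag k]; rfl
    · intro l _ hl
      rw [hoff k l hl.symm, zero_mul]
    · simp
  simp only [this, ← Finset.mul_sum]
  simp only [confFactor, lap] at hA ⊢
  linear_combination f (ψ x) * hA

theorem confFactor_ne_zero {ψ : EuclideanSpace ℝ (Fin d) → EuclideanSpace ℝ (Fin d)}
    {w : EuclideanSpace ℝ (Fin d) → ℂ} {x : EuclideanSpace ℝ (Fin d)}
    (hw : w x ≠ 0) (hψ : DifferentiableAt ℝ ψ x) (hs : Function.Surjective (fderiv ℝ ψ x))
    (i : Fin d) : confFactor w ψ i x ≠ 0 := by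
  refine mul_ne_zero hw fun h => ?_
  simp only [pd_ccoord hψ] at h
  have h' : ∑ j, fderiv ℝ ψ x (EuclideanSpace.single j 1) i *
      fderiv ℝ ψ x (EuclideanSpace.single j 1) i = 0 := by
    rw [← Complex.ofReal_inj, Complex.ofReal_zero, ← h]
    push_cast
    rfl
  rw [Finset.sum_eq_zero_iff_of_nonneg (fun _ _ => mul_self_nonneg _)] at h'
  have h0 : ∀ j, fderiv ℝ ψ x (EuclideanSpace.single j 1) i = 0 := fun j =>
    mul_self_eq_zero.1 (h' j (Finset.mem_univ j))
  obtain ⟨v, hv⟩ := hs (EuclideanSpace.single i 1)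
  have h1 : fderiv ℝ ψ x v i = 1 := by rw [hv]; simp
  rw [fderiv_eq_sum_pd] at h1
  simp [pd, h0] at h1

/-- Solutions can be transported along `f ↦ w · (f ∘ ψ)`. -/
theorem exists_transport (hd : 2 ≤ d) {lam : ℂ} {U : Set (EuclideanSpace ℝ (Fin d))}
    (hU : IsOpen U)
    {ψ : EuclideanSpace ℝ (Fin d) → EuclideanSpace ℝ (Fin d)}
    {w : EuclideanSpace ℝ (Fin d) → ℂ}
    (hw : ContDiffOn ℝ (⊤ : ℕ∞) w U) (hψ : ContDiffOn ℝ (⊤ : ℕ∞) ψ U)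
    (hw0 : ∀ x ∈ U, w x ≠ 0) (hinj : Set.InjOn ψ U)
    (hbij : ∀ x ∈ U, Function.Bijective (fderiv ℝ ψ x))
    (hE : ∀ x ∈ U, ∀ ζ : Fin d → ℂ, ∑ i, ζ i ^ 2 = lam →
      lap (fun y => w y * expo ζ (ψ y)) x = lam * (w x * expo ζ (ψ x)))
    {h : EuclideanSpace ℝ (Fin d) → ℂ} (hh : ContDiffOn ℝ (⊤ : ℕ∞) h U)
    (hlap : ∀ x ∈ U, lap h x = lam * h x) :
    IsOpen (ψ '' U) ∧ ∃ h' : EuclideanSpace ℝ (Fin d) → ℂ, ContDiffOn ℝ (⊤ : ℕ∞) h' (ψ '' U) ∧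
      (∀ y ∈ ψ '' U, lap h' y = lam * h' y) ∧ ∀ x ∈ U, w x * h' (ψ x) = h x := by
  have hUn : ∀ x ∈ U, U ∈ nhds x := fun x hx => hU.mem_nhds hx
  have hst : ∀ x (hx : x ∈ U), ∃ e : EuclideanSpace ℝ (Fin d) ≃L[ℝ] EuclideanSpace ℝ (Fin d),
      HasFDerivAt ψ (e : EuclideanSpace ℝ (Fin d) →L[ℝ] EuclideanSpace ℝ (Fin d)) x := by
    intro x hx
    refine ⟨(LinearEquiv.ofBijective (fderiv ℝ ψ x).toLinearMap
      (hbij x hx)).toContinuousLinearEquiv, ?_⟩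
    have := (differentiableAt_of_smooth (hψ.contDiffAt (hUn x hx))).hasFDerivAt
    exact this.congr_fderiv (ContinuousLinearMap.ext fun v => rfl)
  have hloc : ∀ x ∈ U, ψ '' U ∈ nhds (ψ x) ∧
      ContDiffAt ℝ (⊤ : ℕ∞) (Function.invFunOn ψ U) (ψ x) := by
    intro x hx
    obtain ⟨e, he⟩ := hst x hx
    have hc := hψ.contDiffAt (hUn x hx)
    have hn : ((⊤ : ℕ∞) : WithTop ℕ∞) ≠ 0 := by simp
    have hs := hc.hasStrictFDerivAt' he hn
    have hinv : ContDiffAt ℝ (⊤ : ℕ∞) (hc.localInverse he hn) (ψ x) :=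
      hc.to_localInverse he hn
    have hright := hs.eventually_right_inverse
    have hself : hs.localInverse ψ e x (ψ x) = x := hs.localInverse_apply_image
    have hmem : ∀ᶠ y in nhds (ψ x), hs.localInverse ψ e x y ∈ U := by
      have := hs.localInverse_continuousAt
      refine this.eventually ?_
      rw [hself]
      exact hUn x hx
    refine ⟨?_, hinv.congr_of_eventuallyEq ?_⟩
    · filter_upwards [hright, hmem] with y h1 h2 using ⟨_, h2, h1⟩
    · filter_upwards [hright, hmem] with y h1 h2
      have : y ∈ ψ '' U := ⟨_, h2, h1⟩
      refine hinj (Function.invFunOn_mem this) h2 ?_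
      exact (Function.invFunOn_eq this).trans h1.symm
  have hleft : ∀ x ∈ U, Function.invFunOn ψ U (ψ x) = x := fun x hx =>
    hinj.leftInvOn_invFunOn hx
  have hopen : IsOpen (ψ '' U) := isOpen_iff_mem_nhds.2 <| by
    rintro _ ⟨x, hx, rfl⟩
    exact (hloc x hx).1
  have hid : ∀ x ∈ U, w x * (h (Function.invFunOn ψ U (ψ x)) /
      w (Function.invFunOn ψ U (ψ x))) = h x := fun x hx => by
    rw [hleft x hx]
    exact mul_div_cancel₀ _ (hw0 x hx)
  have hsm : ∀ x ∈ U, ContDiffAt ℝ (⊤ : ℕ∞)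
      (fun y => h (Function.invFunOn ψ U y) / w (Function.invFunOn ψ U y)) (ψ x) := by
    intro x hx
    have hg := (hloc x hx).2
    have h1 : ContDiffAt ℝ (⊤ : ℕ∞) h (Function.invFunOn ψ U (ψ x)) := by
      rw [hleft x hx]; exact hh.contDiffAt (hUn x hx)
    have h2 : ContDiffAt ℝ (⊤ : ℕ∞) w (Function.invFunOn ψ U (ψ x)) := by
      rw [hleft x hx]; exact hw.contDiffAt (hUn x hx)
    simp only [div_eq_mul_inv]
    exact (h1.comp (ψ x) hg).mul ((h2.comp (ψ x) hg).inv
      (by simpa only [Function.comp, hleft x hx] using hw0 x hx))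
  refine ⟨hopen, fun y => h (Function.invFunOn ψ U y) / w (Function.invFunOn ψ U y), ?_, ?_, hid⟩
  · rintro _ ⟨x, hx, rfl⟩
    exact (hsm x hx).contDiffWithinAt
  · rintro _ ⟨x, hx, rfl⟩
    have hc := hψ.contDiffAt (hUn x hx)
    let i : Fin d := ⟨0, by omega⟩
    have key := lap_mul_comp_sub hd (hw.contDiffAt (hUn x hx)) hc (hE x hx) (hsm x hx) i
    have hne := confFactor_ne_zero (hw0 x hx) (differentiableAt_of_smooth hc)
      (hbij x hx).surjective i
    have hev : (fun y => w y * (h (Function.invFunOn ψ U (ψ y)) /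
        w (Function.invFunOn ψ U (ψ y)))) =ᶠ[nhds x] h :=
      (hUn x hx |> Filter.mem_of_superset) (fun y hy => hid y hy)
    rw [(lap_congr hev).eq_of_nhds, hid x hx, hlap x hx, sub_self] at key
    exact sub_eq_zero.1 ((mul_eq_zero.1 key.symm).resolve_left hne)

end Jet

section Gradient

variable {d : ℕ}

theorem hasDerivAt_line {f : EuclideanSpace ℝ (Fin d) → ℂ} {p : EuclideanSpace ℝ (Fin d)}
    (i : Fin d) {t : ℝ} (hf : DifferentiableAt ℝ f (p + t • EuclideanSpace.single i 1)) :
    HasDerivAt (fun s : ℝ => f (p + s • EuclideanSpace.single i 1))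
      (pd i f (p + t • EuclideanSpace.single i 1)) t := by
  have h : HasDerivAt (fun s : ℝ => p + s • (EuclideanSpace.single i 1 :
      EuclideanSpace ℝ (Fin d))) (EuclideanSpace.single i 1) t := by
    simpa using ((hasDerivAt_id t).smul_const (EuclideanSpace.single i (1 : ℝ))).const_add p
  exact hf.hasFDerivAt.comp_hasDerivAt t h

theorem second_deriv_nonneg_of_isLocalMin {γ : ℝ → ℝ} {x : ℝ} (h : IsLocalMin γ x)
    (hc : ContinuousAt γ x) : 0 ≤ deriv (deriv γ) x := by
  by_contra! hneg
  have hmax := isLocalMax_of_deriv_deriv_neg hneg h.deriv_eq_zero hc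
  have hconst : γ =ᶠ[nhds x] fun _ => γ x := by
    filter_upwards [h, hmax] with y h1 h2 using le_antisymm h2 h1
  have := hconst.deriv.deriv_eq
  simp only [deriv_const'] at this
  linarith

theorem re_pd_pd_nonneg_of_isLocalMin {f : EuclideanSpace ℝ (Fin d) → ℂ}
    {p : EuclideanSpace ℝ (Fin d)} (hf : ContDiffAt ℝ (⊤ : ℕ∞) f p)
    (h : IsLocalMin (fun x => (f x).re) p) (i : Fin d) : 0 ≤ (pd i (pd i f) p).re := by
  have hcont : ContinuousAt (fun s : ℝ => p + s • (EuclideanSpace.single i 1 :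
      EuclideanSpace ℝ (Fin d))) 0 := by fun_prop
  have h0 : p + (0 : ℝ) • (EuclideanSpace.single i 1 : EuclideanSpace ℝ (Fin d)) = p := by simp
  have htend : Filter.Tendsto (fun s : ℝ => p + s • (EuclideanSpace.single i 1 :
      EuclideanSpace ℝ (Fin d))) (nhds 0) (nhds p) := by
    have := hcont.tendsto
    rwa [h0] at this
  have hre : ∀ {g : ℝ → ℂ} {g' : ℂ} {t : ℝ}, HasDerivAt g g' t →
      HasDerivAt (fun s => (g s).re) g'.re t := fun hg =>
    (Complex.reCLM.hasFDerivAt.comp_hasDerivAt _ hg)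
  have hmin : IsLocalMin (fun s : ℝ => (f (p + s • EuclideanSpace.single i 1)).re) 0 := by
    have := htend.eventually h
    simpa [IsLocalMin, IsMinFilter, h0] using this
  have hd1 : deriv (fun s : ℝ => (f (p + s • EuclideanSpace.single i 1)).re) =ᶠ[nhds 0]
      fun s => (pd i f (p + s • EuclideanSpace.single i 1)).re := by
    filter_upwards [htend.eventually (eventually_differentiableAt hf)] with s hs
    exact (hre (hasDerivAt_line i hs)).deriv
  have hd2 := (hre (hasDerivAt_line (t := 0) i (f := pd i f) (p := p)
    (by rw [h0]; exact differentiableAt_of_smooth (hf.pd i)))).deriv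
  have hfc : ContinuousAt (fun s : ℝ => (f (p + s • EuclideanSpace.single i 1)).re) 0 :=
    (hre (hasDerivAt_line (t := 0) i (f := f) (p := p)
      (by rw [h0]; exact differentiableAt_of_smooth hf))).continuousAt
  have := second_deriv_nonneg_of_isLocalMin hmin hfc
  rwa [hd1.deriv_eq, hd2, h0] at this

theorem re_lap_nonneg_of_isLocalMin {f : EuclideanSpace ℝ (Fin d) → ℂ}
    {p : EuclideanSpace ℝ (Fin d)} (hf : ContDiffAt ℝ (⊤ : ℕ∞) f p)
    (h : IsLocalMin (fun x => (f x).re) p) : 0 ≤ (lap f p).re := by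
  simp only [lap, Complex.re_sum]
  exact Finset.sum_nonneg fun i _ => re_pd_pd_nonneg_of_isLocalMin hf h i

/-- The reflection in the hyperplane through `a` orthogonal to the `j`-th axis. -/
noncomputable def reflAt (a : EuclideanSpace ℝ (Fin d)) (j : Fin d)
    (x : EuclideanSpace ℝ (Fin d)) : EuclideanSpace ℝ (Fin d) :=
  x - (2 * (x j - a j)) • EuclideanSpace.single j 1

theorem reflAt_apply (a : EuclideanSpace ℝ (Fin d)) (j k : Fin d)
    (x : EuclideanSpace ℝ (Fin d)) :
    reflAt a j x k = if k = j then 2 * a j - x j else x k := by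
  by_cases h : k = j
  · subst h
    simp [reflAt]; ring
  · simp [reflAt, h]

theorem dist_reflAt (a : EuclideanSpace ℝ (Fin d)) (j : Fin d)
    (x : EuclideanSpace ℝ (Fin d)) : dist (reflAt a j x) a = dist x a := by
  simp only [EuclideanSpace.dist_eq]
  congr 1
  refine Finset.sum_congr rfl fun k _ => ?_
  rw [reflAt_apply, Real.dist_eq, Real.dist_eq, sq_abs, sq_abs]
  split_ifs with h
  · subst h; ring
  · rfl

theorem hasFDerivAt_reflAt (a : EuclideanSpace ℝ (Fin d)) (j : Fin d)
    (x : EuclideanSpace ℝ (Fin d)) :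
    HasFDerivAt (reflAt a j) (ContinuousLinearMap.id ℝ (EuclideanSpace ℝ (Fin d)) -
      ((2 : ℝ) • (EuclideanSpace.proj (𝕜 := ℝ) j : EuclideanSpace ℝ (Fin d) →L[ℝ] ℝ)).smulRight
        (EuclideanSpace.single j 1)) x := by
  have h : HasFDerivAt (fun y : EuclideanSpace ℝ (Fin d) => y j)
    (EuclideanSpace.proj (𝕜 := ℝ) j : EuclideanSpace ℝ (Fin d) →L[ℝ] ℝ) x :=
    (EuclideanSpace.proj (𝕜 := ℝ) j : EuclideanSpace ℝ (Fin d) →L[ℝ] ℝ).hasFDerivAt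
  exact (hasFDerivAt_id x).sub (((h.sub_const (a j)).const_mul 2).smul_const _)

theorem pd_comp_reflAt {u : EuclideanSpace ℝ (Fin d) → ℂ} (a : EuclideanSpace ℝ (Fin d))
    (j i : Fin d) {x : EuclideanSpace ℝ (Fin d)} (hu : DifferentiableAt ℝ u (reflAt a j x)) :
    pd i (fun y => u (reflAt a j y)) x =
      (if i = j then -1 else 1) * pd i u (reflAt a j x) := by
  have h := hu.hasFDerivAt.comp x (hasFDerivAt_reflAt a j x)
  have e : fderiv ℝ (fun y => u (reflAt a j y)) x = _ := h.fderiv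
  rw [pd, e, pd]
  by_cases hij : i = j
  · subst hij
    simp [two_mul]
  · simp [hij, Ne.symm hij]

theorem contDiff_reflAt (a : EuclideanSpace ℝ (Fin d)) (j : Fin d) :
    ContDiff ℝ (⊤ : ℕ∞) (reflAt a j) := by
  have h : ContDiff ℝ (⊤ : ℕ∞) (fun y : EuclideanSpace ℝ (Fin d) => 2 * (y j - a j)) :=
    contDiff_const.mul (ContDiff.sub
      (EuclideanSpace.proj (𝕜 := ℝ) j : EuclideanSpace ℝ (Fin d) →L[ℝ] ℝ).contDiff contDiff_const)
  exact contDiff_id.sub (h.fun_smul contDiff_const)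

theorem lap_comp_reflAt {u : EuclideanSpace ℝ (Fin d) → ℂ} (a : EuclideanSpace ℝ (Fin d))
    (j : Fin d) {x : EuclideanSpace ℝ (Fin d)}
    (hu : ContDiffAt ℝ (⊤ : ℕ∞) u (reflAt a j x)) :
    lap (fun y => u (reflAt a j y)) x = lap u (reflAt a j x) := by
  refine Finset.sum_congr rfl fun i _ => ?_
  have h1 : pd i (fun y => u (reflAt a j y)) =ᶠ[nhds x]
      fun y => (if i = j then -1 else 1) * pd i u (reflAt a j y) := by
    filter_upwards [(contDiff_reflAt a j).continuous.continuousAt.eventually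
      (eventually_differentiableAt hu)] with y hy using pd_comp_reflAt a j i hy
  rw [(pd_congr h1 i).eq_of_nhds, pd_const_mul, pd_comp_reflAt a j i
    (differentiableAt_of_smooth (hu.pd i))]
  · split_ifs <;> simp
  · exact differentiableAt_of_smooth
      ((hu.pd i).comp x (contDiff_reflAt a j).contDiffAt)

/-- A diagonal quadratic polynomial. -/
noncomputable def quadPoly (a : EuclideanSpace ℝ (Fin d)) (c b : Fin d → ℝ)
    (x : EuclideanSpace ℝ (Fin d)) : ℂ :=
  ((∑ k, (c k * (x k - a k) ^ 2 + b k * (x k - a k)) : ℝ) : ℂ)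

theorem pd_quadPoly (a : EuclideanSpace ℝ (Fin d)) (c b : Fin d → ℝ) (i : Fin d) :
    pd i (quadPoly a c b) = fun x => ((2 * c i * (x i - a i) + b i : ℝ) : ℂ) := by
  funext x
  have hy : ∀ k, HasFDerivAt (fun y : EuclideanSpace ℝ (Fin d) => y k - a k)
      (EuclideanSpace.proj (𝕜 := ℝ) k : EuclideanSpace ℝ (Fin d) →L[ℝ] ℝ) x := fun k =>
    (EuclideanSpace.proj (𝕜 := ℝ) k :
      EuclideanSpace ℝ (Fin d) →L[ℝ] ℝ).hasFDerivAt.sub_const (a k)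
  have h := Complex.ofRealCLM.hasFDerivAt.comp x (HasFDerivAt.fun_sum fun k (_ : k ∈ Finset.univ) =>
    (((hy k).pow 2).const_mul (c k)).add ((hy k).const_mul (b k)))
  have e : fderiv ℝ (quadPoly a c b) x = _ := h.fderiv
  rw [pd, e]
  simp [apply_ite, Finset.sum_add_distrib]
  ring

theorem contDiff_quadPoly (a : EuclideanSpace ℝ (Fin d)) (c b : Fin d → ℝ) :
    ContDiff ℝ (⊤ : ℕ∞) (quadPoly a c b) := by
  have hy : ∀ k, ContDiff ℝ (⊤ : ℕ∞) (fun y : EuclideanSpace ℝ (Fin d) => y k - a k) := fun k =>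
    (EuclideanSpace.proj (𝕜 := ℝ) k : EuclideanSpace ℝ (Fin d) →L[ℝ] ℝ).contDiff.sub
      contDiff_const
  have h : ContDiff ℝ (⊤ : ℕ∞) (fun x : EuclideanSpace ℝ (Fin d) =>
      ∑ k, (c k * (x k - a k) ^ 2 + b k * (x k - a k))) := ContDiff.sum fun k _ =>
    (contDiff_const.mul ((hy k).pow 2)).add (contDiff_const.mul (hy k))
  exact Complex.ofRealCLM.contDiff.comp h

theorem lap_quadPoly (a : EuclideanSpace ℝ (Fin d)) (c b : Fin d → ℝ)
    (x : EuclideanSpace ℝ (Fin d)) : lap (quadPoly a c b) x = ((∑ k, 2 * c k : ℝ) : ℂ) := by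
  simp only [lap, pd_quadPoly]
  push_cast
  refine Finset.sum_congr rfl fun i _ => ?_
  have hy : HasFDerivAt (fun y : EuclideanSpace ℝ (Fin d) => 2 * c i * (y i - a i) + b i)
      ((2 * c i) • (EuclideanSpace.proj (𝕜 := ℝ) i : EuclideanSpace ℝ (Fin d) →L[ℝ] ℝ)) x :=
    (((EuclideanSpace.proj (𝕜 := ℝ) i :
      EuclideanSpace ℝ (Fin d) →L[ℝ] ℝ).hasFDerivAt.sub_const (a i)).const_mul _).add_const _
  have e : fderiv ℝ (fun y : EuclideanSpace ℝ (Fin d) =>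
      ((2 * c i * (y i - a i) + b i : ℝ) : ℂ)) x = _ :=
    (Complex.ofRealCLM.hasFDerivAt.comp x hy).fderiv
  push_cast at e
  rw [pd, e]
  simp

theorem re_pd_le_of_eigenfunction (lam : ℂ) (a : EuclideanSpace ℝ (Fin d)) (j : Fin d) {ρ : ℝ}
    (hρ : 0 < ρ) {u : EuclideanSpace ℝ (Fin d) → ℂ}
    (hu : ∀ x ∈ Metric.closedBall a ρ, ContDiffAt ℝ (⊤ : ℕ∞) u x)
    (hlap : ∀ x ∈ Metric.closedBall a ρ, lap u x = lam * u x) {m : ℝ} (hm : 0 < m)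
    (hb : ∀ x ∈ Metric.closedBall a ρ, ‖u x‖ ≤ m) :
    2 * (pd j u a).re ≤ m * ((2 * d / ρ ^ 2 + ‖lam‖ + 1) * ρ) := by
  set β : ℝ := 2 * d / ρ ^ 2 + ‖lam‖ + 1 with hβ
  have hβ0 : 0 < β := by positivity
  set c : Fin d → ℝ := fun k => m * (2 / ρ ^ 2) - if k = j then m * β else 0 with hc
  set b : Fin d → ℝ := fun k => if k = j then m * (β * ρ) else 0 with hbdef
  have hR : ∀ x ∈ Metric.closedBall a ρ, reflAt a j x ∈ Metric.closedBall a ρ := fun x hx => by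
    rw [Metric.mem_closedBall, dist_reflAt]; exact hx
  have hq : ∀ x, (quadPoly a c b x).re =
      m * (2 / ρ ^ 2 * dist x a ^ 2 + β * ρ * (x j - a j) - β * (x j - a j) ^ 2) := by
    intro x
    rw [quadPoly, Complex.ofReal_re, EuclideanSpace.dist_eq, Real.sq_sqrt
      (Finset.sum_nonneg fun _ _ => sq_nonneg _)]
    simp only [Real.dist_eq, sq_abs, hc, hbdef, sub_mul, ite_mul, zero_mul,
      Finset.sum_add_distrib, Finset.sum_sub_distrib, Finset.sum_ite_eq', Finset.mem_univ,
      if_true, ← Finset.mul_sum]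
    ring
  set G : EuclideanSpace ℝ (Fin d) → ℂ := fun x =>
    quadPoly a c b x - (u x - u (reflAt a j x)) with hG
  have hvs : ∀ x ∈ Metric.closedBall a ρ, ContDiffAt ℝ (⊤ : ℕ∞)
      (fun x => u x - u (reflAt a j x)) x := fun x hx =>
    (hu x hx).sub ((hu _ (hR x hx)).comp x (contDiff_reflAt a j).contDiffAt)
  have hGs : ∀ x ∈ Metric.closedBall a ρ, ContDiffAt ℝ (⊤ : ℕ∞) G x := fun x hx =>
    (contDiff_quadPoly a c b).contDiffAt.sub (hvs x hx)
  have hdiff : ∀ x ∈ Metric.closedBall a ρ, ‖u x - u (reflAt a j x)‖ ≤ 2 * m := fun x hx =>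
    (norm_sub_le _ _).trans (by linarith [hb x hx, hb _ (hR x hx)])
  have hGlap : ∀ x ∈ Metric.closedBall a ρ, (lap G x).re < 0 := by
    intro x hx
    have e : lap G x = lap (quadPoly a c b) x - (lap u x - lap u (reflAt a j x)) := by
      rw [hG, lap_sub (contDiff_quadPoly a c b).contDiffAt (hvs x hx), lap_sub (hu x hx)
        (g := fun x => u (reflAt a j x)) ((hu _ (hR x hx)).comp x (contDiff_reflAt a j).contDiffAt),
        lap_comp_reflAt a j (hu _ (hR x hx))]
    rw [e, lap_quadPoly, hlap x hx, hlap _ (hR x hx), ← mul_sub, Complex.sub_re,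
      Complex.ofReal_re]
    have h1 : -(lam * (u x - u (reflAt a j x))).re ≤ ‖lam‖ * (2 * m) := by
      refine (neg_le_abs _).trans ((Complex.abs_re_le_norm _).trans ?_)
      rw [norm_mul]
      exact mul_le_mul_of_nonneg_left (hdiff x hx) (norm_nonneg _)
    have h2 : ∑ k, 2 * c k = m * (4 * d / ρ ^ 2 - 2 * β) := by
      simp only [hc, mul_sub, Finset.sum_sub_distrib, mul_ite, mul_zero, Finset.sum_ite_eq',
        Finset.mem_univ, if_true, Finset.sum_const, Finset.card_univ, Fintype.card_fin,
        nsmul_eq_mul]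
      ring
    rw [h2, hβ]
    have h3 : m * (4 * d / ρ ^ 2 - 2 * (2 * d / ρ ^ 2 + ‖lam‖ + 1)) =
      -2 * m * ‖lam‖ - 2 * m := by ring
    rw [h3]
    linarith
  set H : Set (EuclideanSpace ℝ (Fin d)) := Metric.closedBall a ρ ∩ {x | a j ≤ x j} with hH
  have hpj : Continuous fun x : EuclideanSpace ℝ (Fin d) => x j :=
    (EuclideanSpace.proj (𝕜 := ℝ) j : EuclideanSpace ℝ (Fin d) →L[ℝ] ℝ).continuous
  have hHc : IsCompact H :=
    (isCompact_closedBall a ρ).inter_right (isClosed_le continuous_const hpj)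
  have haH : a ∈ H := ⟨Metric.mem_closedBall_self hρ.le, le_refl (a j)⟩
  have hGc : ContinuousOn (fun x => (G x).re) H := fun x hx =>
    (Complex.continuous_re.continuousAt.comp (hGs x hx.1).continuousAt).continuousWithinAt
  have hs : ∀ x ∈ Metric.closedBall a ρ, |x j - a j| ≤ ρ := fun x hx => by
    have := PiLp.norm_apply_le (x - a) j
    rw [← dist_eq_norm] at this
    exact this.trans hx
  have hpos : ∀ x ∈ H, 0 ≤ (G x).re := by
    obtain ⟨p, hp, hmin⟩ := hHc.exists_isMinOn ⟨a, haH⟩ hGc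
    suffices 0 ≤ (G p).re from fun x hx => this.trans (hmin hx)
    have hsp := hs p hp.1
    have hp2 : 0 ≤ p j - a j := sub_nonneg.2 hp.2
    rw [abs_of_nonneg hp2] at hsp
    have hGre : (G p).re = (quadPoly a c b p).re - (u p - u (reflAt a j p)).re := by
      rw [hG, Complex.sub_re]
    have hbs : 0 ≤ β * ρ * (p j - a j) - β * (p j - a j) ^ 2 := by
      have : 0 ≤ β * ((p j - a j) * (ρ - (p j - a j))) :=
        mul_nonneg hβ0.le (mul_nonneg hp2 (sub_nonneg.2 hsp))
      linarith
    rcases hp2.eq_or_lt with h0 | h0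
    · have : reflAt a j p = p := by
        rw [reflAt, ← h0]; simp
      rw [hGre, hq, this, ← h0]
      simp only [sub_self, Complex.zero_re]
      have : 0 ≤ m * (2 / ρ ^ 2 * dist p a ^ 2) := by positivity
      linarith
    rcases (Metric.mem_closedBall.1 hp.1).eq_or_lt with h1 | h1
    · rw [hGre, hq, h1]
      have h2 := (Complex.re_le_norm _).trans (hdiff p hp.1)
      have h3 : 2 / ρ ^ 2 * ρ ^ 2 = 2 := by field_simp
      rw [h3]
      nlinarith
    · exfalso
      have hnhds : H ∈ nhds p := by
        refine Filter.inter_mem (Metric.closedBall_mem_nhds_of_mem h1) ?_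
        have : {x : EuclideanSpace ℝ (Fin d) | a j < x j} ∈ nhds p :=
          (isOpen_lt continuous_const hpj).mem_nhds (by simpa using h0)
        exact Filter.mem_of_superset this fun x (hx : a j < x j) => hx.le
      have hloc : IsLocalMin (fun x => (G x).re) p := hmin.isLocalMin hnhds
      exact absurd (re_lap_nonneg_of_isLocalMin (hGs p hp.1) hloc) (not_le.2 (hGlap p hp.1))
  have ha0 : a + (0 : ℝ) • (EuclideanSpace.single j 1 : EuclideanSpace ℝ (Fin d)) = a := by simp
  have haball := Metric.mem_closedBall_self (x := a) hρ.le
  have hder : HasDerivAt (fun s : ℝ => (G (a + s • EuclideanSpace.single j 1)).re)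
      (pd j G a).re 0 := by
    have h1 := hasDerivAt_line (t := 0) j (f := G) (p := a)
      (by rw [ha0]; exact differentiableAt_of_smooth (hGs a haball))
    rw [ha0] at h1
    exact Complex.reCLM.hasFDerivAt.comp_hasDerivAt _ h1
  have hra : reflAt a j a = a := by simp [reflAt]
  have hG0 : (G a).re = 0 := by
    have : (G a).re = (quadPoly a c b a).re - (u a - u (reflAt a j a)).re := by
      rw [hG, Complex.sub_re]
    rw [this, hq, hra]
    simp
  have hnn : 0 ≤ (pd j G a).re := by
    refine ge_of_tendsto hder.tendsto_slope_zero_right ?_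
    have : Set.Ioc (0 : ℝ) ρ ∈ nhdsWithin (0 : ℝ) (Set.Ioi 0) := Ioc_mem_nhdsGT hρ
    filter_upwards [this] with t ht
    simp only [zero_add, ha0, hG0, sub_zero]
    refine smul_nonneg (inv_nonneg.2 ht.1.le) (hpos _ ⟨?_, ?_⟩)
    · rw [Metric.mem_closedBall, dist_eq_norm]
      simpa [norm_smul, abs_of_pos ht.1] using ht.2
    · simpa using ht.1.le
  have hpdG : pd j G a = ((m * (β * ρ) : ℝ) : ℂ) - 2 * pd j u a := by
    have hus := differentiableAt_of_smooth (hu a haball)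
    rw [hG, pd_sub (differentiableAt_of_smooth (contDiff_quadPoly a c b).contDiffAt)
      (differentiableAt_of_smooth (hvs a haball)), pd_sub hus
      (g := fun x => u (reflAt a j x)) (differentiableAt_of_smooth ((hu _ (hR a haball)).comp a (contDiff_reflAt a j).contDiffAt)),
      pd_comp_reflAt a j j (by rw [hra]; exact hus), hra, pd_quadPoly]
    simp [hbdef]
    ring
  rw [hpdG] at hnn
  simp at hnn
  linarith

/-- Interior gradient estimate for eigenfunctions of the Laplacian. -/
theorem norm_pd_le_of_eigenfunction (lam : ℂ) (a : EuclideanSpace ℝ (Fin d)) (j : Fin d) {ρ : ℝ}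
    (hρ : 0 < ρ) : ∃ C : ℝ, 0 < C ∧ ∀ u : EuclideanSpace ℝ (Fin d) → ℂ,
    (∀ x ∈ Metric.closedBall a ρ, ContDiffAt ℝ (⊤ : ℕ∞) u x) →
    (∀ x ∈ Metric.closedBall a ρ, lap u x = lam * u x) → ∀ m : ℝ, 0 < m →
    (∀ x ∈ Metric.closedBall a ρ, ‖u x‖ ≤ m) → ‖pd j u a‖ ≤ C * m := by
  refine ⟨(2 * d / ρ ^ 2 + ‖lam‖ + 1) * ρ / 2, by positivity, fun u hu hlap m hm hb => ?_⟩
  obtain ⟨c, hc, hcu⟩ : ∃ c : ℂ, ‖c‖ = 1 ∧ c * pd j u a = ‖pd j u a‖ := by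
    obtain ⟨c, hc, h⟩ := RCLike.exists_norm_eq_mul_self (pd j u a)
    exact ⟨c, hc, h.symm⟩
  have hd : ∀ x ∈ Metric.closedBall a ρ, ∀ i, pd i (fun y => c * u y) =ᶠ[nhds x]
      fun y => c * pd i u y := fun x hx i => by
    filter_upwards [eventually_differentiableAt (hu x hx)] with y hy using pd_const_mul c hy i
  have := re_pd_le_of_eigenfunction lam a j hρ (u := fun y => c * u y)
    (fun x hx => contDiffAt_const.mul (hu x hx)) (fun x hx => by
      have : lap (fun y => c * u y) x = c * lap u x := by
        simp only [lap, Finset.mul_sum]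
        refine Finset.sum_congr rfl fun i _ => ?_
        rw [(pd_congr (hd x hx i) i).eq_of_nhds,
          pd_const_mul c (differentiableAt_of_smooth ((hu x hx).pd i))]
      rw [this, hlap x hx]; ring) hm (fun x hx => by rw [norm_mul, hc, one_mul]; exact hb x hx)
  rw [(hd a (Metric.mem_closedBall_self hρ.le) j).eq_of_nhds, hcu, Complex.ofReal_re] at this
  linarith

end Gradient

section Necessity

variable {d : ℕ} {lam : ℂ} {X : Set (EuclideanSpace ℝ (Fin d))}

/-- An entire eigenfunction, as an element of `E_λ(X)`. -/
def Eig.ofEntire (X : Set (EuclideanSpace ℝ (Fin d))) (f : EuclideanSpace ℝ (Fin d) → ℂ)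
    (hf : ContDiff ℝ (⊤ : ℕ∞) f) (hlap : ∀ x, lap f x = lam * f x) : Eig d lam X :=
  ⟨⟨fun x => f x, hf.continuous.comp continuous_subtype_val⟩, f, hf.contDiffOn,
    fun x _ => hlap x, fun _ => rfl⟩

/-- The exponentials in `E_λ(X)`. -/
noncomputable def Eig.expo (X : Set (EuclideanSpace ℝ (Fin d))) (ζ : Fin d → ℂ)
    (hζ : ∑ i, ζ i ^ 2 = lam) : Eig d lam X :=
  Eig.ofEntire X (_root_.expo ζ) (contDiff_expo ζ) fun x => by rw [lap_expo, hζ]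

theorem lap_zero (x : EuclideanSpace ℝ (Fin d)) :
    lap (fun _ : EuclideanSpace ℝ (Fin d) => (0 : ℂ)) x = 0 := by
  have h : ∀ j : Fin d, pd j (fun _ : EuclideanSpace ℝ (Fin d) => (0 : ℂ)) = fun _ => 0 := by
    intro j; funext y; simp [pd]
  simp [lap, h]

theorem Eig.isOpen_norm_sub_lt {K : Set X} (hK : IsCompact K) (e : C(X, ℂ)) (ε : ℝ) :
    IsOpen {g : Eig d lam X | ∀ x ∈ K, ‖g.1 x - e x‖ < ε} := by
  have h1 := ContinuousMap.isOpen_setOfPred_mapsTo (Y := ℂ) hK (Metric.isOpen_ball (x := (0 : ℂ)) (ε := ε))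
  have h2 : Continuous fun g : Eig d lam X => g.1 - e :=
    continuous_subtype_val.sub continuous_const
  have := h1.preimage h2
  convert this using 1
  ext g
  simp [Set.MapsTo]

theorem TopMixing.exists_approx {T : Eig d lam X → Eig d lam X} (hT : TopMixing T)
    {K : Set X} (hK : IsCompact K) (e : Eig d lam X) {ε : ℝ} (hε : 0 < ε) :
    ∃ f, ∀ x ∈ K, ‖(T f).1 x - e.1 x‖ < ε := by
  obtain ⟨M, hM⟩ := hT Set.univ _ isOpen_univ (Eig.isOpen_norm_sub_lt hK e.1 ε) ⟨e, trivial⟩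
    ⟨e, fun x _ => by simpa using hε⟩
  obtain ⟨_, ⟨f, _, rfl⟩, hf⟩ := hM (M + 1) (Nat.le_succ M)
  rw [Function.iterate_succ_apply'] at hf
  exact ⟨_, hf⟩

theorem eq_of_forall_norm_sub_le {a b : ℂ} {C : ℝ} (h : ∀ ε : ℝ, 0 < ε → ‖a - b‖ ≤ C * ε) :
    a = b := by
  have : Filter.Tendsto (fun ε : ℝ => C * ε) (nhdsWithin 0 (Set.Ioi 0)) (nhds 0) :=
    (Continuous.tendsto' (by fun_prop) 0 0 (mul_zero C)).mono_left nhdsWithin_le_nhds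
  have h0 : ‖a - b‖ ≤ 0 := ge_of_tendsto this (by
    filter_upwards [self_mem_nhdsWithin] with ε hε using h ε hε)
  exact sub_eq_zero.1 (norm_le_zero_iff.1 h0)

variable {w : EuclideanSpace ℝ (Fin d) → ℂ}
  {ψ : EuclideanSpace ℝ (Fin d) → EuclideanSpace ℝ (Fin d)} {hm : Set.MapsTo ψ X X}
  {T : Eig d lam X → Eig d lam X}

theorem exists_quadric_point (hd : 2 ≤ d) (lam : ℂ) : ∃ ζ : Fin d → ℂ, ∑ i, ζ i ^ 2 = lam := by
  have : Nontrivial (Fin d) := Fin.nontrivial_iff_two_le.2 hd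
  obtain ⟨j, k, hjk⟩ := exists_pair_ne (Fin d)
  obtain ⟨β, hβ⟩ := exists_sq_add_sq lam 0
  exact ⟨_, (sum_sq_single_add_single hjk 0 β).trans hβ⟩

theorem weight_ne_zero_of_topMixing (hd : 2 ≤ d)
    (hTf : ∀ f x, (T f).1 x = w x * f.1 ⟨ψ x, hm x.2⟩) (hT : TopMixing T) :
    ∀ x ∈ X, w x ≠ 0 := by
  intro x hx h0
  obtain ⟨ζ, hζ⟩ := exists_quadric_point hd lam
  have hne : expo ζ x ≠ 0 := Complex.exp_ne_zero _
  obtain ⟨f, hf⟩ := hT.exists_approx (isCompact_singleton (x := ⟨x, hx⟩)) (Eig.expo X ζ hζ)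
    (norm_pos_iff.2 hne)
  have := hf _ rfl
  rw [hTf, h0, zero_mul, zero_sub, norm_neg] at this
  exact lt_irrefl _ this

theorem expo_single_add_single (j k : Fin d) (α β : ℂ) (x : EuclideanSpace ℝ (Fin d)) :
    expo (Pi.single j α + Pi.single k β) x = Complex.exp (x j * α + x k * β) := by
  rw [expo, ← sum_mul_single_add_single fun i => (x i : ℂ)]
  simp only [mul_comm]

theorem injOn_of_topMixing (hd : 2 ≤ d)
    (hTf : ∀ f x, (T f).1 x = w x * f.1 ⟨ψ x, hm x.2⟩) (hT : TopMixing T) :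
    Set.InjOn ψ X := by
  have : Nontrivial (Fin d) := Fin.nontrivial_iff_two_le.2 hd
  have hw0 := weight_ne_zero_of_topMixing hd hTf hT
  intro x hx y hy hxy
  have key : ∀ ζ : Fin d → ℂ, ∑ i, ζ i ^ 2 = lam → w y * expo ζ x = w x * expo ζ y := by
    intro ζ hζ
    refine eq_of_forall_norm_sub_le (C := ‖w y‖ + ‖w x‖) fun ε hε => ?_
    obtain ⟨f, hf⟩ := hT.exists_approx (K := {⟨x, hx⟩, ⟨y, hy⟩})
      (Set.Finite.isCompact (by simp)) (Eig.expo X ζ hζ) hε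
    have h1 := hf ⟨x, hx⟩ (by simp)
    have h2 := hf ⟨y, hy⟩ (by simp)
    rw [hTf] at h1 h2
    have hz : (⟨ψ x, hm hx⟩ : X) = ⟨ψ y, hm hy⟩ := Subtype.ext hxy
    rw [hz] at h1
    set z := f.1 ⟨ψ y, hm hy⟩
    have e : w y * expo ζ x - w x * expo ζ y =
      -(w y * (w x * z - expo ζ x)) + w x * (w y * z - expo ζ y) := by ring
    rw [e]
    refine (norm_add_le _ _).trans ?_
    rw [norm_neg, norm_mul, norm_mul, add_mul]
    exact add_le_add (mul_le_mul_of_nonneg_left h1.le (norm_nonneg _))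
      (mul_le_mul_of_nonneg_left h2.le (norm_nonneg _))
  have hexp : ∀ j (α : ℂ), Complex.exp (2 * α * ((x j : ℂ) - y j)) = (w x / w y) ^ 2 := by
    intro j α
    obtain ⟨k, hk⟩ := exists_ne j
    obtain ⟨β, hβ⟩ := exists_sq_add_sq lam α
    have h : ∀ β, α ^ 2 + β ^ 2 = lam → w y * Complex.exp (x j * α + x k * β) =
        w x * Complex.exp (y j * α + y k * β) := fun β hβ => by
      rw [← expo_single_add_single, ← expo_single_add_single]
      exact key _ ((sum_sq_single_add_single hk.symm α β).trans hβ)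
    have h' : ∀ β, α ^ 2 + β ^ 2 = lam →
        Complex.exp (α * ((x j : ℂ) - y j) + β * ((x k : ℂ) - y k)) = w x / w y := by
      intro β hβ
      rw [eq_div_iff (hw0 y hy)]
      have e : α * ((x j : ℂ) - y j) + β * ((x k : ℂ) - y k) =
        (x j * α + x k * β) - (y j * α + y k * β) := by ring
      rw [e, Complex.exp_sub, div_mul_eq_mul_div, div_eq_iff (Complex.exp_ne_zero _), mul_comm,
        h β hβ]
    have e : 2 * α * ((x j : ℂ) - y j) = (α * ((x j : ℂ) - y j) + β * ((x k : ℂ) - y k)) +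
      (α * ((x j : ℂ) - y j) + (-β) * ((x k : ℂ) - y k)) := by ring
    rw [e, Complex.exp_add, h' β hβ, h' (-β) (by rw [neg_sq]; exact hβ), sq]
  ext j
  by_contra hne
  have hv : (x j : ℂ) - y j ≠ 0 := by
    rw [sub_ne_zero]; exact_mod_cast hne
  have h0 := hexp j 0
  have h1 := hexp j (1 / (2 * ((x j : ℂ) - y j)))
  rw [← h0, show 2 * (1 / (2 * ((x j : ℂ) - y j))) * ((x j : ℂ) - y j) = 1 by field_simp] at h1
  simp only [mul_zero, zero_mul, Complex.exp_zero] at h1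
  have h2 := congrArg Complex.re h1
  rw [show (1 : ℂ) = ((1 : ℝ) : ℂ) by simp, ← Complex.ofReal_exp, Complex.ofReal_re,
    Complex.ofReal_re] at h2
  exact absurd h2 (by simp)

theorem bijective_fderiv_of_topMixing (hd : 2 ≤ d) (hX : IsOpen X)
    (hw : ContDiffOn ℝ (⊤ : ℕ∞) w X) (hψ : ContDiffOn ℝ (⊤ : ℕ∞) ψ X)
    (hTf : ∀ f x, (T f).1 x = w x * f.1 ⟨ψ x, hm x.2⟩) (hT : TopMixing T) :
    ∀ x ∈ X, Function.Bijective (fderiv ℝ ψ x) := by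
  have : Nontrivial (Fin d) := Fin.nontrivial_iff_two_le.2 hd
  have hw0 := weight_ne_zero_of_topMixing hd hTf hT
  intro x hx
  suffices Function.Injective (fderiv ℝ ψ x) from
    ⟨this, (LinearMap.injective_iff_surjective (f := (fderiv ℝ ψ x).toLinearMap)).1 this⟩
  rw [injective_iff_map_eq_zero]
  intro v hv
  have hXn : ∀ y ∈ X, X ∈ nhds y := fun y hy => hX.mem_nhds hy
  obtain ⟨ρ, hρ, hρX⟩ := Metric.nhds_basis_closedBall.mem_iff.1 (hXn x hx)
  have hgrad : ∀ j, _ := fun j => norm_pd_le_of_eigenfunction lam x j hρ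
  choose C hC0 hC using hgrad
  have hKc : IsCompact (Subtype.val ⁻¹' Metric.closedBall x ρ : Set X) :=
    Topology.IsInducing.subtypeVal.isCompact_preimage' (isCompact_closedBall x ρ)
      (by simpa using hρX)
  have key : ∀ ζ : Fin d → ℂ, ∑ i, ζ i ^ 2 = lam →
      w x * (fderiv ℝ (expo ζ) x v) = fderiv ℝ w x v * expo ζ x := by
    intro ζ hζ
    refine eq_of_forall_norm_sub_le (C := ‖w x‖ * ∑ k, ‖v k‖ * C k + ‖fderiv ℝ w x v‖)
      fun ε hε => ?_
    obtain ⟨f, hf⟩ := hT.exists_approx hKc (Eig.expo X ζ hζ) hε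
    obtain ⟨g, hgs, hgl, hg⟩ := (T f).2
    obtain ⟨f', hfs, -, hf'⟩ := f.2
    have hgw : g =ᶠ[nhds x] fun y => w y * f' (ψ y) := by
      filter_upwards [hXn x hx] with y hy
      rw [← hg ⟨y, hy⟩, hTf, hf']
    have hwx := (differentiableAt_of_smooth (hw.contDiffAt (hXn x hx)))
    have hfx := (differentiableAt_of_smooth (hfs.contDiffAt (hXn _ (hm hx))))
    have hψx := (differentiableAt_of_smooth (hψ.contDiffAt (hXn x hx)))
    have hder : fderiv ℝ g x v = fderiv ℝ w x v * f' (ψ x) := by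
      have h1 := hwx.hasFDerivAt.mul (hfx.hasFDerivAt.comp x hψx.hasFDerivAt)
      have h2 : fderiv ℝ (fun y => w y * f' (ψ y)) x = _ := h1.fderiv
      rw [hgw.fderiv_eq, h2]
      simp [hv, mul_comm]
    have hgx : g x = w x * f' (ψ x) := hgw.eq_of_nhds
    have hrel : w x * fderiv ℝ g x v = fderiv ℝ w x v * g x := by rw [hder, hgx]; ring
    have hub : ∀ y ∈ Metric.closedBall x ρ, ‖g y - expo ζ y‖ ≤ ε := fun y hy => by
      have := hf ⟨y, hρX hy⟩ hy
      rw [hg] at this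
      exact this.le
    have hsm : ∀ y ∈ Metric.closedBall x ρ, ContDiffAt ℝ (⊤ : ℕ∞) g y := fun y hy =>
      hgs.contDiffAt (hXn y (hρX hy))
    have hpd : ∀ k, ‖pd k (fun y => g y - expo ζ y) x‖ ≤ C k * ε := fun k =>
      hC k _ (fun y hy => (hsm y hy).sub (contDiff_expo ζ).contDiffAt) (fun y hy => by
        rw [lap_sub (hsm y hy) (contDiff_expo ζ).contDiffAt, hgl y (hρX hy), lap_expo, hζ]
        ring) ε hε hub
    have hxb := Metric.mem_closedBall_self (x := x) hρ.le
    have hfd : ‖fderiv ℝ (expo ζ) x v - fderiv ℝ g x v‖ ≤ (∑ k, ‖v k‖ * C k) * ε := by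
      rw [norm_sub_rev, fderiv_eq_sum_pd, fderiv_eq_sum_pd, ← Finset.sum_sub_distrib,
        Finset.sum_mul]
      refine norm_sum_le_of_le _ fun k _ => ?_
      rw [← smul_sub, norm_smul, mul_assoc, ← pd_sub (differentiableAt_of_smooth (hsm x hxb))
        (differentiableAt_of_smooth (contDiff_expo ζ).contDiffAt)]
      exact mul_le_mul_of_nonneg_left (hpd k) (norm_nonneg _)
    have e : w x * (fderiv ℝ (expo ζ) x v) - fderiv ℝ w x v * expo ζ x =
        w x * (fderiv ℝ (expo ζ) x v - fderiv ℝ g x v) +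
          fderiv ℝ w x v * (g x - expo ζ x) := by
      linear_combination hrel
    rw [e]
    refine (norm_add_le _ _).trans ?_
    rw [norm_mul, norm_mul, add_mul, mul_assoc]
    exact add_le_add (mul_le_mul_of_nonneg_left hfd (norm_nonneg _))
      (mul_le_mul_of_nonneg_left (hub x hxb) (norm_nonneg _))
  have key2 : ∀ ζ : Fin d → ℂ, ∑ i, ζ i ^ 2 = lam → w x * ∑ k, (v k : ℂ) * ζ k =
      fderiv ℝ w x v := by
    intro ζ hζ
    have h := key ζ hζ
    have hne : expo ζ x ≠ 0 := Complex.exp_ne_zero _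
    rw [fderiv_eq_sum_pd] at h
    simp only [pd_expo, Complex.real_smul, ← mul_assoc, ← Finset.sum_mul] at h
    exact mul_right_cancel₀ hne h
  ext j
  obtain ⟨k, hk⟩ := exists_ne j
  obtain ⟨β, hβ⟩ := exists_sq_add_sq lam 1
  have h : ∀ α β, α ^ 2 + β ^ 2 = lam →
      w x * ((v j : ℂ) * α + v k * β) = fderiv ℝ w x v := fun α β hαβ => by
    rw [← sum_mul_single_add_single (fun i => (v i : ℂ))]
    exact key2 _ ((sum_sq_single_add_single hk.symm α β).trans hαβ)
  have h1 := h 1 β hβ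
  have h2 := h (-1) β (by linear_combination hβ)
  have h3 : w x * (v j : ℂ) = 0 := by linear_combination (h1 - h2) / 2
  simpa using (mul_eq_zero.1 h3).resolve_left (hw0 x hx)

/-- The weight of the `m`-th iterate of a weighted composition operator. -/
noncomputable def iterWeight (w : EuclideanSpace ℝ (Fin d) → ℂ)
    (ψ : EuclideanSpace ℝ (Fin d) → EuclideanSpace ℝ (Fin d)) (m : ℕ)
    (x : EuclideanSpace ℝ (Fin d)) : ℂ := ∏ k ∈ Finset.range m, w (ψ^[k] x)

theorem val_iterate_restrict (m : ℕ) (x : X) :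
    (((Set.MapsTo.restrict ψ X X hm)^[m] x : X) : EuclideanSpace ℝ (Fin d)) = ψ^[m] x := by
  induction m generalizing x with
  | zero => rfl
  | succ m ih => rw [Function.iterate_succ_apply, ih, Function.iterate_succ_apply]; rfl

theorem iterate_wcomp_apply (hTf : ∀ f x, (T f).1 x = w x * f.1 ⟨ψ x, hm x.2⟩) (m : ℕ)
    (f : Eig d lam X) (x : X) :
    (T^[m] f).1 x = iterWeight w ψ m x * f.1 ((Set.MapsTo.restrict ψ X X hm)^[m] x) := by
  induction m generalizing f with
  | zero => simp [iterWeight]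
  | succ m ih =>
    rw [Function.iterate_succ_apply, ih, hTf, Function.iterate_succ_apply', iterWeight, iterWeight,
      Finset.prod_range_succ, mul_assoc]
    congr 2
    exact congrArg w (val_iterate_restrict m x)

theorem strongRunAway_of_topMixing (hd : 2 ≤ d)
    (hTf : ∀ f x, (T f).1 x = w x * f.1 ⟨ψ x, hm x.2⟩) (hT : TopMixing T) :
    StrongRunAway (Set.MapsTo.restrict ψ X X hm) := by
  obtain ⟨ζ, hζ⟩ := exists_quadric_point hd lam
  intro K hK
  rcases K.eq_empty_or_nonempty with rfl | hKne
  · exact ⟨0, by simp⟩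
  set e := Eig.expo X ζ hζ
  obtain ⟨p, hp, hmin⟩ := hK.exists_isMinOn hKne (e.1.continuous.norm.continuousOn)
  set c := ‖e.1 p‖
  have hc : 0 < c := norm_pos_iff.2 (Complex.exp_ne_zero _)
  have hU := Eig.isOpen_norm_sub_lt (lam := lam) hK 0 (c / 2)
  have hV := Eig.isOpen_norm_sub_lt (lam := lam) hK e.1 (c / 2)
  have hUne : {g : Eig d lam X | ∀ x ∈ K, ‖g.1 x - (0 : C(X, ℂ)) x‖ < c / 2}.Nonempty :=
    ⟨Eig.ofEntire X (fun _ => 0) contDiff_const (fun x => by rw [lap_zero, mul_zero]),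
      fun x _ => by simpa [Eig.ofEntire] using hc⟩
  have hVne : {g : Eig d lam X | ∀ x ∈ K, ‖g.1 x - e.1 x‖ < c / 2}.Nonempty :=
    ⟨e, fun x _ => by simpa using hc⟩
  obtain ⟨M₁, h₁⟩ := hT _ _ hU hV hUne hVne
  obtain ⟨M₂, h₂⟩ := hT _ _ hV hU hVne hUne
  refine ⟨max M₁ M₂, fun m hmM => Set.eq_empty_of_forall_notMem ?_⟩
  rintro _ ⟨⟨x, hx, rfl⟩, hy⟩
  have hbig : ∀ f : Eig d lam X, (∀ x ∈ K, ‖f.1 x - e.1 x‖ < c / 2) → ∀ x ∈ K,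
      c / 2 < ‖f.1 x‖ := by
    intro f hf x hx
    have h1 := hf x hx
    have h2 : c ≤ ‖e.1 x‖ := hmin hx
    have h3 := norm_sub_norm_le (e.1 x) (f.1 x)
    rw [norm_sub_rev] at h3
    linarith
  obtain ⟨_, ⟨f, hf, rfl⟩, hTf1⟩ := h₁ m ((le_max_left _ _).trans hmM)
  obtain ⟨_, ⟨g, hg, rfl⟩, hTg⟩ := h₂ m ((le_max_right _ _).trans hmM)
  have a1 := hbig _ hTf1 x hx
  have a2 := hf _ hy
  have b1 := hbig _ hg _ hy
  have b2 := hTg x hx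
  simp only [ContinuousMap.zero_apply, sub_zero] at a2 b2
  rw [iterate_wcomp_apply hTf, norm_mul] at a1 b2
  have hW : ‖iterWeight w ψ m x‖ < 1 := by
    by_contra! hge
    nlinarith [norm_nonneg (iterWeight w ψ m x)]
  nlinarith [norm_nonneg (iterWeight w ψ m x), norm_nonneg (f.1 ((Set.MapsTo.restrict ψ X X hm)^[m] x))]

end Necessity

section Theta

open MeasureTheory

variable {d : ℕ} {Ω : Type*} [MeasurableSpace Ω] {μ : Measure Ω} {ζ : Ω → Fin d → ℂ}

theorem norm_cexp_sum_le (a z : Fin d → ℂ) :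
    ‖Complex.exp (∑ i, a i * z i)‖ ≤ Real.exp (d * ‖z‖ * ‖a‖) := by
  rw [Complex.norm_exp]
  refine Real.exp_le_exp.2 ((Complex.re_le_norm _).trans ((norm_sum_le _ _).trans ?_))
  refine (Finset.sum_le_card_nsmul _ _ (‖z‖ * ‖a‖) fun i _ => ?_).trans ?_
  · rw [norm_mul, mul_comm]
    exact mul_le_mul (norm_le_pi_norm z i) (norm_le_pi_norm a i) (norm_nonneg _) (norm_nonneg _)
  · simp [mul_assoc]

/-- `k` is integrable against all exponentials of `‖ζ‖`. -/
def ExpIntegrable (μ : Measure Ω) (ζ : Ω → Fin d → ℂ) (k : Ω → ℂ) : Prop :=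
  AEStronglyMeasurable k μ ∧ ∀ R : ℝ, Integrable (fun ω => Real.exp (R * ‖ζ ω‖) * ‖k ω‖) μ

/-- The superposition `z ↦ ∫ k(ω) exp (ζ(ω) · z) dω` of exponentials. -/
noncomputable def expSuperpos (μ : Measure Ω) (ζ : Ω → Fin d → ℂ) (k : Ω → ℂ)
    (z : Fin d → ℂ) : ℂ :=
  ∫ ω, k ω * Complex.exp (∑ i, ζ ω i * z i) ∂μ

theorem ExpIntegrable.mul {k m : Ω → ℂ} (hk : ExpIntegrable μ ζ k) (hm : AEStronglyMeasurable m μ)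
    (hζ : Measurable ζ) {C R₀ : ℝ} (hC : ∀ ω, ‖m ω‖ ≤ C * Real.exp (R₀ * ‖ζ ω‖)) :
    ExpIntegrable μ ζ (fun ω => m ω * k ω) := by
  refine ⟨hm.mul hk.1, fun R => ?_⟩
  refine ((hk.2 (R + R₀)).const_mul C).mono' ?_ (Filter.Eventually.of_forall fun ω => ?_)
  · exact ((Real.continuous_exp.measurable.comp
      (hζ.norm.const_mul R)).aestronglyMeasurable).mul (hm.mul hk.1).norm
  · rw [Real.norm_of_nonneg (by positivity), norm_mul, add_mul, Real.exp_add]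
    have := mul_le_mul_of_nonneg_left (hC ω)
      (show 0 ≤ Real.exp (R * ‖ζ ω‖) * ‖k ω‖ by positivity)
    nlinarith

theorem ExpIntegrable.coord_mul {k : Ω → ℂ} (hk : ExpIntegrable μ ζ k) (hζ : Measurable ζ)
    (i : Fin d) : ExpIntegrable μ ζ (fun ω => ζ ω i * k ω) := by
  refine hk.mul (m := fun ω => ζ ω i) (C := 1) (R₀ := 1)
    ((measurable_pi_apply i).comp hζ).aestronglyMeasurable hζ fun ω => ?_
  have h1 := norm_le_pi_norm (ζ ω) i
  have h2 := Real.add_one_le_exp ‖ζ ω‖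
  rw [one_mul, one_mul]
  linarith

theorem measurable_cexp_sum (hζ : Measurable ζ) (z : Fin d → ℂ) :
    Measurable fun ω => Complex.exp (∑ i, ζ ω i * z i) :=
  Complex.measurable_exp.comp (Finset.measurable_sum _ fun i _ =>
    ((measurable_pi_apply i).comp hζ).mul_const (z i))

theorem ExpIntegrable.integrable_exp {k : Ω → ℂ} (hk : ExpIntegrable μ ζ k) (hζ : Measurable ζ)
    (z : Fin d → ℂ) : Integrable (fun ω => k ω * Complex.exp (∑ i, ζ ω i * z i)) μ := by
  refine (hk.2 (d * ‖z‖)).mono' (hk.1.mul (measurable_cexp_sum hζ z).aestronglyMeasurable)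
    (Filter.Eventually.of_forall fun ω => ?_)
  rw [norm_mul, mul_comm]
  exact mul_le_mul_of_nonneg_right (norm_cexp_sum_le _ _) (norm_nonneg _)

theorem ExpIntegrable.integrable {k : Ω → ℂ} (hk : ExpIntegrable μ ζ k) : Integrable k μ := by
  have := hk.2 0
  simp only [zero_mul, Real.exp_zero, one_mul] at this
  exact (integrable_norm_iff hk.1).1 this

/-- The linear form `z ↦ ∑ aᵢ zᵢ`. -/
noncomputable def dotCLM (a : Fin d → ℂ) : (Fin d → ℂ) →L[ℂ] ℂ :=
  ∑ i, a i • ContinuousLinearMap.proj (R := ℂ) (φ := fun _ : Fin d => ℂ) i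

theorem dotCLM_apply (a z : Fin d → ℂ) : dotCLM a z = ∑ i, a i * z i := by
  simp [dotCLM, _root_.sum_apply]

theorem norm_dotCLM_le (a : Fin d → ℂ) : ‖dotCLM a‖ ≤ d * ‖a‖ := by
  refine ContinuousLinearMap.opNorm_le_bound _ (by positivity) fun z => ?_
  rw [dotCLM_apply]
  refine (norm_sum_le _ _).trans
    ((Finset.sum_le_card_nsmul _ _ (‖a‖ * ‖z‖) fun i _ => ?_).trans ?_)
  · rw [norm_mul]
    exact mul_le_mul (norm_le_pi_norm a i) (norm_le_pi_norm z i) (norm_nonneg _) (norm_nonneg _)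
  · simp [mul_assoc]

theorem hasFDerivAt_expSuperpos {k : Ω → ℂ} (hk : ExpIntegrable μ ζ k) (hζ : Measurable ζ)
    (z : Fin d → ℂ) :
    HasFDerivAt (expSuperpos μ ζ k)
      (dotCLM fun i => expSuperpos μ ζ (fun ω => ζ ω i * k ω) z) z := by
  have hmain := hasFDerivAt_integral_of_dominated_of_fderiv_le (𝕜 := ℂ) (μ := μ)
    (F := fun z ω => k ω * Complex.exp (∑ i, ζ ω i * z i))
    (F' := fun z ω => (k ω * Complex.exp (∑ i, ζ ω i * z i)) • dotCLM (ζ ω))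
    (bound := fun ω => d * (Real.exp ((d * (‖z‖ + 1) + 1) * ‖ζ ω‖) * ‖k ω‖))
    (x₀ := z) (s := Metric.ball z 1) (Metric.ball_mem_nhds z one_pos)
    (Filter.Eventually.of_forall fun z => (hk.integrable_exp hζ z).1)
    (hk.integrable_exp hζ z) ?_ ?_ ((hk.2 _).const_mul _) ?_
  · refine hmain.congr_fderiv ?_
    have h_int : ∀ i, Integrable (fun ω => ((k ω * Complex.exp (∑ i, ζ ω i * z i)) * ζ ω i) •
        (ContinuousLinearMap.proj (R := ℂ) (φ := fun _ : Fin d => ℂ) i)) μ := fun i => by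
      refine Integrable.smul_const ?_ _
      refine ((hk.coord_mul hζ i).integrable_exp hζ z).congr (Filter.Eventually.of_forall ?_)
      intro ω; ring
    simp only [dotCLM, Finset.smul_sum, smul_smul]
    rw [integral_finsetSum _ fun i _ => h_int i]
    refine Finset.sum_congr rfl fun i _ => ?_
    rw [integral_smul_const, expSuperpos]
    congr 2
    funext ω
    ring
  · refine AEStronglyMeasurable.smul (hk.integrable_exp hζ z).1 ?_
    simp only [dotCLM]
    refine Finset.aestronglyMeasurable_fun_sum _ fun i _ => ?_
    exact (((measurable_pi_apply i).comp hζ).aestronglyMeasurable).smul_const _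
  · refine Filter.Eventually.of_forall fun ω y hy => ?_
    have hy' : ‖y‖ ≤ ‖z‖ + 1 := by
      have h1 : ‖y - z‖ < 1 := by simpa [dist_eq_norm] using hy
      have h2 := norm_sub_norm_le y z
      linarith
    rw [norm_smul, norm_mul, add_mul, Real.exp_add, one_mul]
    have h1 : ‖Complex.exp (∑ i, ζ ω i * y i)‖ ≤ Real.exp (d * (‖z‖ + 1) * ‖ζ ω‖) :=
      (norm_cexp_sum_le _ _).trans (Real.exp_le_exp.2 (by gcongr))
    have h2 : ‖dotCLM (ζ ω)‖ ≤ d * Real.exp ‖ζ ω‖ := (norm_dotCLM_le _).trans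
      (mul_le_mul_of_nonneg_left (by linarith [Real.add_one_le_exp ‖ζ ω‖]) (Nat.cast_nonneg d))
    calc ‖k ω‖ * ‖Complex.exp (∑ i, ζ ω i * y i)‖ * ‖dotCLM (ζ ω)‖
        ≤ ‖k ω‖ * Real.exp (d * (‖z‖ + 1) * ‖ζ ω‖) * (d * Real.exp ‖ζ ω‖) := by gcongr
      _ = _ := by ring
  · refine Filter.Eventually.of_forall fun ω y _ => ?_
    have h := ((dotCLM (ζ ω)).hasFDerivAt (x := y)).cexp.const_mul (k ω)
    simpa only [dotCLM_apply, smul_smul] using h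

theorem contDiff_expSuperpos {k : Ω → ℂ} (hk : ExpIntegrable μ ζ k) (hζ : Measurable ζ) :
    ContDiff ℂ (⊤ : ℕ∞) (expSuperpos μ ζ k) := by
  rw [contDiff_infty]
  intro n
  induction n generalizing k with
  | zero =>
    exact contDiff_zero.2 (continuous_iff_continuousAt.2 fun z =>
      (hasFDerivAt_expSuperpos hk hζ z).continuousAt)
  | succ n ih =>
    push_cast
    rw [contDiff_succ_iff_fderiv]
    refine ⟨fun z => (hasFDerivAt_expSuperpos hk hζ z).differentiableAt, by simp, ?_⟩
    have : fderiv ℂ (expSuperpos μ ζ k) = fun z => ∑ i,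
        expSuperpos μ ζ (fun ω => ζ ω i * k ω) z •
          ContinuousLinearMap.proj (R := ℂ) (φ := fun _ : Fin d => ℂ) i := by
      funext z
      exact (hasFDerivAt_expSuperpos hk hζ z).fderiv
    rw [this]
    exact ContDiff.sum fun i _ => (ih (hk.coord_mul hζ i)).smul contDiff_const

/-- The embedding `ℝ^d → ℂ^d`. -/
noncomputable def cplx : EuclideanSpace ℝ (Fin d) →L[ℝ] (Fin d → ℂ) :=
  ContinuousLinearMap.pi fun i => Complex.ofRealCLM.comp (EuclideanSpace.proj (𝕜 := ℝ) i)

theorem cplx_apply (x : EuclideanSpace ℝ (Fin d)) (i : Fin d) : cplx x i = (x i : ℂ) := rfl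

theorem contDiff_expSuperpos_affine {k : Ω → ℂ} (hk : ExpIntegrable μ ζ k) (hζ : Measurable ζ)
    (c : Fin d → ℂ) (ε : ℝ) :
    ContDiff ℝ (⊤ : ℕ∞) (fun x => expSuperpos μ ζ k (c + ε • cplx x)) :=
  ((contDiff_expSuperpos hk hζ).restrict_scalars ℝ).comp
    (contDiff_const.add (cplx.contDiff.const_smul ε))

theorem pd_expSuperpos_affine {k : Ω → ℂ} (hk : ExpIntegrable μ ζ k) (hζ : Measurable ζ)
    (c : Fin d → ℂ) (ε : ℝ) (j : Fin d) :
    pd j (fun x => expSuperpos μ ζ k (c + ε • cplx x)) =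
      fun x => (ε : ℂ) * expSuperpos μ ζ (fun ω => ζ ω j * k ω) (c + ε • cplx x) := by
  funext x
  have h1 : HasFDerivAt (fun x : EuclideanSpace ℝ (Fin d) => c + ε • cplx x)
      (ε • (cplx : EuclideanSpace ℝ (Fin d) →L[ℝ] (Fin d → ℂ))) x :=
    (cplx.hasFDerivAt.const_smul ε).const_add c
  have h2 := ((hasFDerivAt_expSuperpos hk hζ (c + ε • cplx x)).restrictScalars ℝ).comp x h1
  have e : fderiv ℝ (fun x => expSuperpos μ ζ k (c + ε • cplx x)) x = _ := h2.fderiv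
  rw [pd, e]
  simp [dotCLM_apply, cplx_apply, apply_ite]

theorem lap_expSuperpos_affine {k : Ω → ℂ} (hk : ExpIntegrable μ ζ k) (hζ : Measurable ζ)
    (c : Fin d → ℂ) {ε : ℝ} (hε : ε ^ 2 = 1) :
    lap (fun x => expSuperpos μ ζ k (c + ε • cplx x)) =
      fun x => expSuperpos μ ζ (fun ω => (∑ i, ζ ω i ^ 2) * k ω) (c + ε • cplx x) := by
  funext x
  have h1 : ∀ j, pd j (pd j (fun x => expSuperpos μ ζ k (c + ε • cplx x))) x =
      expSuperpos μ ζ (fun ω => ζ ω j * (ζ ω j * k ω)) (c + ε • cplx x) := by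
    intro j
    have hj := hk.coord_mul hζ j
    rw [pd_expSuperpos_affine hk hζ, pd_const_mul _ (differentiableAt_of_smooth
      (contDiff_expSuperpos_affine hj hζ c ε).contDiffAt), pd_expSuperpos_affine hj hζ, ← mul_assoc]
    have : (ε : ℂ) * ε = 1 := by rw [← sq]; exact_mod_cast hε
    rw [this, one_mul]
  simp only [lap, h1]
  simp only [expSuperpos]
  rw [← integral_finsetSum _ fun j _ => ((hk.coord_mul hζ j).coord_mul hζ j).integrable_exp hζ _]
  congr 1
  funext ω
  rw [Finset.sum_mul, Finset.sum_mul]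
  exact Finset.sum_congr rfl fun j _ => by ring

end Theta

section Kernel

open MeasureTheory

variable {n : ℕ}

/-- A square root of `|ξ|² + λ`. -/
noncomputable def symbolRoot (lam : ℂ) (ξ : Fin n → ℝ) : ℂ :=
  ((∑ k, (ξ k : ℂ) ^ 2) + lam) ^ (((2 : ℕ) : ℂ)⁻¹)

/-- A real part for the first frequency, within `2` of `b`, which stays at distance at least `1`
from `± Re √(|ξ|² + λ)`. -/
noncomputable def freqShift (lam : ℂ) (b : ℝ) (ξ : Fin n → ℝ) : ℝ :=
  if 1 ≤ |b - abs (symbolRoot lam ξ).re| then b else b + 2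

/-- The complex frequency `(i a + c, i ξ)`, with `c` the shift attached to `ξ`. -/
noncomputable def freq (lam : ℂ) (b : ℝ) (ω : ℝ × (Fin n → ℝ)) : Fin (n + 1) → ℂ :=
  Fin.cons (Complex.I * ω.1 + freqShift lam b ω.2) fun k => Complex.I * ω.2 k

/-- The symbol of `Δ - λ` at the complex frequency. -/
noncomputable def freqSymbol (lam : ℂ) (b : ℝ) (ω : ℝ × (Fin n → ℝ)) : ℂ :=
  ∑ i, freq lam b ω i ^ 2 - lam

theorem symbolRoot_sq (lam : ℂ) (ξ : Fin n → ℝ) :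
    symbolRoot lam ξ ^ 2 = (∑ k, (ξ k : ℂ) ^ 2) + lam :=
  Complex.cpow_nat_inv_pow _ two_ne_zero

theorem le_freqShift (lam : ℂ) (b : ℝ) (ξ : Fin n → ℝ) : b ≤ freqShift lam b ξ := by
  rw [freqShift]; split_ifs <;> linarith

theorem freqShift_le (lam : ℂ) (b : ℝ) (ξ : Fin n → ℝ) : freqShift lam b ξ ≤ b + 2 := by
  rw [freqShift]; split_ifs <;> linarith

theorem one_le_abs_freqShift_sub (lam : ℂ) (b : ℝ) (ξ : Fin n → ℝ) :
    1 ≤ |freqShift lam b ξ - abs (symbolRoot lam ξ).re| := by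
  rw [freqShift]
  split_ifs with h
  · exact h
  · rw [not_le, abs_lt] at h
    rw [le_abs]
    left
    linarith

theorem freqSymbol_eq (lam : ℂ) (b : ℝ) (ω : ℝ × (Fin n → ℝ)) :
    freqSymbol lam b ω = (Complex.I * ω.1 + freqShift lam b ω.2 - symbolRoot lam ω.2) *
      (Complex.I * ω.1 + freqShift lam b ω.2 + symbolRoot lam ω.2) := by
  have h := symbolRoot_sq lam ω.2
  have h2 : ∑ k, (Complex.I * (ω.2 k : ℂ)) ^ 2 = -∑ k, (ω.2 k : ℂ) ^ 2 := by
    rw [← Finset.sum_neg_distrib]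
    refine Finset.sum_congr rfl fun k _ => ?_
    rw [mul_pow, Complex.I_sq]; ring
  rw [freqSymbol, Fin.sum_univ_succ]
  simp only [freq, Fin.cons_zero, Fin.cons_succ]
  rw [h2]
  linear_combination h

theorem one_le_norm_freqSymbol (lam : ℂ) {b : ℝ} (hb : 1 ≤ b) (ω : ℝ × (Fin n → ℝ)) :
    1 ≤ ‖freqSymbol lam b ω‖ := by
  rw [freqSymbol_eq, norm_mul]
  have h1 := one_le_abs_freqShift_sub lam b ω.2
  have h2 := le_freqShift lam b ω.2
  set c := freqShift lam b ω.2
  set κ := symbolRoot lam ω.2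
  have e1 : (Complex.I * ω.1 + c - κ).re = c - κ.re := by simp
  have e2 : (Complex.I * ω.1 + c + κ).re = c + κ.re := by simp
  have h3 : 1 ≤ |c + abs κ.re| := by
    rw [le_abs]; left; linarith [abs_nonneg κ.re]
  have h4 : 1 ≤ |c - κ.re| ∧ 1 ≤ |c + κ.re| := by
    rcases abs_cases κ.re with ⟨h, _⟩ | ⟨h, _⟩ <;> rw [h] at h1 h3
    · exact ⟨h1, h3⟩
    · exact ⟨by simpa [sub_eq_add_neg] using h3, by simpa using h1⟩
  refine one_le_mul_of_one_le_of_one_le ?_ ?_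
  · exact h4.1.trans (e1 ▸ Complex.abs_re_le_norm _)
  · exact h4.2.trans (e2 ▸ Complex.abs_re_le_norm _)

theorem re_freqSymbol (lam : ℂ) (b : ℝ) (ω : ℝ × (Fin n → ℝ)) :
    (freqSymbol lam b ω).re =
      -(ω.1 ^ 2 + ∑ k, ω.2 k ^ 2) + freqShift lam b ω.2 ^ 2 - lam.re := by
  rw [freqSymbol, Fin.sum_univ_succ]
  simp [freq, sq, Complex.re_sum]
  ring

theorem norm_freq_sq_le (lam : ℂ) (b : ℝ) (ω : ℝ × (Fin n → ℝ)) :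
    ‖freq lam b ω‖ ^ 2 ≤ ω.1 ^ 2 + ∑ k, ω.2 k ^ 2 + freqShift lam b ω.2 ^ 2 := by
  have h0 : 0 ≤ ∑ k, ω.2 k ^ 2 := Finset.sum_nonneg fun k _ => sq_nonneg _
  refine (Real.le_sqrt (norm_nonneg _) (by positivity)).1
    ((pi_norm_le_iff_of_nonneg (Real.sqrt_nonneg _)).2 fun i => Real.le_sqrt_of_sq_le ?_)
  refine Fin.cases ?_ (fun k => ?_) i
  · simp only [freq, Fin.cons_zero]
    rw [Complex.sq_norm, Complex.normSq_apply]
    simp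
    nlinarith
  · simp only [freq, Fin.cons_succ]
    rw [norm_mul, Complex.norm_I, one_mul, Complex.norm_real, Real.norm_eq_abs, sq_abs]
    have := Finset.single_le_sum (f := fun k => ω.2 k ^ 2) (fun k _ => sq_nonneg _)
      (Finset.mem_univ k)
    nlinarith [sq_nonneg ω.1, sq_nonneg (freqShift lam b ω.2)]

theorem measurable_freqShift (lam : ℂ) (b : ℝ) :
    Measurable (freqShift lam b : (Fin n → ℝ) → ℝ) := by
  have : Measurable (symbolRoot lam : (Fin n → ℝ) → ℂ) := by
    unfold symbolRoot
    fun_prop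
  unfold freqShift
  refine Measurable.ite (measurableSet_le measurable_const ?_) measurable_const measurable_const
  exact (((Complex.measurable_re.comp this).abs).const_sub b).abs

theorem measurable_freq (lam : ℂ) (b : ℝ) : Measurable (freq (n := n) lam b) := by
  have := measurable_freqShift (n := n) lam b
  refine measurable_pi_iff.2 fun i => ?_
  refine Fin.cases ?_ (fun k => ?_) i
  · simp only [freq, Fin.cons_zero]
    fun_prop
  · simp only [freq, Fin.cons_succ]
    fun_prop

theorem measurable_freqSymbol (lam : ℂ) (b : ℝ) : Measurable (freqSymbol (n := n) lam b) :=
  (Finset.measurable_sum _ fun i _ =>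
    ((measurable_pi_apply i).comp (measurable_freq lam b)).pow_const 2).sub_const lam

theorem integrable_gaussian_prod {t : ℝ} (ht : 0 < t) : Integrable
    (fun ω : ℝ × (Fin n → ℝ) => Real.exp (-t * (ω.1 ^ 2 + ∑ k, ω.2 k ^ 2))) := by
  have h1 := integrable_exp_neg_mul_sq ht
  have h2 : Integrable (fun ξ : Fin n → ℝ => ∏ k, Real.exp (-t * ξ k ^ 2)) :=
    Integrable.fintype_prod (f := fun _ x => Real.exp (-t * x ^ 2)) fun _ => h1
  refine (h1.mul_prod h2).congr (Filter.Eventually.of_forall fun ω => ?_)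
  simp only [mul_add, Real.exp_add, Finset.mul_sum, Real.exp_sum]

theorem integral_gaussian_prod (t : ℝ) :
    ∫ ω : ℝ × (Fin n → ℝ), Real.exp (-t * (ω.1 ^ 2 + ∑ k, ω.2 k ^ 2)) =
      √(Real.pi / t) ^ (n + 1) := by
  simp only [mul_add, Real.exp_add, Finset.mul_sum, Real.exp_sum]
  rw [Measure.volume_eq_prod, integral_prod_mul (fun x : ℝ => Real.exp (-t * x ^ 2))
    (fun ξ : Fin n → ℝ => ∏ k, Real.exp (-t * ξ k ^ 2)),
    integral_fintype_prod_volume_eq_pow (fun x => Real.exp (-t * x ^ 2)), integral_gaussian,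
    Fintype.card_fin, pow_succ']

theorem expIntegrable_exp_freqSymbol (lam : ℂ) {b t : ℝ} (hb : 0 ≤ b) (ht : 0 < t) :
    ExpIntegrable volume (freq (n := n) lam b) fun ω => Complex.exp (t * freqSymbol lam b ω) := by
  have hmeas : Measurable fun ω : ℝ × (Fin n → ℝ) => Complex.exp (t * freqSymbol lam b ω) :=
    Complex.measurable_exp.comp ((measurable_freqSymbol lam b).const_mul _)
  refine ⟨hmeas.aestronglyMeasurable, fun R => ?_⟩
  refine ((integrable_gaussian_prod (half_pos ht)).const_mul
    (Real.exp (R ^ 2 / (2 * t) + (3 * t / 2) * (b + 2) ^ 2 - t * lam.re))).mono'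
    (((Real.measurable_exp.comp ((measurable_freq lam b).norm.const_mul R)).mul
      hmeas.norm).aestronglyMeasurable) (Filter.Eventually.of_forall fun ω => ?_)
  rw [Real.norm_of_nonneg (by positivity), Complex.norm_exp, Complex.re_ofReal_mul,
    ← Real.exp_add, ← Real.exp_add, Real.exp_le_exp, re_freqSymbol]
  have h1 := norm_freq_sq_le lam b ω
  have h2 : freqShift lam b ω.2 ^ 2 ≤ (b + 2) ^ 2 :=
    pow_le_pow_left₀ (hb.trans (le_freqShift _ _ _)) (freqShift_le _ _ _) 2
  have h3 : R * ‖freq lam b ω‖ ≤ R ^ 2 / (2 * t) + t / 2 * ‖freq lam b ω‖ ^ 2 := by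
    have : R ^ 2 / (2 * t) + t / 2 * ‖freq lam b ω‖ ^ 2 - R * ‖freq lam b ω‖ =
      (R - t * ‖freq lam b ω‖) ^ 2 / (2 * t) := by field_simp; ring
    have h4 : 0 ≤ (R - t * ‖freq lam b ω‖) ^ 2 / (2 * t) := by positivity
    linarith
  have h5 := mul_le_mul_of_nonneg_left h1 (half_pos ht).le
  have h6 := mul_le_mul_of_nonneg_left h2 ht.le
  nlinarith

theorem expIntegrable_exp_div_freqSymbol (lam : ℂ) {b t : ℝ} (hb : 1 ≤ b) (ht : 0 < t) :
    ExpIntegrable volume (freq (n := n) lam b)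
      fun ω => (freqSymbol lam b ω)⁻¹ * Complex.exp (t * freqSymbol lam b ω) := by
  refine (expIntegrable_exp_freqSymbol lam (zero_le_one.trans hb) ht).mul (C := 1) (R₀ := 0)
    (measurable_freqSymbol lam b).inv.aestronglyMeasurable (measurable_freq lam b) fun ω => ?_
  rw [zero_mul, Real.exp_zero, mul_one, norm_inv]
  exact inv_le_one_of_one_le₀ (one_le_norm_freqSymbol lam hb ω)

/-- The Gaussian superposition `∫ exp (t (ζ·ζ - λ)) exp (ζ·z)`. -/
noncomputable def heatSup (n : ℕ) (lam : ℂ) (b t : ℝ) (z : Fin (n + 1) → ℂ) : ℂ :=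
  expSuperpos volume (freq lam b) (fun ω => Complex.exp (t * freqSymbol lam b ω)) z

/-- The superposition `∫ exp (t (ζ·ζ - λ)) / (ζ·ζ - λ) exp (ζ·z)`. -/
noncomputable def resolventSup (n : ℕ) (lam : ℂ) (b t : ℝ) (z : Fin (n + 1) → ℂ) : ℂ :=
  expSuperpos volume (freq lam b)
    (fun ω => (freqSymbol lam b ω)⁻¹ * Complex.exp (t * freqSymbol lam b ω)) z

theorem heatSup_eq (lam : ℂ) {b t : ℝ} (hb : 0 ≤ b) (ht : 0 < t) (z : Fin (n + 1) → ℂ) :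
    heatSup n lam b t z = (√(Real.pi / t) ^ (n + 1) : ℝ) *
      Complex.exp (-t * lam - (∑ i, z i ^ 2) / (4 * t)) := by
  have ht' : (t : ℂ) ≠ 0 := by exact_mod_cast ht.ne'
  have hpow : ((Real.pi : ℂ) / t) ^ (1 / 2 : ℂ) = (√(Real.pi / t) : ℝ) := by
    rw [Real.sqrt_eq_rpow, Complex.ofReal_cpow (by positivity)]
    push_cast
    rfl
  have h_int := (expIntegrable_exp_freqSymbol (n := n) lam hb ht).integrable_exp
    (measurable_freq lam b) z
  rw [heatSup, expSuperpos, Measure.volume_eq_prod, integral_prod_symm _ h_int]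
  have h1 : ∀ ξ : Fin n → ℝ, ∫ a : ℝ, Complex.exp (t * freqSymbol lam b (a, ξ)) *
      Complex.exp (∑ i, freq lam b (a, ξ) i * z i) =
      ((√(Real.pi / t) : ℝ) * Complex.exp (-t * lam - z 0 ^ 2 / (4 * t))) *
        Complex.exp (-t * ∑ k, (ξ k : ℂ) ^ 2 + ∑ k, (Complex.I * z k.succ) * ξ k) := by
    intro ξ
    set c := freqShift lam b ξ with hc
    have h2 := integral_cexp_quadratic (b := -(t : ℂ)) (by simpa using ht)
      (2 * Complex.I * t * c + Complex.I * z 0)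
      (t * c ^ 2 + c * z 0 - t * lam - t * ∑ k, (ξ k : ℂ) ^ 2 + ∑ k, (Complex.I * z k.succ) * ξ k)
    rw [neg_neg, hpow] at h2
    rw [mul_assoc, ← Complex.exp_add]
    convert h2 using 3
    · rename_i a
      have h3 : ∑ k, (Complex.I * (ξ k : ℂ)) ^ 2 = -∑ k, (ξ k : ℂ) ^ 2 := by
        rw [← Finset.sum_neg_distrib]
        refine Finset.sum_congr rfl fun k _ => ?_
        rw [mul_pow, Complex.I_sq]; ring
      have h4 : ∑ k, (Complex.I * z k.succ) * ξ k = ∑ k, Complex.I * ξ k * z k.succ :=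
        Finset.sum_congr rfl fun k _ => by ring
      rw [← Complex.exp_add, freqSymbol, Fin.sum_univ_succ, Fin.sum_univ_succ]
      simp only [freq, Fin.cons_zero, Fin.cons_succ, ← hc]
      rw [h3, h4]
      congr 1
      linear_combination (t * a ^ 2 : ℂ) * Complex.I_sq
    · field_simp
      linear_combination (-(2 * t * c + z 0) ^ 2 : ℂ) * Complex.I_sq
  simp only [h1]
  rw [integral_const_mul, GaussianFourier.integral_cexp_neg_mul_sum_add (by simpa using ht),
    Fintype.card_fin, show ((n : ℂ) / 2) = n * (1 / 2) by ring, Complex.cpow_nat_mul, hpow,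
    Fin.sum_univ_succ]
  have h5 : ∑ k : Fin n, (Complex.I * z k.succ) ^ 2 = -∑ k : Fin n, z k.succ ^ 2 := by
    rw [← Finset.sum_neg_distrib]
    refine Finset.sum_congr rfl fun k _ => ?_
    rw [mul_pow, Complex.I_sq]; ring
  rw [h5, mul_mul_mul_comm, ← Complex.exp_add, ← pow_succ']
  push_cast
  congr 2
  ring

end Kernel

section KernelBounds

open MeasureTheory

variable {n : ℕ}

theorem exists_norm_heatSup_le (n : ℕ) (lam : ℂ) {b r : ℝ} (hb : 0 ≤ b) (hr : 0 < r) :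
    ∃ C : ℝ, ∀ t : ℝ, 0 < t → t ≤ 1 → ∀ z : Fin (n + 1) → ℂ, r ≤ (∑ i, z i ^ 2).re →
      ‖heatSup n lam b t z‖ ≤ C := by
  refine ⟨Real.exp ‖lam‖ * ((4 * Real.pi / r) ^ (n + 1) * (n + 1).factorial),
    fun t ht ht1 z hz => ?_⟩
  have e1 : (-t * lam - (∑ i, z i ^ 2) / (4 * t) : ℂ).re =
      -(t * lam.re) - (∑ i, z i ^ 2).re / (4 * t) := by
    rw [show (4 * t : ℂ) = ((4 * t : ℝ) : ℂ) by push_cast; rfl, Complex.sub_re,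
      Complex.div_ofReal_re, neg_mul, Complex.neg_re, Complex.re_ofReal_mul]
  rw [heatSup_eq lam hb ht, norm_mul, Complex.norm_exp, e1, sub_eq_add_neg, Real.exp_add,
    Complex.norm_real, Real.norm_of_nonneg (by positivity)]
  have h1 : -(t * lam.re) ≤ ‖lam‖ := by
    have := (abs_le.1 (Complex.abs_re_le_norm lam)).1
    nlinarith [norm_nonneg lam]
  have h2 : Real.exp (-((∑ i, z i ^ 2).re / (4 * t))) ≤
      (4 * t / r) ^ (n + 1) * (n + 1).factorial := by
    have h3 := Real.pow_div_factorial_le_exp (r / (4 * t)) (by positivity) (n + 1)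
    have h4 : Real.exp (-((∑ i, z i ^ 2).re / (4 * t))) ≤ (Real.exp (r / (4 * t)))⁻¹ := by
      rw [← Real.exp_neg]
      exact Real.exp_le_exp.2 (neg_le_neg (by gcongr))
    refine h4.trans ((inv_anti₀ (by positivity) h3).trans (le_of_eq ?_))
    rw [inv_div, div_eq_mul_inv, ← inv_pow, inv_div, mul_comm]
  have h5 : √(Real.pi / t) ≤ Real.pi / t := by
    rw [Real.sqrt_le_left (by positivity)]
    have : 1 ≤ Real.pi / t := by
      rw [le_div_iff₀ ht]
      linarith [Real.pi_gt_three]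
    nlinarith
  calc √(Real.pi / t) ^ (n + 1) * (Real.exp (-(t * lam.re)) *
        Real.exp (-((∑ i, z i ^ 2).re / (4 * t))))
      ≤ (Real.pi / t) ^ (n + 1) * (Real.exp ‖lam‖ *
        ((4 * t / r) ^ (n + 1) * (n + 1).factorial)) := by gcongr
    _ = Real.exp ‖lam‖ * ((Real.pi / t * (4 * t / r)) ^ (n + 1) * (n + 1).factorial) := by
        rw [mul_pow]; ring
    _ = _ := by
        congr 3
        field_simp

theorem hasDerivAt_resolventSup (lam : ℂ) {b t : ℝ} (hb : 1 ≤ b) (ht : 0 < t)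
    (z : Fin (n + 1) → ℂ) :
    HasDerivAt (fun s : ℝ => resolventSup n lam b s z) (heatSup n lam b t z) t := by
  have hb0 : 0 ≤ b := zero_le_one.trans hb
  have hmeas : Measurable fun ω : ℝ × (Fin n → ℝ) => (freqSymbol lam b ω) :=
    measurable_freqSymbol lam b
  have hexp := measurable_cexp_sum (measurable_freq lam b (n := n)) z
  have i1 := ((expIntegrable_exp_freqSymbol (n := n) lam hb0 (half_pos ht)).integrable_exp
    (measurable_freq lam b) z).norm
  have hq : ∀ ω : ℝ × (Fin n → ℝ), (freqSymbol lam b ω).re ≤ (b + 2) ^ 2 - lam.re := by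
    intro ω
    rw [re_freqSymbol]
    have h2 : freqShift lam b ω.2 ^ 2 ≤ (b + 2) ^ 2 :=
      pow_le_pow_left₀ (hb0.trans (le_freqShift _ _ _)) (freqShift_le _ _ _) 2
    have h0 : 0 ≤ ∑ k, ω.2 k ^ 2 := Finset.sum_nonneg fun k _ => sq_nonneg _
    nlinarith [sq_nonneg ω.1]
  refine (hasDerivAt_integral_of_dominated_loc_of_deriv_le (𝕜 := ℝ) (μ := volume)
    (F := fun s ω => (freqSymbol lam b ω)⁻¹ * Complex.exp (s * freqSymbol lam b ω) *
      Complex.exp (∑ i, freq lam b ω i * z i))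
    (F' := fun s ω => Complex.exp (s * freqSymbol lam b ω) *
      Complex.exp (∑ i, freq lam b ω i * z i))
    (bound := fun ω => Real.exp (t * |(b + 2) ^ 2 - lam.re|) * ‖Complex.exp
      ((t / 2 : ℝ) * freqSymbol lam b ω) * Complex.exp (∑ i, freq lam b ω i * z i)‖)
    (x₀ := t) (s := Set.Ioo (t / 2) (3 * t / 2)) (Ioo_mem_nhds (by linarith) (by linarith))
    ?_ ?_ ?_ ?_ (i1.const_mul _) ?_).2
  · refine Filter.Eventually.of_forall fun s => Measurable.aestronglyMeasurable ?_
    exact ((hmeas.inv).mul (Complex.measurable_exp.comp (hmeas.const_mul _))).mul hexp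
  · exact (expIntegrable_exp_div_freqSymbol lam hb ht).integrable_exp (measurable_freq lam b) z
  · exact ((Complex.measurable_exp.comp (hmeas.const_mul _)).mul hexp).aestronglyMeasurable
  · refine Filter.Eventually.of_forall fun ω s hs => ?_
    rw [norm_mul, norm_mul, ← mul_assoc]
    refine mul_le_mul_of_nonneg_right ?_ (norm_nonneg _)
    rw [Complex.norm_exp, Complex.norm_exp, Complex.re_ofReal_mul, Complex.re_ofReal_mul,
      ← Real.exp_add, Real.exp_le_exp]
    have h1 := hq ω
    have h2 := le_abs_self ((b + 2) ^ 2 - lam.re)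
    have h3 := abs_nonneg ((b + 2) ^ 2 - lam.re)
    obtain ⟨h4, h5⟩ := hs
    nlinarith [mul_le_mul_of_nonneg_left (h1.trans h2) (show 0 ≤ s - t / 2 by linarith)]
  · refine Filter.Eventually.of_forall fun ω s _ => ?_
    have hne : freqSymbol lam b ω ≠ 0 := by
      intro h
      have := one_le_norm_freqSymbol lam hb ω
      rw [h, norm_zero] at this
      linarith
    have h1 : HasDerivAt (fun s : ℝ => (s : ℂ) * freqSymbol lam b ω) (freqSymbol lam b ω) s := by
      simpa using (Complex.ofRealCLM.hasDerivAt (x := s)).mul_const (freqSymbol lam b ω)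
    have h2 := ((h1.cexp).const_mul (freqSymbol lam b ω)⁻¹).mul_const
      (Complex.exp (∑ i, freq lam b ω i * z i))
    refine h2.congr_deriv ?_
    rw [mul_comm (Complex.exp _) (freqSymbol lam b ω), inv_mul_cancel_left₀ hne]

theorem exists_norm_resolventSup_sub_le (n : ℕ) (lam : ℂ) {b r : ℝ} (hb : 1 ≤ b) (hr : 0 < r) :
    ∃ C : ℝ, 0 ≤ C ∧ ∀ s t : ℝ, 0 < s → s ≤ 1 → 0 < t → t ≤ 1 → ∀ z : Fin (n + 1) → ℂ,
      r ≤ (∑ i, z i ^ 2).re →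
      ‖resolventSup n lam b s z - resolventSup n lam b t z‖ ≤ C * |s - t| := by
  obtain ⟨C, hC⟩ := exists_norm_heatSup_le n lam (zero_le_one.trans hb) hr
  refine ⟨|C|, abs_nonneg _, fun s t hs hs1 ht ht1 z hz => ?_⟩
  exact (convex_Ioc (0 : ℝ) 1).norm_image_sub_le_of_norm_hasDerivWithin_le
    (f := fun s => resolventSup n lam b s z) (f' := fun s => heatSup n lam b s z)
    (fun u hu => (hasDerivAt_resolventSup lam hb hu.1 z).hasDerivWithinAt)
    (fun u hu => (hC u hu.1 hu.2 z hz).trans (le_abs_self C)) ⟨ht, ht1⟩ ⟨hs, hs1⟩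

theorem contDiff_resolventSup_affine (lam : ℂ) {b t : ℝ} (hb : 1 ≤ b) (ht : 0 < t)
    (c : Fin (n + 1) → ℂ) (ε : ℝ) :
    ContDiff ℝ (⊤ : ℕ∞) (fun x => resolventSup n lam b t (c + ε • cplx x)) :=
  contDiff_expSuperpos_affine (expIntegrable_exp_div_freqSymbol lam hb ht)
    (measurable_freq lam b) c ε

theorem lap_resolventSup_affine (lam : ℂ) {b t : ℝ} (hb : 1 ≤ b) (ht : 0 < t)
    (c : Fin (n + 1) → ℂ) {ε : ℝ} (hε : ε ^ 2 = 1) (x : EuclideanSpace ℝ (Fin (n + 1))) :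
    lap (fun x => resolventSup n lam b t (c + ε • cplx x)) x =
      lam * resolventSup n lam b t (c + ε • cplx x) + heatSup n lam b t (c + ε • cplx x) := by
  have hk := expIntegrable_exp_div_freqSymbol (n := n) lam hb ht
  have hk' := expIntegrable_exp_freqSymbol (n := n) lam (zero_le_one.trans hb) ht
  have hm := measurable_freq (n := n) lam b
  have h := congrFun (lap_expSuperpos_affine hk hm c hε) x
  refine h.trans ?_
  rw [resolventSup, heatSup, expSuperpos, expSuperpos, expSuperpos, ← integral_const_mul,
    ← integral_add ((hk.integrable_exp hm _).const_mul lam) (hk'.integrable_exp hm _)]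
  congr 1
  funext ω
  have hne : freqSymbol lam b ω ≠ 0 := by
    intro h
    have := one_le_norm_freqSymbol lam hb ω
    rw [h, norm_zero] at this
    linarith
  have e : ∑ i, freq lam b ω i ^ 2 = freqSymbol lam b ω + lam := by rw [freqSymbol]; ring
  rw [e]
  field_simp
  ring

theorem norm_resolventSup_le (lam : ℂ) {b t s : ℝ} (hb : 1 ≤ b) (ht : 0 < t) (hs : 0 ≤ s)
    {x : EuclideanSpace ℝ (Fin (n + 1))} (hx : x 0 ≤ -s) :
    ‖resolventSup n lam b t (cplx x)‖ ≤
      Real.exp (-(b * s) + t * ((b + 2) ^ 2 + ‖lam‖)) * √(Real.pi / t) ^ (n + 1) := by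
  rw [← integral_gaussian_prod, ← integral_const_mul]
  refine norm_integral_le_of_norm_le ((integrable_gaussian_prod ht).const_mul _)
    (Filter.Eventually.of_forall fun ω => ?_)
  have h1 : (∑ i, freq lam b ω i * cplx x i).re = freqShift lam b ω.2 * x 0 := by
    rw [Fin.sum_univ_succ]
    simp [freq, cplx_apply, Complex.re_sum]
  rw [norm_mul, norm_mul, norm_inv, Complex.norm_exp, Complex.norm_exp, h1,
    Complex.re_ofReal_mul, re_freqSymbol, mul_assoc, ← Real.exp_add]
  have h2 := inv_le_one_of_one_le₀ (one_le_norm_freqSymbol lam hb ω)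
  refine (mul_le_of_le_one_left (Real.exp_pos _).le h2).trans ?_
  rw [← Real.exp_add, Real.exp_le_exp]
  have h3 := le_freqShift lam b ω.2
  have h4 : freqShift lam b ω.2 ^ 2 ≤ (b + 2) ^ 2 :=
    pow_le_pow_left₀ (by linarith) (freqShift_le _ _ _) 2
  have h5 : freqShift lam b ω.2 * x 0 ≤ -(b * s) := by nlinarith
  have h6 := (abs_le.1 (Complex.abs_re_le_norm lam)).1
  nlinarith

/-- A sequence of smoothing times. -/
noncomputable def smoothTime (m : ℕ) : ℝ := 1 / ((m : ℝ) + 1) ^ 2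

theorem smoothTime_pos (m : ℕ) : 0 < smoothTime m := by
  rw [smoothTime]; positivity

theorem smoothTime_le_one (m : ℕ) : smoothTime m ≤ 1 := by
  rw [smoothTime]
  exact (div_le_one (by positivity)).2 (one_le_pow₀ (by linarith [m.cast_nonneg (α := ℝ)]))

theorem tendsto_smoothTime : Filter.Tendsto smoothTime Filter.atTop (nhds 0) := by
  have h := (tendsto_one_div_add_atTop_nhds_zero_nat (𝕜 := ℝ)).pow 2
  rw [zero_pow two_ne_zero] at h
  refine h.congr fun m => ?_
  rw [smoothTime, div_pow, one_pow]

theorem tendsto_resolventSup_bound (n : ℕ) (L : ℝ) {s : ℝ} (hs : 0 < s) :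
    Filter.Tendsto (fun m : ℕ => Real.exp (-(((m : ℝ) + 1) * s) +
      smoothTime m * (((m : ℝ) + 1 + 2) ^ 2 + L)) * √(Real.pi / smoothTime m) ^ (n + 1))
      Filter.atTop (nhds 0) := by
  have h1 : Filter.Tendsto (fun m : ℕ => ((m : ℝ) + 1) * s) Filter.atTop Filter.atTop :=
    (Filter.tendsto_atTop_add_const_right _ 1 tendsto_natCast_atTop_atTop).atTop_mul_const hs
  have h2 := ((Real.tendsto_pow_mul_exp_neg_atTop_nhds_zero (n + 1)).comp h1).const_mul
    (Real.exp (9 + |L|) * (√Real.pi / s) ^ (n + 1))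
  rw [mul_zero] at h2
  refine squeeze_zero (fun m => by positivity) (fun m => ?_) h2
  have hu : (1 : ℝ) ≤ (m : ℝ) + 1 := by linarith [m.cast_nonneg (α := ℝ)]
  simp only [Function.comp_apply, smoothTime]
  set u : ℝ := (m : ℝ) + 1
  have hu0 : 0 < u := by linarith
  have h3 : 1 / u ^ 2 * ((u + 2) ^ 2 + L) ≤ 9 + |L| := by
    rw [one_div, inv_mul_le_iff₀ (by positivity)]
    nlinarith [le_abs_self L, abs_nonneg L, mul_nonneg (abs_nonneg L) (by nlinarith : 0 ≤ u ^ 2 - 1)]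
  have h4 : √(Real.pi / (1 / u ^ 2)) = √Real.pi * u := by
    rw [div_div_eq_mul_div, div_one, Real.sqrt_mul Real.pi_pos.le, Real.sqrt_sq hu0.le]
  rw [h4, Real.exp_add]
  calc Real.exp (-(u * s)) * Real.exp (1 / u ^ 2 * ((u + 2) ^ 2 + L)) * (√Real.pi * u) ^ (n + 1)
      ≤ Real.exp (-(u * s)) * Real.exp (9 + |L|) * (√Real.pi * u) ^ (n + 1) := by gcongr
    _ = Real.exp (9 + |L|) * (√Real.pi * u) ^ (n + 1) * Real.exp (-(u * s)) := by ring
    _ = Real.exp (9 + |L|) * (√Real.pi / s * (u * s)) ^ (n + 1) * Real.exp (-(u * s)) := by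
        congr 3
        field_simp
    _ = _ := by rw [mul_pow]; ring

end KernelBounds

section Functional

open MeasureTheory Filter Topology

variable {n : ℕ}

/-- The exponential with complex frequency `a`, as a continuous function on `K`. -/
noncomputable def expOn {d : ℕ} (K : Set (EuclideanSpace ℝ (Fin d))) (a : Fin d → ℂ) : C(K, ℂ) :=
  ⟨fun x => Complex.exp (∑ i, a i * cplx x.1 i), by fun_prop⟩

theorem continuous_expOn {d : ℕ} (K : Set (EuclideanSpace ℝ (Fin d))) : Continuous (expOn K) := by
  have h : Continuous fun p : (Fin d → ℂ) × K => Complex.exp (∑ i, p.1 i * cplx p.2.1 i) := by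
    fun_prop
  exact (ContinuousMap.curry ⟨_, h⟩).continuous

/-- The translate by `η` of the resolvent superposition, as a continuous function on `K`. -/
noncomputable def poleOn (K : Set (EuclideanSpace ℝ (Fin (n + 1)))) (lam : ℂ) (m : ℕ)
    (η : Fin (n + 1) → ℂ) : C(K, ℂ) :=
  ⟨fun x => resolventSup n lam 1 (smoothTime m) (-η + (1 : ℝ) • cplx x.1),
    (contDiff_resolventSup_affine lam le_rfl (smoothTime_pos m) (-η) 1).continuous.comp
      continuous_subtype_val⟩

variable {K : Set (EuclideanSpace ℝ (Fin (n + 1)))} [CompactSpace K]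

theorem norm_expOn_le {d : ℕ} {K : Set (EuclideanSpace ℝ (Fin d))} [CompactSpace K] {R : ℝ}
    (hR : ∀ x ∈ K, ‖cplx x‖ ≤ R) (a : Fin d → ℂ) :
    ‖expOn K a‖ ≤ Real.exp (d * R * ‖a‖) := by
  refine (ContinuousMap.norm_le _ (Real.exp_pos _).le).2 fun x => ?_
  refine (norm_cexp_sum_le _ _).trans (Real.exp_le_exp.2 ?_)
  have := hR x.1 x.2
  gcongr

theorem exists_norm_cplx_le {d : ℕ} (K : Set (EuclideanSpace ℝ (Fin d))) [CompactSpace K] :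
    ∃ R : ℝ, 0 ≤ R ∧ ∀ x ∈ K, ‖cplx x‖ ≤ R := by
  have hK : IsCompact K := isCompact_iff_compactSpace.2 inferInstance
  obtain ⟨R, hR⟩ := hK.exists_bound_of_continuousOn (f := fun x => cplx x)
    cplx.continuous.continuousOn
  exact ⟨|R|, abs_nonneg R, fun x hx => (hR x hx).trans (le_abs_self R)⟩

theorem contDiff_functional_poleOn (lam : ℂ) (Λ : C(K, ℂ) →L[ℂ] ℂ) (m : ℕ) :
    ContDiff ℂ (⊤ : ℕ∞) fun η => Λ (poleOn K lam m η) := by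
  obtain ⟨R, hR0, hR⟩ := exists_norm_cplx_le K
  set k : ℝ × (Fin n → ℝ) → ℂ := fun ω =>
    (freqSymbol lam 1 ω)⁻¹ * Complex.exp (smoothTime m * freqSymbol lam 1 ω) with hkdef
  have hk : ExpIntegrable volume (freq (n := n) lam 1) k :=
    expIntegrable_exp_div_freqSymbol lam le_rfl (smoothTime_pos m)
  have hζ := measurable_freq (n := n) lam 1
  have hm1 : AEStronglyMeasurable (fun ω => expOn K (freq (n := n) lam 1 ω)) volume :=
    (continuous_expOn K).comp_aestronglyMeasurable hζ.aestronglyMeasurable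
  have hk' : ExpIntegrable volume (freq (n := n) lam 1)
      (fun ω => Λ (expOn K (freq lam 1 ω)) * k ω) := by
    refine hk.mul (C := ‖Λ‖) (R₀ := (n + 1 : ℕ) * R)
      (Λ.continuous.comp_aestronglyMeasurable hm1) hζ fun ω => ?_
    exact (Λ.le_opNorm _).trans (mul_le_mul_of_nonneg_left (norm_expOn_le hR _) (norm_nonneg _))
  have key : ∀ η, Λ (poleOn K lam m η) = expSuperpos volume (freq lam 1)
      (fun ω => Λ (expOn K (freq lam 1 ω)) * k ω) (-η) := by
    intro η
    have h_int : Integrable (fun ω => (k ω * Complex.exp (∑ i, freq lam 1 ω i * (-η) i)) •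
        expOn K (freq (n := n) lam 1 ω)) := by
      refine (hk.2 ((n + 1 : ℕ) * ‖-η‖ + (n + 1 : ℕ) * R)).mono'
        ((hk.1.mul (measurable_cexp_sum hζ _).aestronglyMeasurable).smul hm1)
        (Eventually.of_forall fun ω => ?_)
      rw [norm_smul, norm_mul, add_mul, Real.exp_add]
      have h1 := norm_cexp_sum_le (freq lam 1 ω) (-η)
      have h2 := norm_expOn_le hR (freq lam 1 ω)
      calc ‖k ω‖ * ‖Complex.exp (∑ i, freq lam 1 ω i * (-η) i)‖ * ‖expOn K (freq lam 1 ω)‖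
          ≤ ‖k ω‖ * Real.exp ((n + 1 : ℕ) * ‖-η‖ * ‖freq lam 1 ω‖) *
            Real.exp ((n + 1 : ℕ) * R * ‖freq lam 1 ω‖) := by gcongr
        _ = _ := by ring
    have h3 : poleOn K lam m η = ∫ ω, (k ω * Complex.exp (∑ i, freq lam 1 ω i * (-η) i)) •
        expOn K (freq (n := n) lam 1 ω) := by
      ext x
      rw [ContinuousMap.integral_apply h_int]
      simp only [poleOn, ContinuousMap.coe_mk, resolventSup, expSuperpos]
      congr 1
      funext ω
      simp only [ContinuousMap.smul_apply, expOn, ContinuousMap.coe_mk, smul_eq_mul, hkdef]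
      rw [mul_assoc _ (Complex.exp (∑ i, freq lam 1 ω i * (-η) i)), ← Complex.exp_add,
        ← Finset.sum_add_distrib]
      congr 3
      funext i
      rw [one_smul, Pi.add_apply]
      ring
    rw [h3, ← ContinuousLinearMap.integral_comp_comm _ h_int, expSuperpos]
    congr 1
    funext ω
    rw [map_smul, smul_eq_mul]
    ring
  rw [funext key]
  exact (contDiff_expSuperpos hk' hζ).comp contDiff_neg

theorem exists_norm_poleOn_sub_le (K : Set (EuclideanSpace ℝ (Fin (n + 1)))) [CompactSpace K]
    (lam : ℂ) {r : ℝ} (hr : 0 < r) :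
    ∃ C : ℝ, 0 ≤ C ∧ ∀ (m l : ℕ) (η : Fin (n + 1) → ℂ),
      (∀ x ∈ K, r ≤ (∑ i, (cplx x i - η i) ^ 2).re) →
      ‖poleOn K lam m η - poleOn K lam l η‖ ≤ C * |smoothTime m - smoothTime l| := by
  obtain ⟨C, hC0, hC⟩ := exists_norm_resolventSup_sub_le n lam le_rfl hr
  refine ⟨C, hC0, fun m l η hη => (ContinuousMap.norm_le _ (by positivity)).2 fun x => ?_⟩
  refine hC _ _ (smoothTime_pos m) (smoothTime_le_one m) (smoothTime_pos l) (smoothTime_le_one l)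
    _ ?_
  refine (hη x.1 x.2).trans (le_of_eq ?_)
  congr 2
  funext i
  rw [one_smul, Pi.add_apply, Pi.neg_apply]
  ring

theorem exists_norm_functional_sub_le (lam : ℂ) (Λ : C(K, ℂ) →L[ℂ] ℂ) {r : ℝ} (hr : 0 < r) :
    ∃ C : ℝ, 0 ≤ C ∧ ∀ (m l : ℕ) (η : Fin (n + 1) → ℂ),
      (∀ x ∈ K, r ≤ (∑ i, (cplx x i - η i) ^ 2).re) →
      ‖Λ (poleOn K lam m η) - Λ (poleOn K lam l η)‖ ≤ C * |smoothTime m - smoothTime l| := by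
  obtain ⟨C, hC0, hC⟩ := exists_norm_poleOn_sub_le K lam hr
  refine ⟨‖Λ‖ * C, by positivity, fun m l η hη => ?_⟩
  rw [← map_sub, mul_assoc]
  exact (Λ.le_opNorm _).trans (mul_le_mul_of_nonneg_left (hC m l η hη) (norm_nonneg _))

theorem tendsto_functional_poleOn_of_far (lam : ℂ) (Λ : C(K, ℂ) →L[ℂ] ℂ)
    (hΛ : ∀ f : C(EuclideanSpace ℝ (Fin (n + 1)), ℂ), ContDiff ℝ (⊤ : ℕ∞) f →
      (∀ x, lap f x = lam * f x) → Λ (f.restrict K) = 0)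
    {y : EuclideanSpace ℝ (Fin (n + 1))} {s : ℝ} (hs : 0 < s) (hy : ∀ x ∈ K, x 0 - y 0 ≤ -s) :
    Tendsto (fun m => Λ (poleOn K lam m (cplx y))) atTop (𝓝 0) := by
  have h0 := (tendsto_resolventSup_bound n ‖lam‖ hs).const_mul ‖Λ‖
  rw [mul_zero] at h0
  refine squeeze_zero_norm (fun m => ?_) h0
  have hb : (1 : ℝ) ≤ (m : ℝ) + 1 := by linarith [m.cast_nonneg (α := ℝ)]
  have ht := smoothTime_pos m
  set b : ℝ := (m : ℝ) + 1
  have c1 := contDiff_resolventSup_affine (n := n) lam le_rfl ht (-cplx y) 1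
  have c2 := contDiff_resolventSup_affine (n := n) lam hb ht (-cplx y) 1
  have h1 := hΛ ⟨_, (c1.sub c2).continuous⟩ (c1.sub c2) fun x => by
    have e1 := lap_resolventSup_affine lam le_rfl ht (-cplx y) (one_pow 2) x
    have e2 := lap_resolventSup_affine lam hb ht (-cplx y) (one_pow 2) x
    have e3 := lap_sub (x := x) c1.contDiffAt c2.contDiffAt
    refine e3.trans ?_
    rw [e1, e2, heatSup_eq lam zero_le_one ht, heatSup_eq lam (zero_le_one.trans hb) ht]
    simp only [ContinuousMap.coe_mk]
    ring
  set q : C(K, ℂ) := (⟨fun x => resolventSup n lam b (smoothTime m) (-cplx y + (1 : ℝ) • cplx x),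
    c2.continuous⟩ : C(EuclideanSpace ℝ (Fin (n + 1)), ℂ)).restrict K with hq
  have h2 : Λ (poleOn K lam m (cplx y)) = Λ q := by
    rw [← sub_eq_zero, ← map_sub, ← h1]
    rfl
  rw [h2]
  refine (Λ.le_opNorm _).trans (mul_le_mul_of_nonneg_left ?_ (norm_nonneg _))
  refine (ContinuousMap.norm_le _ (by positivity)).2 fun x => ?_
  have e : -cplx y + (1 : ℝ) • cplx x.1 = cplx (x.1 - y) := by
    rw [map_sub, one_smul]; abel
  have := norm_resolventSup_le lam hb ht hs.le (x := x.1 - y) (by simpa using hy x.1 x.2)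
  rw [← e] at this
  exact this

theorem tendsto_functional_poleOn_propagate (lam : ℂ) (Λ : C(K, ℂ) →L[ℂ] ℂ)
    {y₀ a y : EuclideanSpace ℝ (Fin (n + 1))} {r : ℝ} (hr : 0 < r)
    (hball : ∀ x ∈ K, 3 * r ≤ ‖x - y₀‖) (ha : ‖a - y₀‖ ≤ r) (hy : ‖y - y₀‖ ≤ r)
    (hZ : ∀ᶠ z in 𝓝 a, Tendsto (fun m => Λ (poleOn K lam m (cplx z))) atTop (𝓝 0)) :
    Tendsto (fun m => Λ (poleOn K lam m (cplx y))) atTop (𝓝 0) := by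
  set U : Set ℂ := Set.Ioo (-1 / 4 : ℝ) (5 / 4) ×ℂ Set.Ioo (-1 / 4 : ℝ) (1 / 4) with hU
  have hUo : IsOpen U := isOpen_Ioo.reProdIm isOpen_Ioo
  have hUc : Convex ℝ U := 
    ((convex_Ioo (-1 / 4 : ℝ) (5 / 4)).linear_preimage Complex.reLm).inter
      ((convex_Ioo (-1 / 4 : ℝ) (1 / 4)).linear_preimage Complex.imLm)
  set f : ℕ → ℂ → ℂ := fun m s => Λ (poleOn K lam m (cplx a + s • cplx (y - a))) with hf
  have hfd : ∀ m, Differentiable ℂ (f m) := fun m =>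
    ((contDiff_functional_poleOn lam Λ m).differentiable (by simp)).comp
      ((differentiable_id.smul_const _).const_add _)
  have hre : ∀ s ∈ U, ∀ x ∈ K,
      r ^ 2 ≤ (∑ i, (cplx x i - (cplx a + s • cplx (y - a)) i) ^ 2).re := by
    intro s hs x hx
    obtain ⟨⟨h1, h2⟩, h3, h4⟩ := hs
    have e : (∑ i, (cplx x i - (cplx a + s • cplx (y - a)) i) ^ 2).re =
        ‖x - a - s.re • (y - a)‖ ^ 2 - s.im ^ 2 * ‖y - a‖ ^ 2 := by
      rw [EuclideanSpace.real_norm_sq_eq, EuclideanSpace.real_norm_sq_eq, Finset.mul_sum,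
        ← Finset.sum_sub_distrib, Complex.re_sum]
      refine Finset.sum_congr rfl fun i _ => ?_
      simp [cplx_apply, sq]
      ring
    have h5 : ‖y - a‖ ≤ 2 * r := by
      have := norm_sub_le (y - y₀) (a - y₀)
      rw [sub_sub_sub_cancel_right] at this
      linarith
    have h6 : 3 / 2 * r ≤ ‖x - a - s.re • (y - a)‖ := by
      have e2 : x - y₀ = (x - a - s.re • (y - a)) +
          ((1 - s.re) • (a - y₀) + s.re • (y - y₀)) := by module
      have h7 := norm_add_le (x - a - s.re • (y - a)) ((1 - s.re) • (a - y₀) + s.re • (y - y₀))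
      rw [← e2] at h7
      have h8 := norm_add_le ((1 - s.re) • (a - y₀)) (s.re • (y - y₀))
      rw [norm_smul, norm_smul, Real.norm_eq_abs, Real.norm_eq_abs] at h8
      have h9 : |1 - s.re| * ‖a - y₀‖ ≤ |1 - s.re| * r := by gcongr
      have h10 : |s.re| * ‖y - y₀‖ ≤ |s.re| * r := by gcongr
      have h11 : |1 - s.re| + |s.re| ≤ 3 / 2 := by
        rcases abs_cases (1 - s.re) with ⟨h, _⟩ | ⟨h, _⟩ <;>
          rcases abs_cases s.re with ⟨h', _⟩ | ⟨h', _⟩ <;> linarith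
      have h12 := hball x hx
      nlinarith
    rw [e]
    have h13 : s.im ^ 2 ≤ 1 / 16 := by nlinarith
    have h14 : ‖y - a‖ ^ 2 ≤ (2 * r) ^ 2 := pow_le_pow_left₀ (norm_nonneg _) h5 2
    have h15 : (3 / 2 * r) ^ 2 ≤ ‖x - a - s.re • (y - a)‖ ^ 2 :=
      pow_le_pow_left₀ (by positivity) h6 2
    have h16 : s.im ^ 2 * ‖y - a‖ ^ 2 ≤ 1 / 16 * (2 * r) ^ 2 := by gcongr
    nlinarith [sq_nonneg r]
  obtain ⟨C, hC0, hC⟩ := exists_norm_functional_sub_le lam Λ (r := r ^ 2) (by positivity)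
  have hbound : ∀ s ∈ U, ∀ m l, ‖f m s - f l s‖ ≤ C * |smoothTime m - smoothTime l| :=
    fun s hs m l => hC m l _ (hre s hs)
  have hcs : Tendsto (fun p : ℕ × ℕ => C * |smoothTime p.1 - smoothTime p.2|) (atTop ×ˢ atTop)
      (𝓝 0) := by
    have h1 : Tendsto (fun p : ℕ × ℕ => smoothTime p.1) (atTop ×ˢ atTop) (𝓝 0) :=
      tendsto_smoothTime.comp tendsto_fst
    have h2 : Tendsto (fun p : ℕ × ℕ => smoothTime p.2) (atTop ×ˢ atTop) (𝓝 0) :=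
      tendsto_smoothTime.comp tendsto_snd
    simpa using (h1.sub h2).abs.const_mul C
  have hcauchy : UniformCauchySeqOn f atTop U := by
    rw [Metric.uniformCauchySeqOn_iff]
    intro ε hε
    have h1 := hcs.eventually (gt_mem_nhds hε)
    rw [prod_atTop_atTop_eq, eventually_atTop_prod_self] at h1
    obtain ⟨N, hN⟩ := h1
    exact ⟨N, fun m hm l hl s hs => (dist_eq_norm (f m s) (f l s)).trans_le
      (hbound s hs m l) |>.trans_lt (hN m l hm hl)⟩
  have hlim : ∀ s ∈ U, ∃ L, Tendsto (fun m => f m s) atTop (𝓝 L) := fun s hs =>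
    cauchySeq_tendsto_of_complete (hcauchy.cauchySeq hs)
  choose! F hF using hlim
  have hunif : TendstoUniformlyOn f F atTop U := hcauchy.tendstoUniformlyOn_of_tendsto hF
  have hFd : DifferentiableOn ℂ F U := hunif.tendstoLocallyUniformlyOn.differentiableOn
    (Eventually.of_forall fun m => (hfd m).differentiableOn) hUo
  have hFa : AnalyticOnNhd ℂ F U := hFd.analyticOnNhd hUo
  have h0U : (0 : ℂ) ∈ U := by
    rw [hU, Complex.mem_reProdIm]; norm_num
  have h1U : (1 : ℂ) ∈ U := by
    rw [hU, Complex.mem_reProdIm]; norm_num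
  have hreal : ∀ σ : ℝ, cplx a + (σ : ℂ) • cplx (y - a) = cplx (a + σ • (y - a)) := by
    intro σ
    rw [map_add, map_smul]
    rfl
  have hzero : ∃ᶠ s in 𝓝[≠] (0 : ℂ), F s = 0 := by
    have c : Tendsto (fun σ : ℝ => a + σ • (y - a)) (𝓝 0) (𝓝 a) := by
      have : Continuous fun σ : ℝ => a + σ • (y - a) := by fun_prop
      simpa using this.tendsto 0
    have c2 : Tendsto (fun σ : ℝ => (σ : ℂ)) (𝓝[≠] 0) (𝓝[≠] 0) := by
      refine tendsto_nhdsWithin_of_tendsto_nhds_of_eventually_within _ ?_ ?_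
      · exact (Complex.continuous_ofReal.tendsto' 0 0 Complex.ofReal_zero).mono_left
          nhdsWithin_le_nhds
      · filter_upwards [self_mem_nhdsWithin] with σ hσ
        simpa using hσ
    have h1 : ∀ᶠ σ : ℝ in 𝓝[≠] 0, F (σ : ℂ) = 0 := by
      filter_upwards [(c.eventually hZ).filter_mono nhdsWithin_le_nhds,
        c2.eventually (mem_nhdsWithin_of_mem_nhds (hUo.mem_nhds h0U))] with σ h1 h2
      refine tendsto_nhds_unique (hF _ h2) ?_
      simp only [hf, hreal]
      exact h1
    exact c2.frequently h1.frequently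
  have hF1 := hFa.eqOn_zero_of_preconnected_of_frequently_eq_zero hUc.isPreconnected h0U hzero h1U
  have := hF 1 h1U
  rw [hF1] at this
  have e : cplx a + (1 : ℂ) • cplx (y - a) = cplx y := by
    simp
  simpa only [hf, e, Pi.zero_apply] using this

theorem tendsto_functional_poleOn (lam : ℂ) (Λ : C(K, ℂ) →L[ℂ] ℂ)
    (hΛ : ∀ f : C(EuclideanSpace ℝ (Fin (n + 1)), ℂ), ContDiff ℝ (⊤ : ℕ∞) f →
      (∀ x, lap f x = lam * f x) → Λ (f.restrict K) = 0)
    (hKc : IsPreconnected Kᶜ) {y : EuclideanSpace ℝ (Fin (n + 1))} (hy : y ∉ K) :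
    Tendsto (fun m => Λ (poleOn K lam m (cplx y))) atTop (𝓝 0) := by
  have hK : IsCompact K := isCompact_iff_compactSpace.2 inferInstance
  set A : Set (EuclideanSpace ℝ (Fin (n + 1))) :=
    {z | ∀ᶠ z' in 𝓝 z, Tendsto (fun m => Λ (poleOn K lam m (cplx z'))) atTop (𝓝 0)} with hA
  have hAo : IsOpen A := isOpen_iff_mem_nhds.2 fun z hz => eventually_eventually_nhds.2 hz
  suffices h : Kᶜ ⊆ A from (h hy : ∀ᶠ z' in 𝓝 y, _).self_of_nhds
  refine hKc.subset_of_closure_inter_subset hAo ?_ ?_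
  · obtain ⟨R, hR0, hR⟩ := exists_norm_cplx_le K
    have hco : Continuous fun z : EuclideanSpace ℝ (Fin (n + 1)) => z 0 := by fun_prop
    have hxR : ∀ x ∈ K, x 0 ≤ R := fun x hx => by
      have h1 := (norm_le_pi_norm (cplx x) 0).trans (hR x hx)
      rw [cplx_apply, Complex.norm_real] at h1
      exact (le_abs_self _).trans h1
    refine ⟨EuclideanSpace.single 0 (R + 2), fun h => ?_, ?_⟩
    · have := hxR _ h
      simp at this
      linarith
    · have h2 : ∀ᶠ z : EuclideanSpace ℝ (Fin (n + 1)) in 𝓝 (EuclideanSpace.single 0 (R + 2)),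
          R + 1 < z 0 := hco.continuousAt.eventually (lt_mem_nhds (by simp))
      filter_upwards [h2] with z hz
      exact tendsto_functional_poleOn_of_far lam Λ hΛ one_pos fun x hx => by
        linarith [hxR x hx]
  · rintro y₀ ⟨h1, h2⟩
    obtain ⟨ρ, hρ, hball⟩ := Metric.isOpen_iff.1 hK.isClosed.isOpen_compl y₀ h2
    have hρ3 : 0 < ρ / 3 := by positivity
    obtain ⟨a, haA, ha⟩ := Metric.mem_closure_iff.1 h1 _ hρ3
    filter_upwards [Metric.ball_mem_nhds y₀ hρ3] with z hz
    refine tendsto_functional_poleOn_propagate lam Λ hρ3 (y₀ := y₀) (a := a) (fun x hx => ?_) ?_ ?_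
      haA
    · by_contra hlt
      rw [not_le] at hlt
      exact hball (by rw [Metric.mem_ball, dist_eq_norm]; linarith) hx
    · rw [← dist_eq_norm, dist_comm]; exact ha.le
    · rw [← dist_eq_norm]; exact (Metric.mem_ball.1 hz).le

end Functional

section Representation

open MeasureTheory Filter Topology

theorem integral_mul_pd {d : ℕ} {s h : EuclideanSpace ℝ (Fin d) → ℂ}
    (hs : ContDiff ℝ (⊤ : ℕ∞) s) (hh : ContDiff ℝ (⊤ : ℕ∞) h) (hc : HasCompactSupport h)
    (j : Fin d) : ∫ x, s x * pd j h x = -∫ x, pd j s x * h x := by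
  have hc' : HasCompactSupport (pd j h) := hc.fderiv_apply (𝕜 := ℝ) _
  exact integral_mul_fderiv_eq_neg_fderiv_mul_of_integrable
    (((hs.pd j).continuous.fun_mul hh.continuous).integrable_of_hasCompactSupport hc.mul_left)
    ((hs.continuous.fun_mul (hh.pd j).continuous).integrable_of_hasCompactSupport hc'.mul_left)
    ((hs.continuous.fun_mul hh.continuous).integrable_of_hasCompactSupport hc.mul_left)
    (fun x _ => differentiableAt_of_smooth hs.contDiffAt)
    (fun x _ => differentiableAt_of_smooth hh.contDiffAt)

theorem HasCompactSupport.lap {d : ℕ} {h : EuclideanSpace ℝ (Fin d) → ℂ}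
    (hc : HasCompactSupport h) : HasCompactSupport (lap h) := by
  refine hc.mono' fun x hx => ?_
  by_contra hx'
  have h1 := lap_congr (notMem_tsupport_iff_eventuallyEq.1 hx')
  exact hx (h1.self_of_nhds.trans (lap_zero x))

theorem integral_mul_lap {d : ℕ} {s h : EuclideanSpace ℝ (Fin d) → ℂ}
    (hs : ContDiff ℝ (⊤ : ℕ∞) s) (hh : ContDiff ℝ (⊤ : ℕ∞) h) (hc : HasCompactSupport h) :
    ∫ x, s x * lap h x = ∫ x, lap s x * h x := by
  simp only [lap, Finset.mul_sum, Finset.sum_mul]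
  have hc' : ∀ j, HasCompactSupport (pd j h) := fun j => hc.fderiv_apply (𝕜 := ℝ) _
  have hc'' : ∀ j, HasCompactSupport (pd j (pd j h)) := fun j => (hc' j).fderiv_apply (𝕜 := ℝ) _
  rw [integral_finsetSum _ fun j _ => (hs.continuous.fun_mul
      ((hh.pd j).pd j).continuous).integrable_of_hasCompactSupport (hc'' j).mul_left,
    integral_finsetSum _ fun j _ => (((hs.pd j).pd j).continuous.fun_mul
      hh.continuous).integrable_of_hasCompactSupport hc.mul_left]
  refine Finset.sum_congr rfl fun j _ => ?_
  rw [integral_mul_pd hs (hh.pd j) (hc' j), integral_mul_pd (hs.pd j) hh hc, neg_neg]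

variable {n : ℕ}

theorem integral_resolventSup_mul (lam : ℂ) {t : ℝ} (ht : 0 < t)
    {φ : EuclideanSpace ℝ (Fin (n + 1)) → ℂ} (hφ : ContDiff ℝ (⊤ : ℕ∞) φ)
    (hc : HasCompactSupport φ) (x : EuclideanSpace ℝ (Fin (n + 1))) :
    ∫ y, resolventSup n lam 1 t (cplx x + (-1 : ℝ) • cplx y) * (lap φ y - lam * φ y) =
      ∫ y, heatSup n lam 1 t (cplx x + (-1 : ℝ) • cplx y) * φ y := by
  have hs := contDiff_resolventSup_affine (n := n) lam le_rfl ht (cplx x) (-1)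
  have i1 := (hs.continuous.fun_mul hφ.lap.continuous).integrable_of_hasCompactSupport
    (μ := volume) hc.lap.mul_left
  have i2 := (hs.continuous.fun_mul hφ.continuous).integrable_of_hasCompactSupport
    (μ := volume) hc.mul_left
  have i3 := (hs.lap.continuous.fun_mul hφ.continuous).integrable_of_hasCompactSupport
    (μ := volume) hc.mul_left
  have e1 : ∀ y, resolventSup n lam 1 t (cplx x + (-1 : ℝ) • cplx y) * (lap φ y - lam * φ y) =
      resolventSup n lam 1 t (cplx x + (-1 : ℝ) • cplx y) * lap φ y -
      lam * (resolventSup n lam 1 t (cplx x + (-1 : ℝ) • cplx y) * φ y) := fun y => by ring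
  simp only [e1]
  rw [integral_sub i1 (i2.const_mul lam), integral_mul_lap hs hφ hc,
    ← integral_sub i3 (i2.const_mul lam)]
  congr 1
  funext y
  rw [lap_resolventSup_affine lam le_rfl ht (cplx x) (by norm_num) y]
  ring

theorem tendsto_integral_heatSup (lam : ℂ) {φ : EuclideanSpace ℝ (Fin (n + 1)) → ℂ}
    (hφ : Continuous φ) (hc : HasCompactSupport φ) (x : EuclideanSpace ℝ (Fin (n + 1))) :
    Tendsto (fun m => ∫ y, heatSup n lam 1 (smoothTime m) (cplx x + (-1 : ℝ) • cplx y) * φ y)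
      atTop (𝓝 ((2 * Real.pi : ℝ) ^ (n + 1) * φ x)) := by
  have h1 := Real.tendsto_integral_gaussian_smul'
    (hφ.integrable_of_hasCompactSupport (μ := volume) hc) (hφ.continuousAt (x := x))
  have h2 : Tendsto (fun m => 1 / (4 * Real.pi ^ 2 * smoothTime m)) atTop atTop := by
    have h3 : Tendsto smoothTime atTop (𝓝[>] 0) :=
      tendsto_nhdsWithin_iff.2 ⟨tendsto_smoothTime, Eventually.of_forall smoothTime_pos⟩
    refine (h3.inv_tendsto_nhdsGT_zero.const_mul_atTop
      (show 0 < 1 / (4 * Real.pi ^ 2) by positivity)).congr fun m => ?_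
    simp only [Pi.inv_apply]
    field_simp
  have h3 : Tendsto (fun m => ((2 * Real.pi : ℝ) : ℂ) ^ (n + 1) *
      Complex.exp (-smoothTime m * lam)) atTop (𝓝 ((2 * Real.pi : ℝ) ^ (n + 1))) := by
    have h4 : Tendsto (fun m => Complex.exp (-smoothTime m * lam)) atTop (𝓝 1) := by
      have h5 : Tendsto (fun m => (smoothTime m : ℂ)) atTop (𝓝 0) :=
        (Complex.continuous_ofReal.tendsto' 0 0 Complex.ofReal_zero).comp tendsto_smoothTime
      have h6 := (Complex.continuous_exp.tendsto _).comp (h5.neg.mul_const lam)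
      simpa [Function.comp_def] using h6
    simpa using h4.const_mul (((2 * Real.pi : ℝ) : ℂ) ^ (n + 1))
  refine (h3.mul (h1.comp h2)).congr fun m => ?_
  have ht := smoothTime_pos m
  simp only [Function.comp_apply]
  set t := smoothTime m
  rw [← integral_const_mul]
  congr 1
  funext y
  have e1 : ((Real.pi : ℂ) * (1 / (4 * Real.pi ^ 2 * t) : ℝ)) ^
      ((Module.finrank ℝ (EuclideanSpace ℝ (Fin (n + 1))) : ℂ) / 2) =
      ((√(1 / (4 * Real.pi * t)) : ℝ) : ℂ) ^ (n + 1) := by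
    rw [finrank_euclideanSpace_fin, div_eq_mul_one_div ((n + 1 : ℕ) : ℂ), Complex.cpow_nat_mul, Real.sqrt_eq_rpow,
      Complex.ofReal_cpow (by positivity), ← Complex.ofReal_mul]
    have : Real.pi * (1 / (4 * Real.pi ^ 2 * t)) = 1 / (4 * Real.pi * t) := by
      field_simp
    rw [this]
    push_cast
    rfl
  have e2 : √(Real.pi / t) = 2 * Real.pi * √(1 / (4 * Real.pi * t)) := by
    rw [← Real.sqrt_sq (show 0 ≤ 2 * Real.pi by positivity), ← Real.sqrt_mul (by positivity)]
    congr 1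
    field_simp
    ring
  have e3 : ∑ i, (cplx x + (-1 : ℝ) • cplx y) i ^ 2 = ((‖x - y‖ ^ 2 : ℝ) : ℂ) := by
    rw [EuclideanSpace.real_norm_sq_eq]
    push_cast
    refine Finset.sum_congr rfl fun i _ => ?_
    simp [cplx_apply]
    ring
  rw [e1, heatSup_eq lam zero_le_one ht, e2, e3, smul_eq_mul, sub_eq_add_neg (-(t : ℂ) * lam), Complex.exp_add]
  have e4 : (-Real.pi ^ 2 * (1 / (4 * Real.pi ^ 2 * t) : ℝ) * (‖x - y‖ : ℂ) ^ 2 : ℂ) =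
      -(((‖x - y‖ ^ 2 : ℝ) : ℂ) / (4 * t)) := by
    have : (Real.pi : ℂ) ≠ 0 := by exact_mod_cast Real.pi_ne_zero
    have : (t : ℂ) ≠ 0 := by exact_mod_cast ht.ne'
    push_cast
    field_simp
  rw [e4]
  push_cast
  ring

end Representation

section Runge

open MeasureTheory Filter Topology

variable {n : ℕ} {K : Set (EuclideanSpace ℝ (Fin (n + 1)))}

theorem continuous_poleOn (lam : ℂ) (m : ℕ) : Continuous (poleOn K lam m) := by
  have h0 : Continuous (resolventSup n lam 1 (smoothTime m)) :=
    (contDiff_expSuperpos (expIntegrable_exp_div_freqSymbol lam le_rfl (smoothTime_pos m))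
      (measurable_freq lam 1)).continuous
  have h : Continuous fun p : (Fin (n + 1) → ℂ) × K =>
      resolventSup n lam 1 (smoothTime m) (-p.1 + (1 : ℝ) • cplx p.2.1) :=
    h0.comp (by fun_prop)
  exact (ContinuousMap.curry ⟨_, h⟩).continuous

theorem re_sum_sub_sq (x y : EuclideanSpace ℝ (Fin (n + 1))) :
    (∑ i, (cplx x i - cplx y i) ^ 2).re = ‖x - y‖ ^ 2 := by
  rw [EuclideanSpace.real_norm_sq_eq, Complex.re_sum]
  refine Finset.sum_congr rfl fun i _ => ?_
  rw [cplx_apply, cplx_apply, ← Complex.ofReal_sub, ← Complex.ofReal_pow, Complex.ofReal_re]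
  rfl

theorem functional_restrict_eq_zero [CompactSpace K] (lam : ℂ) (Λ : C(K, ℂ) →L[ℂ] ℂ)
    (hΛ : ∀ f : C(EuclideanSpace ℝ (Fin (n + 1)), ℂ), ContDiff ℝ (⊤ : ℕ∞) f →
      (∀ x, lap f x = lam * f x) → Λ (f.restrict K) = 0)
    (hKc : IsPreconnected Kᶜ) {φ : C(EuclideanSpace ℝ (Fin (n + 1)), ℂ)}
    (hφ : ContDiff ℝ (⊤ : ℕ∞) φ) (hc : HasCompactSupport φ)
    (hdisj : Disjoint K (tsupport fun y => lap φ y - lam * φ y)) :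
    Λ (φ.restrict K) = 0 := by
  have hK : IsCompact K := isCompact_iff_compactSpace.2 inferInstance
  set g : EuclideanSpace ℝ (Fin (n + 1)) → ℂ := fun y => lap φ y - lam * φ y with hg
  have hgc : Continuous g := hφ.lap.continuous.sub (hφ.continuous.const_mul lam)
  have hgs : HasCompactSupport g := hc.lap.sub hc.mul_left
  obtain ⟨δ, hδ, hsep⟩ : ∃ δ : ℝ, 0 < δ ∧ ∀ x ∈ K, ∀ y ∈ tsupport g, δ ≤ ‖x - y‖ := by
    obtain ⟨δ, hδ, h⟩ := hdisj.exists_thickenings hK (isClosed_tsupport g)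
    refine ⟨δ, hδ, fun x hx y hy => ?_⟩
    by_contra hlt
    rw [not_le, ← dist_eq_norm] at hlt
    exact Set.disjoint_left.1 h (Metric.self_subset_thickening hδ _ hx)
      (Metric.mem_thickening_iff.2 ⟨y, hy, hlt⟩)
  obtain ⟨C, hC0, hC⟩ := exists_norm_poleOn_sub_le K lam (pow_pos hδ 2)
  have hCs : ∀ m l, ∀ y ∈ tsupport g, ‖poleOn K lam m (cplx y) - poleOn K lam l (cplx y)‖ ≤
      C * |smoothTime m - smoothTime l| := fun m l y hy => hC m l _ fun x hx => by
    rw [re_sum_sub_sq]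
    exact pow_le_pow_left₀ hδ.le (hsep x hx y hy) 2
  set P : ℕ → EuclideanSpace ℝ (Fin (n + 1)) → C(K, ℂ) := fun m y => g y • poleOn K lam m (cplx y)
    with hP
  have hPi : ∀ m, Integrable (P m) := fun m =>
    (hgc.fun_smul ((continuous_poleOn lam m).comp cplx.continuous)).integrable_of_hasCompactSupport
      hgs.smul_right
  have hPsub : ∀ m l y, ‖P m y - P l y‖ ≤ ‖g y‖ * (C * |smoothTime m - smoothTime l|) := by
    intro m l y
    rw [hP]
    simp only
    rw [← smul_sub, norm_smul]
    by_cases hy : y ∈ tsupport g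
    · exact mul_le_mul_of_nonneg_left (hCs m l y hy) (norm_nonneg _)
    · rw [image_eq_zero_of_notMem_tsupport hy]
      simp
  have hgi : Integrable (fun y => ‖g y‖) := (hgc.integrable_of_hasCompactSupport hgs).norm
  set u : ℕ → C(K, ℂ) := fun m => ∫ y, P m y with hu
  have hlim : ∃ v, Tendsto u atTop (𝓝 v) := by
    refine cauchySeq_tendsto_of_complete ?_
    have hst := tendsto_smoothTime.cauchySeq
    rw [Metric.cauchySeq_iff] at hst ⊢
    intro ε hε
    set A := (∫ y, ‖g y‖) * C with hA
    have hA0 : 0 ≤ A := mul_nonneg (integral_nonneg fun _ => norm_nonneg _) hC0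
    obtain ⟨N, hN⟩ := hst (ε / (A + 1)) (by positivity)
    refine ⟨N, fun m hm l hl => ?_⟩
    have h1 := hN m hm l hl
    rw [Real.dist_eq] at h1
    rw [dist_eq_norm, hu]
    simp only
    rw [← integral_sub (hPi m) (hPi l)]
    calc ‖∫ y, (P m y - P l y)‖ ≤ ∫ y, ‖g y‖ * (C * |smoothTime m - smoothTime l|) :=
          norm_integral_le_of_norm_le (hgi.mul_const _) (Eventually.of_forall (hPsub m l))
      _ = A * |smoothTime m - smoothTime l| := by rw [integral_mul_const, hA]; ring
      _ ≤ (A + 1) * |smoothTime m - smoothTime l| := by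
          gcongr; linarith
      _ < (A + 1) * (ε / (A + 1)) := by gcongr
      _ = ε := by field_simp
  obtain ⟨v, hv⟩ := hlim
  have hval : v = ((2 * Real.pi : ℝ) : ℂ) ^ (n + 1) • φ.restrict K := by
    ext x
    have h1 : Tendsto (fun m => u m x) atTop (𝓝 (v x)) :=
      ((continuous_eval_const x).tendsto v).comp hv
    refine tendsto_nhds_unique h1 ((tendsto_integral_heatSup lam hφ.continuous hc x.1).congr
      fun m => ?_)
    rw [hu]
    simp only
    rw [ContinuousMap.integral_apply (hPi m), ← integral_resolventSup_mul lam (smoothTime_pos m) hφ hc]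
    congr 1
    funext y
    simp only [hP, hg, ContinuousMap.smul_apply, poleOn, ContinuousMap.coe_mk, smul_eq_mul]
    rw [mul_comm, one_smul, neg_one_smul, add_comm (-cplx y)]
  have hΛ0 : Tendsto (fun m => Λ (u m)) atTop (𝓝 0) := by
    have e : ∀ m, Λ (u m) = ∫ y, Λ (P m y) := fun m =>
      (ContinuousLinearMap.integral_comp_comm _ (hPi m)).symm
    simp only [e]
    have h2 : Tendsto (fun m => ∫ y, Λ (P m y)) atTop (𝓝 (∫ _ : EuclideanSpace ℝ (Fin (n + 1)), (0 : ℂ))) := by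
      refine tendsto_integral_of_dominated_convergence
        (fun y => ‖Λ‖ * (‖P 0 y‖ + ‖g y‖ * C))
        (fun m => (Λ.integrable_comp (hPi m)).aestronglyMeasurable)
        (((hPi 0).norm.add (hgi.mul_const C)).const_mul _) (fun m => ?_) ?_
      · refine Eventually.of_forall fun y => (Λ.le_opNorm _).trans ?_
        refine mul_le_mul_of_nonneg_left ?_ (norm_nonneg _)
        have h3 := hPsub m 0 y
        have h4 : |smoothTime m - smoothTime 0| ≤ 1 := by
          rw [abs_le]
          constructor <;> linarith [smoothTime_pos m, smoothTime_pos 0, smoothTime_le_one m,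
            smoothTime_le_one 0]
        have h5 : ‖g y‖ * (C * |smoothTime m - smoothTime 0|) ≤ ‖g y‖ * C :=
          mul_le_mul_of_nonneg_left (mul_le_of_le_one_right hC0 h4) (norm_nonneg _)
        have h6 := norm_le_norm_add_norm_sub' (P m y) (P 0 y)
        linarith
      · refine Eventually.of_forall fun y => ?_
        simp only [hP, map_smul, smul_eq_mul]
        by_cases hy : y ∈ tsupport g
        · have hyK : y ∉ K := fun h => Set.disjoint_left.1 hdisj h hy
          simpa using (tendsto_functional_poleOn lam Λ hΛ hKc hyK).const_mul (g y)
        · rw [image_eq_zero_of_notMem_tsupport hy]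
          simp
    simpa using h2
  have h7 := tendsto_nhds_unique ((Λ.continuous.tendsto v).comp hv) hΛ0
  rw [hval, map_smul, smul_eq_mul] at h7
  refine (mul_eq_zero.1 h7).resolve_left (pow_ne_zero _ ?_)
  exact_mod_cast (by positivity : (2 * Real.pi : ℝ) ≠ 0)

end Runge

section RungeApprox

open Filter Topology Manifold

theorem ContDiffOn.exists_compactSupport_eventuallyEq {E : Type*} [NormedAddCommGroup E]
    [NormedSpace ℝ E] [FiniteDimensional ℝ E] {K Ω : Set E} (hK : IsCompact K) (hΩ : IsOpen Ω)
    (hKΩ : K ⊆ Ω) {h : E → ℂ} (hh : ContDiffOn ℝ (⊤ : ℕ∞) h Ω) :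
    ∃ φ : E → ℂ, ContDiff ℝ (⊤ : ℕ∞) φ ∧ HasCompactSupport φ ∧ ∀ᶠ x in 𝓝ˢ K, φ x = h x := by
  obtain ⟨L, hL, hKL, hLΩ⟩ := exists_compact_between hK hΩ hKΩ
  obtain ⟨χ, h1, h0, -⟩ := exists_contMDiffMap_one_nhds_of_subset_interior (n := (⊤ : ℕ∞))
    𝓘(ℝ, E) hK.isClosed hKL
  have hχ : ContDiff ℝ (⊤ : ℕ∞) χ := χ.contMDiff.contDiff
  refine ⟨fun x => (χ x : ℂ) * h x, contDiff_iff_contDiffAt.2 fun x => ?_,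
    HasCompactSupport.intro hL fun x hx => by simp [h0 x hx], h1.mono fun x hx => by simp [hx]⟩
  by_cases hx : x ∈ Ω
  · exact (Complex.ofRealCLM.contDiff.comp hχ).contDiffAt.mul (hh.contDiffAt (hΩ.mem_nhds hx))
  · have h2 : (fun x => (χ x : ℂ) * h x) =ᶠ[𝓝 x] fun _ => 0 := by
      filter_upwards [hL.isClosed.isOpen_compl.mem_nhds fun hxL => hx (hLΩ hxL)] with y hy
      simp [h0 y hy]
    exact contDiffAt_const.congr_of_eventuallyEq h2

/-- Runge approximation for the eigenvalue equation `Δf = λf`. -/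
theorem exists_entire_norm_sub_lt {d : ℕ} (hd : 0 < d) {lam : ℂ}
    {K Ω : Set (EuclideanSpace ℝ (Fin d))} (hK : IsCompact K) (hΩ : IsOpen Ω) (hKΩ : K ⊆ Ω)
    (hKc : IsPreconnected Kᶜ) {h : EuclideanSpace ℝ (Fin d) → ℂ}
    (hh : ContDiffOn ℝ (⊤ : ℕ∞) h Ω) (hlap : ∀ x ∈ Ω, lap h x = lam * h x) {ε : ℝ} (hε : 0 < ε) :
    ∃ F : EuclideanSpace ℝ (Fin d) → ℂ, ContDiff ℝ (⊤ : ℕ∞) F ∧ (∀ x, lap F x = lam * F x) ∧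
      ∀ x ∈ K, ‖F x - h x‖ < ε := by
  obtain ⟨n, rfl⟩ : ∃ n, d = n + 1 := ⟨d - 1, by omega⟩
  obtain ⟨φ₀, hφ, hφc, hφh⟩ := hh.exists_compactSupport_eventuallyEq hK hΩ hKΩ
  obtain ⟨φ, rfl⟩ : ∃ φ : C(EuclideanSpace ℝ (Fin (n + 1)), ℂ), ⇑φ = φ₀ :=
    ⟨⟨φ₀, hφ.continuous⟩, rfl⟩
  have hcK : CompactSpace K := isCompact_iff_compactSpace.1 hK
  have hdisj : Disjoint K (tsupport fun y => lap φ y - lam * φ y) := by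
    refine Set.disjoint_left.2 fun x hx => notMem_tsupport_iff_eventuallyEq.2 ?_
    have h1 : φ =ᶠ[𝓝 x] h := mem_nhdsSet_iff_forall.1 hφh x hx
    filter_upwards [lap_congr h1, h1, hΩ.mem_nhds (hKΩ hx)] with y h2 h3 h4
    simp [h2, h3, hlap y h4]
  let S : Submodule ℂ C(K, ℂ) :=
    { carrier := {q | ∃ f : C(EuclideanSpace ℝ (Fin (n + 1)), ℂ), ContDiff ℝ (⊤ : ℕ∞) f ∧
        (∀ x, lap f x = lam * f x) ∧ f.restrict K = q}
      add_mem' := by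
        rintro _ _ ⟨f, hf, hfl, rfl⟩ ⟨g, hg, hgl, rfl⟩
        refine ⟨f + g, hf.add hg, fun x => ?_, rfl⟩
        have h1 := lap_add hf.contDiffAt hg.contDiffAt (x := x)
        rw [hfl, hgl] at h1
        exact h1.trans (by rw [ContinuousMap.add_apply]; ring)
      zero_mem' := ⟨0, contDiff_const, fun x => (lap_zero x).trans (by simp), rfl⟩
      smul_mem' := by
        rintro c _ ⟨f, hf, hfl, rfl⟩
        refine ⟨c • f, contDiff_const.smul hf, fun x => ?_, rfl⟩
        have h1 := lap_mul (f := fun _ => c) contDiffAt_const hf.contDiffAt (x := x)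
        have h2 : ∀ j : Fin (n + 1), pd j (fun _ : EuclideanSpace ℝ (Fin (n + 1)) => c) =
            fun _ => 0 := fun j => by
          funext y
          simp [pd]
        have h3 : lap (fun _ : EuclideanSpace ℝ (Fin (n + 1)) => c) x = 0 := by
          simp only [lap, h2]
          simp [pd]
        rw [h3, hfl] at h1
        simp only [h2] at h1
        refine h1.trans ?_
        rw [ContinuousMap.smul_apply, smul_eq_mul]
        simp only [zero_mul, Finset.sum_const_zero, mul_zero, add_zero]
        ring }
  have hmem : φ.restrict K ∈ S.topologicalClosure := by
    by_contra hnot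
    obtain ⟨Λ, u, hu, hu'⟩ := RCLike.geometric_hahn_banach_closed_point (𝕜 := ℂ)
      ((S.topologicalClosure.restrictScalars ℝ).convex) S.isClosed_topologicalClosure hnot
    have hS : ∀ a ∈ S.topologicalClosure, (Λ a).re < u := hu
    have hu0 : 0 < u := by simpa using hS 0 (zero_mem _)
    have hΛ0 : ∀ a ∈ S, Λ a = 0 := by
      intro a ha
      by_contra hne
      have h1 := hS (((u : ℂ) * (Λ a)⁻¹) • a)
        (S.le_topologicalClosure (S.smul_mem _ ha))
      rw [map_smul, smul_eq_mul, mul_assoc, inv_mul_cancel₀ hne, mul_one, Complex.ofReal_re] at h1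
      exact lt_irrefl _ h1
    have h2 := functional_restrict_eq_zero lam Λ (fun f hf hfl => hΛ0 _ ⟨f, hf, hfl, rfl⟩) hKc hφ
      hφc hdisj
    rw [h2] at hu'
    simp at hu'
    linarith
  obtain ⟨q, ⟨f, hf, hfl, rfl⟩, hq⟩ := Metric.mem_closure_iff.1 hmem ε hε
  refine ⟨f, hf, hfl, fun x hx => ?_⟩
  have h1 : φ x = h x := hφh.self_of_nhdsSet x hx
  rw [dist_comm, dist_eq_norm] at hq
  have h2 := (ContinuousMap.norm_coe_le_norm (f.restrict K - φ.restrict K) ⟨x, hx⟩).trans_lt hq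
  rw [← h1]
  exact h2

end RungeApprox

section Complement

open Filter Topology Metric

theorem IsPreconnected.diff_of_isPreconnected_diff {α : Type*} [TopologicalSpace α]
    {S K U : Set α} (hS : IsPreconnected S) (hSo : IsOpen S) (hK : IsClosed K) (hU : IsOpen U)
    (hKU : K ⊆ U) (hUK : IsPreconnected (U \ K)) (hUS : U ⊆ S) :
    IsPreconnected (S \ K) := by
  rw [isPreconnected_iff_subset_of_disjoint] at hS hUK ⊢
  have key : ∀ A B : Set α, IsOpen A → IsOpen B → S \ K ⊆ A ∪ B → S \ K ∩ (A ∩ B) = ∅ →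
      U \ K ⊆ A → S \ K ⊆ A ∨ S \ K ⊆ B := by
    intro A B hA hB hAB hd hUA
    have hSKo : IsOpen (S \ K) := hSo.sdiff hK
    rw [Set.eq_empty_iff_forall_notMem] at hd
    have hcover : S ⊆ A ∩ (S \ K) ∪ U ∪ B ∩ (S \ K) := by
      intro x hx
      by_cases hxK : x ∈ K
      · exact Or.inl (Or.inr (hKU hxK))
      · rcases hAB ⟨hx, hxK⟩ with h1 | h1
        · exact Or.inl (Or.inl ⟨h1, hx, hxK⟩)
        · exact Or.inr ⟨h1, hx, hxK⟩
    have hempty : S ∩ ((A ∩ (S \ K) ∪ U) ∩ (B ∩ (S \ K))) = ∅ := by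
      rw [Set.eq_empty_iff_forall_notMem]
      rintro x ⟨-, h1 | h1, h2⟩
      · exact hd x ⟨h2.2, h1.1, h2.1⟩
      · exact hd x ⟨h2.2, hUA ⟨h1, h2.2.2⟩, h2.1⟩
    rcases hS _ _ ((hA.inter hSKo).union hU) (hB.inter hSKo) hcover hempty with h | h
    · left
      intro x hx
      rcases h hx.1 with h1 | h1
      · exact h1.1
      · exact hUA ⟨h1, hx.2⟩
    · right
      exact fun x hx => (h hx.1).1
  intro A B hA hB hAB hd
  have hsub : U \ K ⊆ S \ K := Set.sdiff_subset_sdiff_left hUS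
  rcases hUK A B hA hB (hsub.trans hAB)
    (Set.subset_empty_iff.1 (hd ▸ Set.inter_subset_inter_left _ hsub)) with h | h
  · exact key A B hA hB hAB hd h
  · exact (key B A hB hA (by rwa [Set.union_comm]) (by rwa [Set.inter_comm B]) h).symm

theorem isPreconnected_ball_diff_closedBall {E : Type*} [NormedAddCommGroup E] [NormedSpace ℝ E]
    (h : 1 < Module.rank ℝ E) {r R : ℝ} (hr : 0 ≤ r) :
    IsPreconnected (ball (0 : E) R \ closedBall 0 r) := by
  have h1 : ball (0 : E) R \ closedBall 0 r =
      (fun p : ℝ × E => p.1 • p.2) '' (Set.Ioo r R ×ˢ sphere 0 1) := by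
    ext x
    simp only [Set.mem_sdiff, mem_ball_zero_iff, mem_closedBall_zero_iff, not_le, Set.mem_image,
      Set.mem_prod, Set.mem_Ioo, mem_sphere_zero_iff_norm, Prod.exists]
    constructor
    · rintro ⟨h1, h2⟩
      have h3 : ‖x‖ ≠ 0 := (hr.trans_lt h2).ne'
      refine ⟨‖x‖, ‖x‖⁻¹ • x, ⟨⟨h2, h1⟩, ?_⟩, smul_inv_smul₀ h3 x⟩
      rw [norm_smul, norm_inv, norm_norm, inv_mul_cancel₀ h3]
    · rintro ⟨t, u, ⟨⟨h1, h2⟩, h3⟩, rfl⟩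
      rw [norm_smul, h3, mul_one, Real.norm_of_nonneg (hr.trans h1.le)]
      exact ⟨h2, h1⟩
  rw [h1]
  exact (isPreconnected_Ioo.prod (isPreconnected_sphere h 0 1)).image _ (by fun_prop)

theorem isPreconnected_compl_union_image {α : Type*} [TopologicalSpace α] [PreconnectedSpace α]
    {B U : Set α} {f : α → α} (hB : IsClosed B) (hU : IsOpen U) (hBU : B ⊆ U)
    (hUB : IsPreconnected (U \ B)) (hf : ContinuousOn f U) (hinj : Set.InjOn f U)
    (hfU : IsOpen (f '' U)) (hfB : IsClosed (f '' B)) (hdisj : Disjoint (f '' U) B) :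
    IsPreconnected (B ∪ f '' B)ᶜ := by
  have h1 : IsPreconnected Bᶜ := by
    rw [Set.compl_eq_univ_sdiff]
    exact isPreconnected_univ.diff_of_isPreconnected_diff isOpen_univ hB hU hBU hUB
      (Set.subset_univ U)
  have h2 : (B ∪ f '' B)ᶜ = Bᶜ \ f '' B := by rw [Set.compl_union, Set.sdiff_eq]
  rw [h2]
  refine h1.diff_of_isPreconnected_diff hB.isOpen_compl hfB hfU (Set.image_mono hBU) ?_
    (Set.disjoint_left.1 hdisj)
  rw [← hinj.image_sdiff_subset hBU]
  exact hUB.image f (hf.mono Set.sdiff_subset)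

end Complement

section Sufficiency

open Filter Topology Metric

variable {d : ℕ} {lam : ℂ} {X : Set (EuclideanSpace ℝ (Fin d))}
  {w : EuclideanSpace ℝ (Fin d) → ℂ}
  {ψ : EuclideanSpace ℝ (Fin d) → EuclideanSpace ℝ (Fin d)}

theorem Eig.exists_norm_sub_lt_subset {U : Set (Eig d lam X)} (hU : IsOpen U) {f : Eig d lam X}
    (hf : f ∈ U) : ∃ K : Set X, IsCompact K ∧ ∃ ε : ℝ, 0 < ε ∧
      ∀ g : Eig d lam X, (∀ x ∈ K, ‖g.1 x - f.1 x‖ < ε) → g ∈ U := by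
  have hb := nhds_basis_uniformity (x := f.1)
    (uniformity_basis_dist (α := ℂ)).compactConvergenceUniformity
  have h1 : U ∈ comap (Subtype.val : Eig d lam X → C(X, ℂ)) (𝓝 f.1) := by
    rw [← nhds_induced]
    exact hU.mem_nhds hf
  obtain ⟨⟨K, ε⟩, ⟨hK, hε⟩, h⟩ := (hb.comap Subtype.val).mem_iff.1 h1
  exact ⟨K, hK, ε, hε, fun g hg => h fun x hx => by simpa [dist_eq_norm] using hg x hx⟩

theorem lap_mul_expo_comp (hX : IsOpen X) {hwc : ContinuousOn w X} {hψc : ContinuousOn ψ X}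
    {hm : Set.MapsTo ψ X X}
    (hwd : Set.MapsTo (wcomp X w ψ hwc hψc hm) (Eig d lam X) (Eig d lam X))
    {x : EuclideanSpace ℝ (Fin d)} (hx : x ∈ X) {ζ : Fin d → ℂ} (hζ : ∑ i, ζ i ^ 2 = lam) :
    lap (fun y => w y * expo ζ (ψ y)) x = lam * (w x * expo ζ (ψ x)) := by
  obtain ⟨g, hg, hgl, hgv⟩ := hwd (Eig.expo X ζ hζ).2
  have h1 : ∀ y ∈ X, w y * expo ζ (ψ y) = g y := fun y hy => hgv ⟨y, hy⟩
  have h2 : (fun y => w y * expo ζ (ψ y)) =ᶠ[𝓝 x] g := by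
    filter_upwards [hX.mem_nhds hx] with y hy using h1 y hy
  rw [(lap_congr h2).eq_of_nhds, hgl x hx, h1 x hx]

theorem exists_transport_iterate (hd : 2 ≤ d) (hw : ContDiffOn ℝ (⊤ : ℕ∞) w X)
    (hψ : ContDiffOn ℝ (⊤ : ℕ∞) ψ X) (hm : Set.MapsTo ψ X X) (hw0 : ∀ x ∈ X, w x ≠ 0)
    (hinj : Set.InjOn ψ X) (hbij : ∀ x ∈ X, Function.Bijective (fderiv ℝ ψ x))
    (hE : ∀ x ∈ X, ∀ ζ : Fin d → ℂ, ∑ i, ζ i ^ 2 = lam →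
      lap (fun y => w y * expo ζ (ψ y)) x = lam * (w x * expo ζ (ψ x)))
    {U : Set (EuclideanSpace ℝ (Fin d))} (hU : IsOpen U) (hUX : U ⊆ X)
    {h : EuclideanSpace ℝ (Fin d) → ℂ} (hh : ContDiffOn ℝ (⊤ : ℕ∞) h U)
    (hlap : ∀ x ∈ U, lap h x = lam * h x) (m : ℕ) :
    IsOpen (ψ^[m] '' U) ∧ ∃ h' : EuclideanSpace ℝ (Fin d) → ℂ,
      ContDiffOn ℝ (⊤ : ℕ∞) h' (ψ^[m] '' U) ∧ (∀ y ∈ ψ^[m] '' U, lap h' y = lam * h' y) ∧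
      ∀ x ∈ U, iterWeight w ψ m x * h' (ψ^[m] x) = h x := by
  induction m with
  | zero => simpa [iterWeight] using ⟨hU, h, hh, hlap, fun _ _ => rfl⟩
  | succ m ih =>
    obtain ⟨ho, h₁, hh₁, hl₁, he₁⟩ := ih
    have hsub : ψ^[m] '' U ⊆ X := ((hm.iterate m).mono_left hUX).image_subset
    obtain ⟨ho', h₂, hh₂, hl₂, he₂⟩ := exists_transport hd ho (hw.mono hsub) (hψ.mono hsub)
      (fun x hx => hw0 x (hsub hx)) (hinj.mono hsub) (fun x hx => hbij x (hsub hx))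
      (fun x hx => hE x (hsub hx)) hh₁ hl₁
    have himg : ψ^[m + 1] '' U = ψ '' (ψ^[m] '' U) := by
      rw [Function.iterate_succ', Set.image_comp]
    rw [himg]
    refine ⟨ho', h₂, hh₂, hl₂, fun x hx => ?_⟩
    rw [← he₁ x hx, ← he₂ _ (Set.mem_image_of_mem _ hx), Function.iterate_succ_apply', iterWeight,
      iterWeight, Finset.prod_range_succ]
    ring

theorem continuousOn_iterWeight (hw : ContinuousOn w X) (hψ : ContinuousOn ψ X)
    (hm : Set.MapsTo ψ X X) (m : ℕ) : ContinuousOn (iterWeight w ψ m) X :=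
  continuousOn_finsetProd _ fun k _ => hw.comp (hψ.iterate hm k) (hm.iterate k)

/-- The images in `ℝ^d` of concentric balls under a homeomorphism of `ℝ^d` with `X`. -/
theorem exists_nested_sets (hd : 2 ≤ d) (hX : IsOpen X) (e : X ≃ₜ EuclideanSpace ℝ (Fin d))
    {K : Set X} (hK : IsCompact K) :
    ∃ B U : Set (EuclideanSpace ℝ (Fin d)), ∃ L : Set X, IsCompact B ∧ IsOpen U ∧ IsCompact L ∧
      Subtype.val '' K ⊆ B ∧ B ⊆ U ∧ U ⊆ Subtype.val '' L ∧ IsPreconnected (U \ B) := by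
  obtain ⟨R, hR0, hR⟩ := (hK.image e.continuous).isBounded.exists_pos_norm_le
  have hc : ∀ r : ℝ, IsCompact (e ⁻¹' closedBall 0 r) := fun r =>
    e.isCompact_preimage.2 (isCompact_closedBall 0 r)
  refine ⟨Subtype.val '' (e ⁻¹' closedBall 0 R), Subtype.val '' (e ⁻¹' ball 0 (R + 1)),
    e ⁻¹' closedBall 0 (R + 1), (hc R).image continuous_subtype_val,
    hX.isOpenMap_subtype_val _ (isOpen_ball.preimage e.continuous), hc _, ?_, ?_, ?_, ?_⟩
  · exact Set.image_mono fun x hx => by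
      simpa using hR _ (Set.mem_image_of_mem e hx)
  · exact Set.image_mono (Set.preimage_mono (closedBall_subset_ball (by linarith)))
  · exact Set.image_mono (Set.preimage_mono ball_subset_closedBall)
  · have hrank : 1 < Module.rank ℝ (EuclideanSpace ℝ (Fin d)) := by
      rw [← Module.finrank_eq_rank, finrank_euclideanSpace_fin]
      exact_mod_cast hd
    rw [← Set.image_sdiff Subtype.val_injective, ← Set.preimage_sdiff, ← e.image_symm]
    exact ((isPreconnected_ball_diff_closedBall hrank hR0.le).image _
      e.symm.continuous.continuousOn).image _ continuous_subtype_val.continuousOn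

variable {hm : Set.MapsTo ψ X X} {T : Eig d lam X → Eig d lam X}

theorem topMixing_of_strongRunAway (hd : 2 ≤ d) (hX : IsOpen X)
    (e : X ≃ₜ EuclideanSpace ℝ (Fin d)) (hw : ContDiffOn ℝ (⊤ : ℕ∞) w X)
    (hψ : ContDiffOn ℝ (⊤ : ℕ∞) ψ X) (hw0 : ∀ x ∈ X, w x ≠ 0)
    (hinj : Set.InjOn ψ X) (hbij : ∀ x ∈ X, Function.Bijective (fderiv ℝ ψ x))
    (hE : ∀ x ∈ X, ∀ ζ : Fin d → ℂ, ∑ i, ζ i ^ 2 = lam →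
      lap (fun y => w y * expo ζ (ψ y)) x = lam * (w x * expo ζ (ψ x)))
    (hTf : ∀ f x, (T f).1 x = w x * f.1 ⟨ψ x, hm x.2⟩)
    (hrun : StrongRunAway (Set.MapsTo.restrict ψ X X hm)) : TopMixing T := by
  intro 𝒰 𝒱 h𝒰 h𝒱 ⟨f, hf⟩ ⟨g, hg⟩
  obtain ⟨K₁, hK₁, ε₁, hε₁, hf'⟩ := Eig.exists_norm_sub_lt_subset h𝒰 hf
  obtain ⟨K₂, hK₂, ε₂, hε₂, hg'⟩ := Eig.exists_norm_sub_lt_subset h𝒱 hg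
  obtain ⟨f₀, hf₀, hf₀l, hf₀v⟩ := f.2
  obtain ⟨g₀, hg₀, hg₀l, hg₀v⟩ := g.2
  obtain ⟨B, U, L, hB, hU, hL, hKB, hBU, hUL, hUB⟩ := exists_nested_sets hd hX e (hK₁.union hK₂)
  have hUX : U ⊆ X := hUL.trans (Subtype.coe_image_subset X L)
  obtain ⟨M, hM⟩ := hrun L hL
  refine ⟨M, fun m hMm => ?_⟩
  have hdisj : Disjoint (ψ^[m] '' U) U := by
    rw [Set.disjoint_left]
    rintro _ ⟨x, hx, rfl⟩ hy
    obtain ⟨x, hxL, rfl⟩ := hUL hx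
    obtain ⟨y, hyL, hyx⟩ := hUL hy
    have h1 : (Set.MapsTo.restrict ψ X X hm)^[m] x = y :=
      Subtype.ext ((val_iterate_restrict m x).trans hyx.symm)
    exact (Set.eq_empty_iff_forall_notMem.1 (hM m hMm)) y ⟨⟨x, hxL, h1⟩, hyL⟩
  obtain ⟨hUo, g₁, hg₁, hg₁l, hg₁v⟩ := exists_transport_iterate hd hw hψ hm hw0 hinj hbij hE hU hUX
    (hg₀.mono hUX) (fun x hx => hg₀l x (hUX hx)) m
  have hcont : ContinuousOn ψ^[m] X := hψ.continuousOn.iterate hm m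
  have hBm : IsCompact (ψ^[m] '' B) := hB.image_of_continuousOn (hcont.mono (hBU.trans hUX))
  have hpre := isPreconnected_compl_union_image hB.isClosed hU hBU hUB (hcont.mono hUX)
    ((hinj.iterate hm m).mono hUX) hUo hBm.isClosed (hdisj.mono_right hBU)
  obtain ⟨C, hC⟩ := hB.exists_bound_of_continuousOn
    ((continuousOn_iterWeight hw.continuousOn hψ.continuousOn hm m).mono (hBU.trans hUX))
  classical
  set h : EuclideanSpace ℝ (Fin d) → ℂ := fun x => if x ∈ U then f₀ x else g₁ x with hh
  have hhU : ∀ x ∈ U, h =ᶠ[𝓝 x] f₀ := fun x hx => by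
    filter_upwards [hU.mem_nhds hx] with y hy using if_pos hy
  have hhV : ∀ x ∈ ψ^[m] '' U, h =ᶠ[𝓝 x] g₁ := fun x hx => by
    filter_upwards [hUo.mem_nhds hx] with y hy using if_neg (Set.disjoint_left.1 hdisj hy)
  have hhs : ContDiffOn ℝ (⊤ : ℕ∞) h (U ∪ ψ^[m] '' U) := by
    rintro x (hx | hx)
    · exact ((hf₀.contDiffAt (hX.mem_nhds (hUX hx))).congr_of_eventuallyEq
        (hhU x hx)).contDiffWithinAt
    · exact ((hg₁.contDiffAt (hUo.mem_nhds hx)).congr_of_eventuallyEq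
        (hhV x hx)).contDiffWithinAt
  have hhl : ∀ x ∈ U ∪ ψ^[m] '' U, lap h x = lam * h x := by
    rintro x (hx | hx)
    · rw [(lap_congr (hhU x hx)).eq_of_nhds, (hhU x hx).eq_of_nhds, hf₀l x (hUX hx)]
    · rw [(lap_congr (hhV x hx)).eq_of_nhds, (hhV x hx).eq_of_nhds, hg₁l x hx]
  have hε : 0 < min ε₁ (ε₂ / (|C| + 1)) := lt_min hε₁ (by positivity)
  obtain ⟨F, hF, hFl, hFa⟩ := exists_entire_norm_sub_lt (by omega : 0 < d) (hB.union hBm)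
    (hU.union hUo) (Set.union_subset_union hBU (Set.image_mono hBU)) hpre hhs hhl hε
  refine ⟨T^[m] (Eig.ofEntire X F hF hFl), ⟨_, hf' _ fun x hx => ?_, rfl⟩, hg' _ fun x hx => ?_⟩
  · have hxB : (x : EuclideanSpace ℝ (Fin d)) ∈ B := hKB ⟨x, Or.inl hx, rfl⟩
    have h1 := (hFa x (Or.inl hxB)).trans_le (min_le_left _ _)
    rw [(hhU x (hBU hxB)).eq_of_nhds] at h1
    rw [hf₀v]
    exact h1
  · have hxB : (x : EuclideanSpace ℝ (Fin d)) ∈ B := hKB ⟨x, Or.inr hx, rfl⟩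
    have hyB := Set.mem_image_of_mem ψ^[m] hxB
    have h1 := (hFa _ (Or.inr hyB)).trans_le (min_le_right _ _)
    rw [(hhV _ (Set.image_mono hBU hyB)).eq_of_nhds] at h1
    have h2 : (Eig.ofEntire X F hF hFl).1 ((Set.MapsTo.restrict ψ X X hm)^[m] x) =
        F (ψ^[m] x) := congrArg F (val_iterate_restrict m x)
    rw [iterate_wcomp_apply hTf, h2, hg₀v, ← hg₁v x (hBU hxB), ← mul_sub, norm_mul]
    calc ‖iterWeight w ψ m x‖ * ‖F (ψ^[m] x) - g₁ (ψ^[m] x)‖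
        ≤ |C| * ‖F (ψ^[m] x) - g₁ (ψ^[m] x)‖ := by
          gcongr
          exact (hC x hxB).trans (le_abs_self C)
      _ ≤ (|C| + 1) * ‖F (ψ^[m] x) - g₁ (ψ^[m] x)‖ := by
          gcongr
          linarith
      _ < (|C| + 1) * (ε₂ / (|C| + 1)) := by gcongr
      _ = ε₂ := by field_simp

end Sufficiency

/-- for `d ≥ 2`, `λ ∈ ℂ`, `X ⊆ ℝ^d` open and homeomorphic to `ℝ^d`, and smooth
`w`, `ψ` such that `C_{w,ψ}` maps `E_λ(X)` into itself, `C_{w,ψ}` is topologically mixing on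
`E_λ(X)` (compact-open topology) iff `w` has no zeros, `ψ` is injective, strong run-away, and
has invertible derivative everywhere. -/
theorem stmt16 (d : ℕ) (hd : 2 ≤ d) (lam : ℂ)
    (X : Set (EuclideanSpace ℝ (Fin d))) (hXopen : IsOpen X)
    (hhomeo : Nonempty (↥X ≃ₜ EuclideanSpace ℝ (Fin d)))
    (w : EuclideanSpace ℝ (Fin d) → ℂ)
    (ψ : EuclideanSpace ℝ (Fin d) → EuclideanSpace ℝ (Fin d))
    (hw : ContDiffOn ℝ (⊤ : ℕ∞) w X) (hψ : ContDiffOn ℝ (⊤ : ℕ∞) ψ X)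
    (hm : Set.MapsTo ψ X X)
    (hwd : Set.MapsTo (wcomp X w ψ hw.continuousOn hψ.continuousOn hm)
      (Eig d lam X) (Eig d lam X)) :
    TopMixing (Set.MapsTo.restrict _ _ _ hwd) ↔
      ((∀ x ∈ X, w x ≠ 0) ∧ Set.InjOn ψ X ∧
        StrongRunAway (Set.MapsTo.restrict ψ X X hm) ∧
        ∀ x ∈ X, Function.Bijective (fderiv ℝ ψ x)) := by
  have hTf : ∀ (f : Eig d lam X) (x : X),
      (Set.MapsTo.restrict _ _ _ hwd f).1 x = w x * f.1 ⟨ψ x, hm x.2⟩ := fun _ _ => rfl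
  refine ⟨fun hT => ⟨weight_ne_zero_of_topMixing hd hTf hT, injOn_of_topMixing hd hTf hT,
    strongRunAway_of_topMixing hd hTf hT,
    bijective_fderiv_of_topMixing hd hXopen hw hψ hTf hT⟩, ?_⟩
  rintro ⟨hw0, hinj, hrun, hbij⟩
  obtain ⟨e⟩ := hhomeo
  exact topMixing_of_strongRunAway hd hXopen e hw hψ hw0 hinj hbij
    (fun x hx ζ hζ => lap_mul_expo_comp hXopen hwd hx hζ) hTf hrun
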